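/- Let δ₃ = 0.074267, δ₄ = 0.103974, δ_ℓ = 0.124821 for ℓ ≥ 5, and θ_ℓ = ℓ − δ_ℓ. For every integer ℓ ≥ 3, setting α = θ_ℓ/(2θ_ℓ − 2), the quadruple (4, ℓ; α, α) is admissible: for every ε > 0 there exists M such that for every integer m ≥ M and every integer a with gcd(a,m) = 1, there exist primes p₁, p₂, p₃, p₄ ≤ m^{α+ε} and a positive integer s ≤ m^{α+ε} which is a product of at most ℓ primes (counted with multiplicity), such that p₁·p₂·p₃·p₄·s ≡ a (mod m). -/

import Mathlib

/-- The Greaves sieve constants δ_ℓ. -/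
noncomputable def greavesDelta (l : ℕ) : ℝ :=
  if l ≤ 2 then 0.044560
  else if l = 3 then 0.074267
  else if l = 4 then 0.103974
  else 0.124821

/-- θ_ℓ = ℓ - δ_ℓ. -/
noncomputable def greavesTheta (l : ℕ) : ℝ := l - greavesDelta l


open ArithmeticFunction in
lemma ar_log_factorial (N : ℕ) :
    Real.log (N.factorial : ℝ) = ∑ d ∈ Finset.Icc 1 N, vonMangoldt d * ((N / d : ℕ) : ℝ) := by
  have h1 : Real.log (N.factorial : ℝ) = ∑ k ∈ Finset.Icc 1 N, Real.log (k : ℝ) := by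
    rw [← Finset.prod_Ico_id_eq_factorial, show Finset.Ico 1 (N + 1) = Finset.Icc 1 N from rfl]
    push_cast
    rw [Real.log_prod]
    intro x hx
    have := (Finset.mem_Icc.1 hx).1
    positivity
  rw [h1]
  have h2 : ∀ k ∈ Finset.Icc 1 N, Real.log (k : ℝ) =
      ∑ d ∈ Finset.Icc 1 N, if d ∣ k then vonMangoldt d else 0 := by
    intro k hk
    rw [← vonMangoldt_sum, ← Finset.sum_filter]
    apply Finset.sum_congr _ (fun _ _ => rfl)
    ext d
    have hk' := Finset.mem_Icc.1 hk
    simp only [Nat.mem_divisors, Finset.mem_filter, Finset.mem_Icc]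
    constructor
    · rintro ⟨h, _⟩
      exact ⟨⟨Nat.pos_of_dvd_of_pos h (by omega), (Nat.le_of_dvd (by omega) h).trans hk'.2⟩, h⟩
    · rintro ⟨_, h⟩
      exact ⟨h, by omega⟩
  rw [Finset.sum_congr rfl h2, Finset.sum_comm]
  apply Finset.sum_congr rfl
  intro d hd
  rw [← Finset.sum_filter, Finset.sum_const, nsmul_eq_mul, mul_comm]
  congr 2
  rw [← Nat.Ioc_filter_dvd_card_eq_div]
  rfl

open ArithmeticFunction in
lemma ar_mertens_nat (N : ℕ) (hN : 1 ≤ N) :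
    Real.log N - 1 ≤ ∑ d ∈ Finset.Icc 1 N, vonMangoldt d / (d : ℝ) ∧
    ∑ d ∈ Finset.Icc 1 N, vonMangoldt d / (d : ℝ) ≤ Real.log N + 6 := by
  have hNp : (0 : ℝ) < N := by exact_mod_cast hN
  have hl := ar_log_factorial N
  have e : (N : ℝ) * ∑ d ∈ Finset.Icc 1 N, vonMangoldt d / (d : ℝ) =
      ∑ d ∈ Finset.Icc 1 N, vonMangoldt d * ((N : ℝ) / d) := by
    rw [Finset.mul_sum]; apply Finset.sum_congr rfl; intro d _; ring
  constructor
  · have h1 : Real.log (N.factorial : ℝ) ≤ ∑ d ∈ Finset.Icc 1 N, vonMangoldt d * ((N : ℝ) / d) := by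
      rw [hl]
      apply Finset.sum_le_sum
      intro d _
      exact mul_le_mul_of_nonneg_left Nat.cast_div_le vonMangoldt_nonneg
    have h2 : (N : ℝ) * Real.log N - N ≤ Real.log (N.factorial : ℝ) := by
      have := Stirling.le_log_factorial_stirling (n := N) (by omega)
      have h3 : 0 ≤ Real.log N := Real.log_natCast_nonneg N
      have h4 : 0 ≤ Real.log (2 * Real.pi) := Real.log_nonneg (by nlinarith [Real.pi_gt_three])
      linarith
    have : (N : ℝ) * (Real.log N - 1) ≤ N * ∑ d ∈ Finset.Icc 1 N, vonMangoldt d / (d : ℝ) := by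
      rw [e]; linarith
    exact le_of_mul_le_mul_left this hNp
  · have h1 : ∑ d ∈ Finset.Icc 1 N, vonMangoldt d * ((N : ℝ) / d) ≤
        Real.log (N.factorial : ℝ) + Chebyshev.psi N := by
      rw [hl, Chebyshev.psi, Nat.floor_natCast]
      have : Finset.Ioc 0 N = Finset.Icc 1 N := rfl
      rw [this, ← Finset.sum_add_distrib]
      apply Finset.sum_le_sum
      intro d hd
      have hd1 := (Finset.mem_Icc.1 hd).1
      have h5 : (N : ℝ) / d ≤ ((N / d : ℕ) : ℝ) + 1 := by
        rw [div_le_iff₀ (by exact_mod_cast hd1)]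
        have := (Nat.lt_div_mul_add (a := N) (b := d) hd1).le
        have h6 : (N : ℝ) ≤ ((N / d * d + d : ℕ) : ℝ) := by exact_mod_cast this
        push_cast at h6
        linarith
      have := mul_le_mul_of_nonneg_left h5 (vonMangoldt_nonneg (n := d))
      linarith
    have h2 : Real.log (N.factorial : ℝ) ≤ N * Real.log N := by
      rw [← Real.log_pow]
      apply Real.log_le_log (by positivity)
      exact_mod_cast Nat.factorial_le_pow N
    have h3 := Chebyshev.psi_le_const_mul_self (x := N) hNp.le
    have h4 : Real.log 4 ≤ 2 := by
      have : Real.log 4 = 2 * Real.log 2 := by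
        rw [show (4:ℝ) = 2 ^ 2 by norm_num, Real.log_pow]; norm_num
      have := Real.log_two_lt_d9
      linarith
    have : (N : ℝ) * ∑ d ∈ Finset.Icc 1 N, vonMangoldt d / (d : ℝ) ≤ N * (Real.log N + 6) := by
      rw [e]; nlinarith
    exact le_of_mul_le_mul_left this hNp

open ArithmeticFunction in
lemma ar_mertens_real (t : ℝ) (ht : 1 ≤ t) :
    Real.log t - 2 ≤ ∑ d ∈ Finset.Icc 0 ⌊t⌋₊, vonMangoldt d / (d : ℝ) ∧
    ∑ d ∈ Finset.Icc 0 ⌊t⌋₊, vonMangoldt d / (d : ℝ) ≤ Real.log t + 6 := by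
  have h1 : 1 ≤ ⌊t⌋₊ := (Nat.one_le_floor_iff t).2 ht
  have e : ∑ d ∈ Finset.Icc 0 ⌊t⌋₊, vonMangoldt d / (d : ℝ) =
      ∑ d ∈ Finset.Icc 1 ⌊t⌋₊, vonMangoldt d / (d : ℝ) := by
    rw [← Finset.add_sum_Ioc_eq_sum_Icc (Nat.zero_le _)]
    simp
    rfl
  obtain ⟨h2, h3⟩ := ar_mertens_nat _ h1
  have hf : (⌊t⌋₊ : ℝ) ≤ t := Nat.floor_le (by linarith)
  have hf1 : (1 : ℝ) ≤ ⌊t⌋₊ := by exact_mod_cast h1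
  have hf2 : t < ⌊t⌋₊ + 1 := Nat.lt_floor_add_one t
  rw [e]
  constructor
  · have : Real.log t ≤ Real.log 2 + Real.log ⌊t⌋₊ := by
      rw [← Real.log_mul (by norm_num) (by positivity)]
      exact Real.log_le_log (by linarith) (by linarith)
    have := Real.log_two_lt_d9
    linarith
  · have := Real.log_le_log (by linarith) hf
    linarith

/-- Primes `p` with `x ≤ p < y`. -/
noncomputable def primesIn (x y : ℝ) : Finset ℕ :=
  (Finset.range ⌈y⌉₊).filter (fun p => p.Prime ∧ x ≤ (p : ℝ))

lemma mem_primesIn {x y : ℝ} {p : ℕ} : p ∈ primesIn x y ↔ p.Prime ∧ x ≤ (p : ℝ) ∧ (p : ℝ) < y := by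
  simp only [primesIn, Finset.mem_filter, Finset.mem_range, Nat.lt_ceil]
  tauto

open ArithmeticFunction in
lemma ar_mertens2_vm (x y : ℝ) (hx : 2 ≤ x) (hxy : x ≤ y) :
    ∑ k ∈ Finset.Ioc ⌊x⌋₊ ⌊y⌋₊, (Real.log k)⁻¹ * (vonMangoldt k / (k : ℝ)) ≤
      Real.log (Real.log y / Real.log x) + 14 / Real.log x := by
  have hlx : 0 < Real.log x := Real.log_pos (by linarith)
  have hly : 0 < Real.log y := Real.log_pos (by linarith)
  have hlxy : Real.log x ≤ Real.log y := Real.log_le_log (by linarith) hxy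
  have hd : ∀ t ∈ Set.Icc x y, HasDerivAt (fun t => (Real.log t)⁻¹) (-(t⁻¹) / (Real.log t)^2) t := by
    intro t ht
    have ht0 : t ≠ 0 := by have := ht.1; intro h; linarith
    have := (Real.hasDerivAt_log ht0).inv (Real.log_pos (by have := ht.1; linarith)).ne'
    exact this
  have hcont : ∀ g : ℝ → ℝ, ContinuousOn g (Set.Icc x y) → ContinuousOn g (Set.uIcc x y) := by
    intro g hg; rwa [Set.uIcc_of_le hxy]
  have hlogc : ContinuousOn Real.log (Set.Icc x y) :=
    Real.continuousOn_log.mono (fun t ht => by have := ht.1; simp; intro h; linarith)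
  have hlogne : ∀ t ∈ Set.Icc x y, Real.log t ≠ 0 := fun t ht =>
    (Real.log_pos (by have := ht.1; linarith)).ne'
  have htne : ∀ t ∈ Set.Icc x y, t ≠ 0 := fun t ht => by have := ht.1; intro h; linarith
  have hc2 : ContinuousOn (fun t : ℝ => -(t⁻¹) / (Real.log t)^2) (Set.Icc x y) := by
    apply ContinuousOn.div
    · exact (continuousOn_id.inv₀ htne).neg
    · exact hlogc.pow 2
    · intro t ht; exact pow_ne_zero 2 (hlogne t ht)
  have hderiv : ∀ t ∈ Set.Icc x y, deriv (fun t => (Real.log t)⁻¹) t = -(t⁻¹) / (Real.log t)^2 :=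
    fun t ht => (hd t ht).deriv
  have hintg : MeasureTheory.IntegrableOn (deriv (fun t => (Real.log t)⁻¹)) (Set.Icc x y) := by
    apply (MeasureTheory.integrableOn_congr_fun hderiv measurableSet_Icc).2
    exact hc2.integrableOn_Icc
  have key := sum_mul_eq_sub_sub_integral_mul (fun k => vonMangoldt k / (k : ℝ))
    (f := fun t => (Real.log t)⁻¹) (by linarith : (0:ℝ) ≤ x) hxy
    (fun t ht => (hd t ht).differentiableAt) hintg
  rw [key]
  set A : ℝ → ℝ := fun t => ∑ k ∈ Finset.Icc 0 ⌊t⌋₊, vonMangoldt k / (k : ℝ) with hA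
  have hAx := ar_mertens_real x (by linarith)
  have hAy := ar_mertens_real y (by linarith)
  change Real.log x - 2 ≤ A x ∧ A x ≤ _ at hAx
  change Real.log y - 2 ≤ A y ∧ A y ≤ _ at hAy
  change (Real.log y)⁻¹ * A y - (Real.log x)⁻¹ * A x -
    ∫ t in Set.Ioc x y, deriv (fun t => (Real.log t)⁻¹) t * A t ≤ _
  -- integral
  have hG : ∀ t ∈ Set.uIcc x y, HasDerivAt (fun t => Real.log (Real.log t) - 6 * (Real.log t)⁻¹)
      (t⁻¹ / Real.log t + 6 * (t⁻¹ / (Real.log t)^2)) t := by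
    intro t ht
    rw [Set.uIcc_of_le hxy] at ht
    have h1 := (Real.hasDerivAt_log (htne t ht)).log (hlogne t ht)
    have h2 := (hd t ht).const_mul 6
    refine (h1.sub h2).congr_deriv ?_
    ring
  have hGc : ContinuousOn (fun t => t⁻¹ / Real.log t + 6 * (t⁻¹ / (Real.log t)^2)) (Set.Icc x y) := by
    apply ContinuousOn.add
    · exact ContinuousOn.div (continuousOn_id.inv₀ htne) hlogc hlogne
    · apply ContinuousOn.mul continuousOn_const
      exact ContinuousOn.div (continuousOn_id.inv₀ htne) (hlogc.pow 2)
        (fun t ht => pow_ne_zero 2 (hlogne t ht))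
  have hI := intervalIntegral.integral_eq_sub_of_hasDerivAt hG
    ((hcont _ hGc).intervalIntegrable)
  have hmono : -(∫ t in Set.Ioc x y, deriv (fun t => (Real.log t)⁻¹) t * A t) ≤
      ∫ t in x..y, (t⁻¹ / Real.log t + 6 * (t⁻¹ / (Real.log t)^2)) := by
    rw [intervalIntegral.integral_of_le hxy, ← MeasureTheory.integral_neg]
    apply MeasureTheory.setIntegral_mono_on
    · apply MeasureTheory.Integrable.neg
      have := integrableOn_mul_sum_Icc (m := 0) (fun k => vonMangoldt k / (k : ℝ))
        (by linarith : (0:ℝ) ≤ x) hintg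
      exact this.mono_set Set.Ioc_subset_Icc_self
    · exact hGc.integrableOn_Icc.mono_set Set.Ioc_subset_Icc_self
    · exact measurableSet_Ioc
    · intro t ht
      have ht' : t ∈ Set.Icc x y := Set.Ioc_subset_Icc_self ht
      rw [hderiv t ht']
      have hlt : 0 < Real.log t := Real.log_pos (by have := ht'.1; linarith)
      have htp : 0 < t := by have := ht'.1; linarith
      have hAt := (ar_mertens_real t (by have := ht'.1; linarith)).2
      change A t ≤ _ at hAt
      have : -(-(t⁻¹) / (Real.log t)^2 * A t) = (t⁻¹ / (Real.log t)^2) * A t := by ring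
      rw [this]
      calc (t⁻¹ / (Real.log t)^2) * A t ≤ (t⁻¹ / (Real.log t)^2) * (Real.log t + 6) :=
            mul_le_mul_of_nonneg_left hAt (by positivity)
        _ = _ := by field_simp
  rw [hI] at hmono
  have e1 : Real.log (Real.log y / Real.log x) = Real.log (Real.log y) - Real.log (Real.log x) :=
    Real.log_div hly.ne' hlx.ne'
  have e2 : (Real.log y)⁻¹ * A y ≤ 1 + 6 * (Real.log y)⁻¹ := by
    calc (Real.log y)⁻¹ * A y ≤ (Real.log y)⁻¹ * (Real.log y + 6) :=
          mul_le_mul_of_nonneg_left hAy.2 (by positivity)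
      _ = _ := by field_simp
  have e3 : 1 - 2 * (Real.log x)⁻¹ ≤ (Real.log x)⁻¹ * A x := by
    calc _ = (Real.log x)⁻¹ * (Real.log x - 2) := by field_simp
      _ ≤ _ := mul_le_mul_of_nonneg_left hAx.1 (by positivity)
  have e4 : (Real.log y)⁻¹ ≤ (Real.log x)⁻¹ := inv_anti₀ hlx hlxy
  rw [e1, div_eq_mul_inv]
  have : 0 < (Real.log x)⁻¹ := by positivity
  linarith

open ArithmeticFunction in
lemma ar_mertens2 (x y : ℝ) (hx : 2 ≤ x) (hxy : x ≤ y) :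
    ∑ p ∈ primesIn x y, (1 : ℝ) / p ≤ Real.log (Real.log y / Real.log x) + 15 / Real.log x := by
  have hlx : 0 < Real.log x := Real.log_pos (by linarith)
  have h1 := ar_mertens2_vm x y hx hxy
  have hsub : primesIn x y ⊆ insert ⌊x⌋₊ ((Finset.Ioc ⌊x⌋₊ ⌊y⌋₊).filter Nat.Prime) := by
    intro p hp
    obtain ⟨h1, h2, h3⟩ := mem_primesIn.1 hp
    have h4 : ⌊x⌋₊ ≤ p := Nat.floor_le_of_le h2
    have h5 : p ≤ ⌊y⌋₊ := Nat.le_floor h3.le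
    simp only [Finset.mem_insert, Finset.mem_filter, Finset.mem_Ioc]
    rcases h4.eq_or_lt with h | h
    · left; exact h.symm
    · right; exact ⟨⟨h, h5⟩, h1⟩
  by_cases hm : ⌊x⌋₊ ∈ primesIn x y
  all_goals
    have hs2 : ∑ p ∈ (Finset.Ioc ⌊x⌋₊ ⌊y⌋₊).filter Nat.Prime, (1 : ℝ) / p ≤
      ∑ k ∈ Finset.Ioc ⌊x⌋₊ ⌊y⌋₊, (Real.log k)⁻¹ * (vonMangoldt k / (k : ℝ)) := by
      rw [Finset.sum_filter]
      apply Finset.sum_le_sum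
      intro k hk
      split_ifs with hp
      · rw [vonMangoldt_apply_prime hp]
        have : 0 < Real.log k := Real.log_pos (by exact_mod_cast hp.one_lt)
        apply le_of_eq
        field_simp
      · have := vonMangoldt_nonneg (n := k)
        have := Real.log_natCast_nonneg k
        positivity
  · have hx2 : x ≤ (⌊x⌋₊ : ℝ) := (mem_primesIn.1 hm).2.1
    have hfl : (⌊x⌋₊ : ℝ) = x := le_antisymm (Nat.floor_le (by linarith)) hx2
    have h2 : ∑ p ∈ primesIn x y, (1 : ℝ) / p ≤
        ∑ p ∈ insert ⌊x⌋₊ ((Finset.Ioc ⌊x⌋₊ ⌊y⌋₊).filter Nat.Prime), (1 : ℝ) / p :=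
      Finset.sum_le_sum_of_subset_of_nonneg hsub (fun _ _ _ => by positivity)
    rw [Finset.sum_insert (by simp), hfl] at h2
    have h3 : 1 / x ≤ 1 / Real.log x :=
      one_div_le_one_div_of_le hlx (Real.log_le_self (by linarith))
    have : 15 / Real.log x = 14 / Real.log x + 1 / Real.log x := by ring
    linarith
  · have h2 : ∑ p ∈ primesIn x y, (1 : ℝ) / p ≤
        ∑ p ∈ ((Finset.Ioc ⌊x⌋₊ ⌊y⌋₊).filter Nat.Prime), (1 : ℝ) / p := by
      apply Finset.sum_le_sum_of_subset_of_nonneg _ (fun _ _ _ => by positivity)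
      intro p hp
      rcases Finset.mem_insert.1 (hsub hp) with h | h
      · exact absurd (h ▸ hp) hm
      · exact h
    have : 15 / Real.log x = 14 / Real.log x + 1 / Real.log x := by ring
    have : 0 < 1 / Real.log x := by positivity
    linarith

/-- Upper Mertens bound for the Euler product. -/
lemma ar_mertens3 (x y : ℝ) (hx : 2 ≤ x) (hxy : x ≤ y) :
    ∑ p ∈ primesIn x y, (-Real.log (1 - 1 / (p : ℝ))) ≤
      Real.log (Real.log y / Real.log x) + 19 / Real.log x := by
  have hlx : 0 < Real.log x := Real.log_pos (by linarith)
  have h1 := ar_mertens2 x y hx hxy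
  have h2 : ∀ p ∈ primesIn x y, -Real.log (1 - 1 / (p : ℝ)) ≤ 1 / p + 2 * ((p : ℝ) ^ 2)⁻¹ := by
    intro p hp
    have hp2 : (2 : ℝ) ≤ p := by exact_mod_cast (mem_primesIn.1 hp).1.two_le
    have hpos : 0 < 1 - 1 / (p : ℝ) := by
      rw [sub_pos, div_lt_one (by linarith)]; linarith
    rw [← Real.log_inv]
    have h3 := Real.log_le_sub_one_of_pos (inv_pos.2 hpos)
    refine h3.trans ?_
    have e : (1 - 1 / (p : ℝ))⁻¹ - 1 = 1 / (p - 1) := by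
      have : (p : ℝ) - 1 ≠ 0 := by linarith
      have h5 : (1 - 1 / (p : ℝ)) = (p - 1) / p := by field_simp
      rw [h5, inv_div]; field_simp; ring
    rw [e]
    have e2 : 1 / (p : ℝ) + 2 * ((p : ℝ) ^ 2)⁻¹ = (p + 2) / (p : ℝ)^2 := by field_simp
    rw [e2, div_le_div_iff₀ (by linarith) (by positivity)]
    nlinarith
  have h3 : ∑ p ∈ primesIn x y, ((p : ℝ) ^ 2)⁻¹ ≤ 2 / Real.log x := by
    have hs : primesIn x y ⊆ Finset.Ioo (⌈x⌉₊ - 1) (⌈y⌉₊) := by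
      intro p hp
      obtain ⟨a1, a2, a3⟩ := mem_primesIn.1 hp
      rw [Finset.mem_Ioo]
      have a4 : ⌈x⌉₊ ≤ p := Nat.ceil_le.2 a2
      have a5 : 0 < ⌈x⌉₊ := Nat.ceil_pos.2 (by linarith)
      exact ⟨by omega, Nat.lt_ceil.2 a3⟩
    have h4 := Finset.sum_le_sum_of_subset_of_nonneg (f := fun p : ℕ => ((p : ℝ) ^ 2)⁻¹) hs
      (fun _ _ _ => by positivity)
    refine h4.trans ((sum_Ioo_inv_sq_le _ _).trans ?_)
    have a5 : 1 ≤ ⌈x⌉₊ := Nat.ceil_pos.2 (by linarith)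
    rw [Nat.cast_sub a5]
    have := Nat.le_ceil x
    apply div_le_div_of_nonneg_left (by norm_num) hlx
    have := Real.log_le_self (x := x) (by linarith)
    push_cast
    linarith
  calc _ ≤ ∑ p ∈ primesIn x y, ((1:ℝ) / p + 2 * ((p : ℝ) ^ 2)⁻¹) := Finset.sum_le_sum h2
    _ = ∑ p ∈ primesIn x y, (1:ℝ) / p + 2 * ∑ p ∈ primesIn x y, ((p : ℝ) ^ 2)⁻¹ := by
        rw [Finset.sum_add_distrib, Finset.mul_sum]
    _ ≤ _ := by
      have : 19 / Real.log x = 15 / Real.log x + 2 * (2 / Real.log x) := by ring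
      linarith

/-- Elementary symmetric sums. -/
noncomputable def es (S : Finset ℕ) (k : ℕ) (x : ℕ → ℝ) : ℝ :=
  ∑ T ∈ S.powersetCard k, ∏ p ∈ T, x p

noncomputable def tr (S : Finset ℕ) (k : ℕ) (x : ℕ → ℝ) : ℝ :=
  ∑ i ∈ Finset.range (k + 1), (-1) ^ i * es S i x

lemma es_zero (S : Finset ℕ) (x : ℕ → ℝ) : es S 0 x = 1 := by simp [es]

lemma es_insert {S : Finset ℕ} {a : ℕ} (ha : a ∉ S) (k : ℕ) (x : ℕ → ℝ) :
    es (insert a S) (k + 1) x = es S (k + 1) x + x a * es S k x := by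
  unfold es
  rw [Finset.powersetCard_succ_insert ha, Finset.sum_union, Finset.sum_image, Finset.mul_sum]
  · congr 1
    apply Finset.sum_congr rfl
    intro T hT
    rw [Finset.prod_insert]
    intro h
    exact ha ((Finset.mem_powersetCard.1 hT).1 h)
  · intro T hT T' hT' h
    have h1 : a ∉ T := fun h => ha ((Finset.mem_powersetCard.1 hT).1 h)
    have h2 : a ∉ T' := fun h => ha ((Finset.mem_powersetCard.1 hT').1 h)
    rw [← Finset.erase_insert h1, ← Finset.erase_insert h2, h]
  · rw [Finset.disjoint_left]
    intro T hT hT'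
    obtain ⟨T', _, rfl⟩ := Finset.mem_image.1 hT'
    exact ha ((Finset.mem_powersetCard.1 hT).1 (Finset.mem_insert_self a T'))

lemma es_nonneg (S : Finset ℕ) (k : ℕ) (x : ℕ → ℝ) (hx : ∀ p ∈ S, 0 ≤ x p) : 0 ≤ es S k x := by
  apply Finset.sum_nonneg
  intro T hT
  exact Finset.prod_nonneg (fun p hp => hx p ((Finset.mem_powersetCard.1 hT).1 hp))

lemma tr_zero (S : Finset ℕ) (x : ℕ → ℝ) : tr S 0 x = 1 := by simp [tr, es_zero]

lemma tr_succ (S : Finset ℕ) (k : ℕ) (x : ℕ → ℝ) :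
    tr S (k + 1) x = tr S k x + (-1) ^ (k + 1) * es S (k + 1) x := by
  unfold tr; rw [Finset.sum_range_succ]

lemma tr_insert {S : Finset ℕ} {a : ℕ} (ha : a ∉ S) (k : ℕ) (x : ℕ → ℝ) :
    tr (insert a S) (k + 1) x = tr S (k + 1) x - x a * tr S k x := by
  induction k with
  | zero => rw [tr_succ, tr_succ, tr_zero, tr_zero, es_insert ha, es_zero]; ring
  | succ k ih => rw [tr_succ, ih, tr_succ S (k + 1), tr_succ S k, es_insert ha]; ring

lemma bonf (S : Finset ℕ) (x : ℕ → ℝ) (hx : ∀ p ∈ S, 0 ≤ x p ∧ x p ≤ 1) (k : ℕ) :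
    0 ≤ (-1) ^ k * (tr S k x - ∏ p ∈ S, (1 - x p)) ∧
    (-1) ^ k * (tr S k x - ∏ p ∈ S, (1 - x p)) ≤ es S (k + 1) x := by
  induction S using Finset.induction_on generalizing k with
  | empty =>
    have h1 : ∀ k, es ∅ (k + 1) x = 0 := by
      intro k; unfold es; rw [Finset.powersetCard_eq_empty.2 (by simp)]; simp
    have h2 : ∀ k, tr ∅ k x = 1 := by
      intro k
      induction k with
      | zero => exact tr_zero _ _
      | succ k ih => rw [tr_succ, ih, h1]; simp
    rw [h1, h2]; simp
  | insert a S ha ih =>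
    have hS : ∀ p ∈ S, 0 ≤ x p ∧ x p ≤ 1 := fun p hp => hx p (Finset.mem_insert_of_mem hp)
    have hxa := hx a (Finset.mem_insert_self _ _)
    rw [Finset.prod_insert ha]
    cases k with
    | zero =>
      have h0 := ih hS 0
      have hp0 : 0 ≤ ∏ p ∈ S, (1 - x p) :=
        Finset.prod_nonneg (fun p hp => by have := hS p hp; linarith)
      have hp1 : ∏ p ∈ S, (1 - x p) ≤ 1 :=
        Finset.prod_le_one (fun p hp => by have := hS p hp; linarith)
          (fun p hp => by have := hS p hp; linarith)
      rw [es_insert ha, es_zero, tr_zero]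
      rw [tr_zero] at h0
      simp only [pow_zero, one_mul, zero_add] at h0 ⊢
      constructor <;> nlinarith
    | succ k =>
      have h1 := ih hS (k + 1)
      have h0 := ih hS k
      rw [tr_insert ha, es_insert ha]
      have e : (-1 : ℝ) ^ (k + 1) * (tr S (k + 1) x - x a * tr S k x - (1 - x a) * ∏ p ∈ S, (1 - x p))
        = (-1) ^ (k + 1) * (tr S (k + 1) x - ∏ p ∈ S, (1 - x p)) +
          x a * ((-1) ^ k * (tr S k x - ∏ p ∈ S, (1 - x p))) := by ring
      rw [e]
      constructor
      · have := mul_nonneg hxa.1 h0.1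
        linarith [h1.1]
      · have := mul_le_mul_of_nonneg_left h0.2 hxa.1
        linarith [h1.2]

lemma bern_aux (s x : ℝ) (hs : 0 ≤ s) (hx : 0 ≤ x) (k : ℕ) :
    s ^ (k + 1) + (k + 1) * (x * s ^ k) ≤ (s + x) ^ (k + 1) := by
  induction k with
  | zero => simp
  | succ k ih =>
    have h := mul_le_mul_of_nonneg_right ih (by linarith : 0 ≤ s + x)
    rw [pow_succ (s + x) (k + 1)]
    refine le_trans ?_ h
    have : 0 ≤ (k + 1) * (x * s ^ k) * x := by positivity
    push_cast
    ring_nf at this ⊢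
    nlinarith

lemma es_le (S : Finset ℕ) (x : ℕ → ℝ) (hx : ∀ p ∈ S, 0 ≤ x p) (k : ℕ) :
    es S k x ≤ (∑ p ∈ S, x p) ^ k / (k.factorial : ℝ) := by
  induction S using Finset.induction_on generalizing k with
  | empty =>
    cases k with
    | zero => simp [es_zero]
    | succ k => 
      unfold es; rw [Finset.powersetCard_eq_empty.2 (by simp)]; simp
  | insert a S ha ih =>
    have hS : ∀ p ∈ S, 0 ≤ x p := fun p hp => hx p (Finset.mem_insert_of_mem hp)
    have hxa := hx a (Finset.mem_insert_self _ _)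
    cases k with
    | zero => simp [es_zero]
    | succ k =>
      have hs : 0 ≤ ∑ p ∈ S, x p := Finset.sum_nonneg hS
      rw [es_insert ha, Finset.sum_insert ha]
      have h1 := ih hS (k + 1)
      have h0 := mul_le_mul_of_nonneg_left (ih hS k) hxa
      have h2 := bern_aux _ _ hs hxa k
      refine (add_le_add h1 h0).trans ?_
      rw [Nat.factorial_succ]
      push_cast
      have hk : (0:ℝ) < k.factorial := by positivity
      have e : (∑ p ∈ S, x p) ^ (k + 1) / (((k:ℝ) + 1) * k.factorial) +
        x a * ((∑ p ∈ S, x p) ^ k / k.factorial) =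
        ((∑ p ∈ S, x p) ^ (k + 1) + (k + 1) * (x a * (∑ p ∈ S, x p) ^ k)) /
          (((k:ℝ) + 1) * k.factorial) := by field_simp
      rw [e, add_comm (x a)]
      gcongr

/-- Sieve polynomial: multilinear polynomial supported on subsets of `Q`. -/
def SV (Q : Finset ℕ) (B D : ℝ) (F : (ℕ → ℝ) → ℝ) : Prop :=
  ∃ c : Finset ℕ → ℝ, (∀ x, F x = ∑ T ∈ Q.powerset, c T * ∏ p ∈ T, x p) ∧
    (∀ T, |c T| ≤ B) ∧ (∀ T ∈ Q.powerset, c T ≠ 0 → ∏ p ∈ T, (p : ℝ) ≤ D)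

lemma SV.mono {Q : Finset ℕ} {B B' D D' : ℝ} {F : (ℕ → ℝ) → ℝ} (h : SV Q B D F) (hB : B ≤ B')
    (hD : D ≤ D') : SV Q B' D' F := by
  obtain ⟨c, h1, h2, h3⟩ := h
  exact ⟨c, h1, fun T => (h2 T).trans hB, fun T hT hc => (h3 T hT hc).trans hD⟩

lemma SV.sub {Q : Finset ℕ} {B B' D : ℝ} {F F' : (ℕ → ℝ) → ℝ} (h : SV Q B D F)
    (h' : SV Q B' D F') : SV Q (B + B') D (fun x => F x - F' x) := by
  obtain ⟨c, h1, h2, h3⟩ := h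
  obtain ⟨c', h1', h2', h3'⟩ := h'
  refine ⟨fun T => c T - c' T, ?_, ?_, ?_⟩
  · intro x; beta_reduce; rw [h1, h1', ← Finset.sum_sub_distrib]
    apply Finset.sum_congr rfl; intros; ring
  · intro T; exact (abs_sub _ _).trans (add_le_add (h2 T) (h2' T))
  · intro T hT hc
    by_cases h : c T = 0
    · apply h3' T hT
      intro h'; apply hc; simp [h, h']
    · exact h3 T hT h

lemma SV.mul {Q Q' : Finset ℕ} (hd : Disjoint Q Q') {B B' D D' : ℝ} {F F' : (ℕ → ℝ) → ℝ}
    (h : SV Q B D F) (h' : SV Q' B' D' F') (hD : 0 ≤ D) :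
    SV (Q ∪ Q') (B * B') (D * D') (fun x => F x * F' x) := by
  obtain ⟨c, h1, h2, h3⟩ := h
  obtain ⟨c', h1', h2', h3'⟩ := h'
  have split : ∀ T ∈ (Q ∪ Q').powerset, ∀ f : ℕ → ℝ, ∏ p ∈ T, f p =
      (∏ p ∈ T ∩ Q, f p) * ∏ p ∈ T ∩ Q', f p := by
    intro T hT f
    rw [← Finset.prod_union, ← Finset.inter_union_distrib_left,
      Finset.inter_eq_left.2 (Finset.mem_powerset.1 hT)]
    exact hd.mono Finset.inter_subset_right Finset.inter_subset_right
  refine ⟨fun T => c (T ∩ Q) * c' (T ∩ Q'), ?_, ?_, ?_⟩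
  · intro x
    beta_reduce
    rw [h1, h1', Finset.sum_mul_sum, ← Finset.sum_product']
    symm
    apply Finset.sum_bij' (fun T _ => (T ∩ Q, T ∩ Q')) (fun P _ => P.1 ∪ P.2)
    · intro T hT; simp
    · intro P hP
      simp only [Finset.mem_product, Finset.mem_powerset] at hP ⊢
      exact Finset.union_subset_union hP.1 hP.2
    · intro T hT
      simp only
      rw [← Finset.inter_union_distrib_left, Finset.inter_eq_left.2 (Finset.mem_powerset.1 hT)]
    · intro P hP
      simp only [Finset.mem_product, Finset.mem_powerset] at hP
      rw [Finset.disjoint_left] at hd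
      ext p
      · simp only [Finset.mem_inter, Finset.mem_union]
        constructor
        · rintro ⟨h | h, h'⟩
          · exact h
          · exact absurd (hP.2 h) (hd h')
        · intro h; exact ⟨Or.inl h, hP.1 h⟩
      · simp only [Finset.mem_inter, Finset.mem_union]
        constructor
        · rintro ⟨h | h, h'⟩
          · exact absurd h' (hd (hP.1 h))
          · exact h
        · intro h; exact ⟨Or.inr h, hP.2 h⟩
    · intro T hT
      rw [split T hT]; ring
  · intro T
    rw [abs_mul]
    exact mul_le_mul (h2 _) (h2' _) (abs_nonneg _) ((abs_nonneg _).trans (h2 ∅))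
  · intro T hT hc
    rw [split T hT]
    apply mul_le_mul (h3 _ (by simp) (left_ne_zero_of_mul hc))
      (h3' _ (by simp) (right_ne_zero_of_mul hc))
    · exact Finset.prod_nonneg (fun _ _ => by positivity)
    · exact hD

/-- General card-weighted polynomials. -/
lemma SV.card (S : Finset ℕ) (g : ℕ → ℝ) (K : ℕ) (hg : ∀ i, |g i| ≤ 1) (hgK : ∀ i, K < i → g i = 0)
    (b : ℝ) (hb : 1 ≤ b) (hS : ∀ p ∈ S, (p : ℝ) ≤ b) :
    SV S 1 (b ^ K) (fun x => ∑ T ∈ S.powerset, g T.card * ∏ p ∈ T, x p) := by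
  refine ⟨fun T => g T.card, fun x => rfl, fun T => hg _, ?_⟩
  intro T hT hc
  have h1 : T.card ≤ K := by
    by_contra h; exact hc (hgK _ (by omega))
  calc ∏ p ∈ T, (p : ℝ) ≤ ∏ p ∈ T, b :=
        Finset.prod_le_prod (fun _ _ => by positivity) (fun p hp => hS p (Finset.mem_powerset.1 hT hp))
    _ = b ^ T.card := by simp
    _ ≤ b ^ K := pow_le_pow_right₀ hb h1

lemma es_eq (S : Finset ℕ) (k : ℕ) (x : ℕ → ℝ) :
    es S k x = ∑ T ∈ S.powerset, (if T.card = k then 1 else 0) * ∏ p ∈ T, x p := by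
  unfold es
  rw [Finset.powersetCard_eq_filter, Finset.sum_filter]
  apply Finset.sum_congr rfl
  intros; split_ifs <;> simp

lemma SV.es (S : Finset ℕ) (K : ℕ) (b : ℝ) (hb : 1 ≤ b) (hS : ∀ p ∈ S, (p : ℝ) ≤ b) :
    SV S 1 (b ^ K) (fun x => es S K x) := by
  have := SV.card S (fun i => if i = K then 1 else 0) K (fun i => by split_ifs <;> simp)
    (fun i hi => by simp; omega) b hb hS
  convert this using 2
  rw [es_eq]

lemma SV.tr (S : Finset ℕ) (K : ℕ) (b : ℝ) (hb : 1 ≤ b) (hS : ∀ p ∈ S, (p : ℝ) ≤ b) :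
    SV S 1 (b ^ K) (fun x => tr S K x) := by
  have := SV.card S (fun i => if i ≤ K then (-1) ^ i else 0) K (fun i => by split_ifs <;> simp)
    (fun i hi => by simp; omega) b hb hS
  convert this using 2 with x
  unfold _root_.tr
  simp_rw [es_eq, Finset.mul_sum]
  rw [Finset.sum_comm]
  apply Finset.sum_congr rfl
  intro T hT
  simp only [ite_mul, one_mul, zero_mul, mul_ite, mul_zero]
  rw [Finset.sum_ite_eq]
  simp only [Finset.mem_range, Nat.lt_succ_iff]

lemma SV.full (S : Finset ℕ) (hS : ∀ p ∈ S, 1 ≤ p) :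
    SV S 1 (∏ p ∈ S, (p : ℝ)) (fun x => ∏ p ∈ S, (1 - x p)) := by
  refine ⟨fun T => (-1) ^ T.card, ?_, fun T => by simp, ?_⟩
  · intro x
    simp_rw [sub_eq_add_neg, add_comm (1 : ℝ), Finset.prod_add_one]
    apply Finset.sum_congr rfl
    intro T _
    rw [Finset.prod_neg]
  · intro T hT _
    have h : ∏ p ∈ T, p ≤ ∏ p ∈ S, p :=
      Finset.prod_le_prod_of_subset_of_one_le' (Finset.mem_powerset.1 hT) (fun p hp _ => hS p hp)
    rw [← Nat.cast_prod, ← Nat.cast_prod]; exact Nat.cast_le.2 h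

/-- The invariant of the Brun-Hooley recursion. -/
def BHInv (Q : Finset ℕ) (DU DL BL σ : ℝ) (U Lw : (ℕ → ℝ) → ℝ) : Prop :=
  SV Q 1 DU U ∧ SV Q BL DL Lw ∧
  (∀ x : ℕ → ℝ, (∀ p, 0 ≤ x p ∧ x p ≤ 1) →
    Lw x ≤ ∏ p ∈ Q, (1 - x p) ∧ ∏ p ∈ Q, (1 - x p) ≤ U x) ∧
  U (fun p => 1 / (p : ℝ)) ≤ (∏ p ∈ Q, (1 - 1 / (p : ℝ))) * Real.exp σ ∧
  (∏ p ∈ Q, (1 - 1 / (p : ℝ))) * (1 - 1.031 * σ) ≤ Lw (fun p => 1 / (p : ℝ))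

lemma inv_unit (p : ℕ) : 0 ≤ 1 / (p : ℝ) ∧ 1 / (p : ℝ) ≤ 1 := by
  refine ⟨by positivity, ?_⟩
  rcases Nat.eq_zero_or_pos p with h | h
  · simp [h]
  · rw [div_le_one (by positivity)]; exact_mod_cast h

lemma exp_small : Real.exp 0.0303 ≤ 1.031 := by
  have := Real.exp_bound' (x := 0.0303) (by norm_num) (by norm_num) (n := 3) (by norm_num)
  refine this.trans ?_
  norm_num [Finset.sum_range_succ, Nat.factorial]

lemma bh_step {Q S : Finset ℕ} (hd : Disjoint Q S) {DU DL BL σ ρ b DU' DL' : ℝ} {k : ℕ}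
    (hk : Even k) {U Lw : (ℕ → ℝ) → ℝ} (h : BHInv Q DU DL BL σ U Lw)
    (hb : 1 ≤ b) (hS : ∀ p ∈ S, (p : ℝ) ≤ b)
    (hDU : 0 ≤ DU) (hDL : 0 ≤ DL) (hρ : 0 ≤ ρ) (hσρ : σ + ρ ≤ 0.0303)
    (hes : es S (k + 1) (fun p => 1 / (p : ℝ)) ≤ ρ * ∏ p ∈ S, (1 - 1 / (p : ℝ)))
    (h1 : DU * b ^ k ≤ DU') (h2 : DL * b ^ k ≤ DL') (h3 : DU * b ^ (k + 1) ≤ DL') :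
    ∃ U' Lw', BHInv (Q ∪ S) DU' DL' (BL + 1) (σ + ρ) U' Lw' := by
  obtain ⟨a1, a2, a3, a4, a5⟩ := h
  have hpr : ∀ (A : Finset ℕ) (x : ℕ → ℝ), (∀ p, 0 ≤ x p ∧ x p ≤ 1) → 0 ≤ ∏ p ∈ A, (1 - x p) :=
    fun A x hx => Finset.prod_nonneg (fun p _ => by have := hx p; linarith)
  have hbon : ∀ x : ℕ → ℝ, (∀ p, 0 ≤ x p ∧ x p ≤ 1) → ∏ p ∈ S, (1 - x p) ≤ tr S k x ∧
      tr S k x - es S (k + 1) x ≤ ∏ p ∈ S, (1 - x p) ∧ 0 ≤ es S (k + 1) x := by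
    intro x hx
    have := bonf S x (fun p _ => hx p) k
    rw [hk.neg_one_pow] at this
    exact ⟨by linarith, by linarith, es_nonneg _ _ _ (fun p _ => (hx p).1)⟩
  have u1 := a1.mul hd (SV.tr S k b hb hS) hDU
  have u2 := (a2.mul hd (SV.tr S k b hb hS) hDL).mono le_rfl h2
  have u3 := (a1.mul hd (SV.es S (k + 1) b hb hS) hDU).mono le_rfl h3
  refine ⟨_, _, u1.mono (by norm_num) h1, (u2.sub u3).mono (by linarith) le_rfl, ?_, ?_, ?_⟩
  · intro x hx
    rw [Finset.prod_union hd]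
    obtain ⟨b1, b2, b3⟩ := hbon x hx
    obtain ⟨c1, c2⟩ := a3 x hx
    have hV := hpr Q x hx
    have hv := hpr S x hx
    constructor
    · have e1 : Lw x * tr S k x ≤ (∏ p ∈ Q, (1 - x p)) * tr S k x :=
        mul_le_mul_of_nonneg_right c1 (hv.trans b1)
      have e2 : (∏ p ∈ Q, (1 - x p)) * es S (k + 1) x ≤ U x * es S (k + 1) x :=
        mul_le_mul_of_nonneg_right c2 b3
      have e3 := mul_le_mul_of_nonneg_left b2 hV
      linarith
    · exact mul_le_mul c2 b1 hv (hV.trans c2)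
  · rw [Finset.prod_union hd]
    obtain ⟨b1, b2, b3⟩ := hbon _ inv_unit
    have hV := hpr Q _ inv_unit
    have hv := hpr S _ inv_unit
    have e1 : tr S k (fun p => 1 / (p : ℝ)) ≤ (∏ p ∈ S, (1 - 1 / (p : ℝ))) * Real.exp ρ := by
      have : 1 + ρ ≤ Real.exp ρ := by linarith [Real.add_one_le_exp ρ]
      have := mul_le_mul_of_nonneg_left this hv
      linarith
    rw [Real.exp_add]
    calc _ ≤ ((∏ p ∈ Q, (1 - 1 / (p : ℝ))) * Real.exp σ) *
          ((∏ p ∈ S, (1 - 1 / (p : ℝ))) * Real.exp ρ) :=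
          mul_le_mul a4 e1 (hv.trans b1) (by positivity)
      _ = _ := by ring
  · rw [Finset.prod_union hd]
    obtain ⟨b1, b2, b3⟩ := hbon _ inv_unit
    have hV := hpr Q _ inv_unit
    have hv := hpr S _ inv_unit
    have hexp : Real.exp σ ≤ 1.031 :=
      (Real.exp_le_exp.2 (by linarith)).trans exp_small
    set V := ∏ p ∈ Q, (1 - 1 / (p : ℝ))
    set v := ∏ p ∈ S, (1 - 1 / (p : ℝ))
    have e0 : 0 ≤ V * (1 - 1.031 * σ) := mul_nonneg hV (by linarith)
    have e1 : V * (1 - 1.031 * σ) * v ≤ Lw (fun p => 1 / (p : ℝ)) * tr S k (fun p => 1 / (p : ℝ)) :=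
      mul_le_mul a5 b1 hv (e0.trans a5)
    have e2 : U (fun p => 1 / (p : ℝ)) * es S (k + 1) (fun p => 1 / (p : ℝ)) ≤
        (V * 1.031) * (ρ * v) :=
      mul_le_mul (a4.trans (mul_le_mul_of_nonneg_left hexp hV)) hes b3 (by positivity)
    calc _ = V * (1 - 1.031 * σ) * v - (V * 1.031) * (ρ * v) := by ring
      _ ≤ _ := by linarith

noncomputable def kk (j : ℕ) : ℕ := 4 + 2 * (j / 2)
noncomputable def rr (j : ℕ) : ℝ := 0.0147 / 40 ^ (j / 2)

lemma rr_pos (j : ℕ) : 0 ≤ rr j := by unfold rr; positivity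

lemma kk_even (j : ℕ) : Even (kk j) := by unfold kk; exact ⟨2 + j / 2, by ring⟩

lemma sum_rr_even (i : ℕ) : ∑ j ∈ Finset.range (2 * i), rr j ≤ 0.0302 - 0.0302 / 40 ^ i := by
  induction i with
  | zero => simp
  | succ i ih =>
    rw [show 2 * (i + 1) = 2 * i + 1 + 1 by ring, Finset.sum_range_succ, Finset.sum_range_succ]
    have e1 : rr (2 * i) = 0.0147 / 40 ^ i := by unfold rr; congr 2; omega
    have e2 : rr (2 * i + 1) = 0.0147 / 40 ^ i := by unfold rr; congr 2; omega
    rw [e1, e2, pow_succ]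
    have : (0:ℝ) < 1 / 40 ^ i := by positivity
    have h1 : (0.0147:ℝ) / 40 ^ i = 0.0147 * (1 / 40 ^ i) := by ring
    have h2 : (0.0302:ℝ) / 40 ^ i = 0.0302 * (1 / 40 ^ i) := by ring
    have h3 : (0.0302:ℝ) / (40 ^ i * 40) = 0.0302 / 40 * (1 / 40 ^ i) := by field_simp
    rw [h2] at ih
    rw [h1, h3]
    linarith

lemma sum_rr (J : ℕ) : ∑ j ∈ Finset.range J, rr j ≤ 0.0302 := by
  have h1 : ∑ j ∈ Finset.range J, rr j ≤ ∑ j ∈ Finset.range (2 * J), rr j :=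
    Finset.sum_le_sum_of_subset_of_nonneg (Finset.range_mono (by omega)) (fun _ _ _ => rr_pos _)
  have := sum_rr_even J
  have : (0:ℝ) < 0.0302 / 40 ^ J := by positivity
  linarith

lemma sum_kk_even (i : ℕ) : ∑ j ∈ Finset.range (2 * i), (kk j : ℝ) * (2 / 5 : ℝ) ^ j ≤
    7.5 - (7.5 + 3.4 * i) * (4 / 25) ^ i := by
  induction i with
  | zero => simp
  | succ i ih =>
    rw [show 2 * (i + 1) = 2 * i + 1 + 1 by ring, Finset.sum_range_succ, Finset.sum_range_succ]
    have e1 : (kk (2 * i) : ℝ) = 4 + 2 * i := by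
      unfold kk; rw [show 2 * i / 2 = i by omega]; push_cast; ring
    have e2 : (kk (2 * i + 1) : ℝ) = 4 + 2 * i := by
      unfold kk; rw [show (2 * i + 1) / 2 = i by omega]; push_cast; ring
    have e3 : (2 / 5 : ℝ) ^ (2 * i) = (4 / 25) ^ i := by rw [pow_mul]; norm_num
    rw [e1, e2, pow_succ (2 / 5 : ℝ), e3, pow_succ]
    have : (0:ℝ) < (4 / 25) ^ i := by positivity
    have hi : (0:ℝ) ≤ (i:ℝ) * (4 / 25) ^ i := by positivity
    push_cast
    nlinarith

lemma sum_kk (J : ℕ) : ∑ j ∈ Finset.range J, (kk j : ℝ) * (2 / 5 : ℝ) ^ j ≤ 7.5 := by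
  have h1 : ∑ j ∈ Finset.range J, (kk j : ℝ) * (2 / 5 : ℝ) ^ j ≤
      ∑ j ∈ Finset.range (2 * J), (kk j : ℝ) * (2 / 5 : ℝ) ^ j :=
    Finset.sum_le_sum_of_subset_of_nonneg (Finset.range_mono (by omega))
      (fun _ _ _ => by positivity)
  have := sum_kk_even J
  have : (0:ℝ) < (7.5 + 3.4 * J) * (4 / 25) ^ J := by positivity
  linarith

lemma rr_bound (j : ℕ) : Real.exp 0.93 * (0.93 ^ (kk j + 1) / ((kk j + 1).factorial : ℝ)) ≤ rr j := by
  unfold kk rr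
  generalize j / 2 = i
  induction i with
  | zero =>
    have := Real.exp_bound' (x := 0.93) (by norm_num) (by norm_num) (n := 9) (by norm_num)
    have h2 : Real.exp 0.93 ≤ 2.535 := by
      refine this.trans ?_
      norm_num [Finset.sum_range_succ, Nat.factorial]
    norm_num [Nat.factorial] at h2 ⊢
    linarith
  | succ i ih =>
    have e : (4 + 2 * (i + 1) + 1) = (4 + 2 * i + 1) + 1 + 1 := by ring
    rw [e, Nat.factorial_succ, Nat.factorial_succ, pow_succ (0.93 : ℝ), pow_succ (0.93 : ℝ),
      pow_succ (40 : ℝ)]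
    push_cast
    set A : ℝ := 0.93 ^ (4 + 2 * i + 1)
    set F : ℝ := ((4 + 2 * i + 1).factorial : ℝ) with hF
    have hF0 : 0 < F := by rw [hF]; positivity
    have hA : 0 < A := by positivity
    have hi : (0:ℝ) ≤ i := by positivity
    calc Real.exp 0.93 * (A * 0.93 * 0.93 / ((4 + 2 * (i:ℝ) + 2 + 1) * ((4 + 2 * (i:ℝ) + 1 + 1) * F)))
        = (Real.exp 0.93 * (A / F)) * (0.93 * 0.93 / ((4 + 2 * (i:ℝ) + 2 + 1) * (4 + 2 * (i:ℝ) + 1 + 1))) := by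
          field_simp
      _ ≤ (0.0147 / 40 ^ i) * (1 / 40) := by
          apply mul_le_mul ih _ (by positivity) (by positivity)
          rw [div_le_div_iff₀ (by positivity) (by norm_num)]
          nlinarith
      _ = 0.0147 / (40 ^ i * 40) := by field_simp

lemma log_five_half : Real.log (5 / 2) ≤ 0.9164 := by
  rw [Real.log_le_iff_le_exp (by norm_num)]
  refine le_trans ?_ (Real.sum_le_exp_of_nonneg (by norm_num) 10)
  norm_num [Finset.sum_range_succ, Nat.factorial]

noncomputable def wc : ℝ := Real.exp 1400
noncomputable def c0c : ℝ := ∏ p ∈ primesIn 2 wc, (p : ℝ)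
noncomputable def bb (z : ℝ) (J : ℕ) : ℝ := max wc (z ^ ((2 / 5 : ℝ) ^ J))

lemma wc_ge : 2 ≤ wc := by
  unfold wc; have := Real.add_one_le_exp (1400:ℝ); linarith

lemma c0c_ge : 1 ≤ c0c := by
  unfold c0c
  rw [← Nat.cast_prod]
  exact_mod_cast Finset.prod_pos (fun p hp => (mem_primesIn.1 hp).1.pos)

lemma bb_succ_le (z : ℝ) (hz : wc ≤ z) (J : ℕ) : bb z (J + 1) ≤ bb z J := by
  have := wc_ge
  unfold bb
  apply max_le_max le_rfl
  apply Real.rpow_le_rpow_of_exponent_le (by linarith)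
  exact pow_le_pow_of_le_one (by norm_num) (by norm_num) (by omega)

lemma bb_zero (z : ℝ) (hz : wc ≤ z) : bb z 0 = z := by
  unfold bb; simp [hz]

lemma bb_le (z : ℝ) (hz : wc ≤ z) (J : ℕ) : bb z J ≤ z := by
  induction J with
  | zero => rw [bb_zero z hz]
  | succ J ih => exact (bb_succ_le z hz J).trans ih

lemma bb_range (z : ℝ) (hz : wc ≤ z) (J : ℕ) (R : ℕ → Prop) [DecidablePred R] :
    ∑ p ∈ (primesIn (bb z (J + 1)) (bb z J)).filter R, (-Real.log (1 - 1 / (p : ℝ))) ≤ 0.93 := by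
  have hw := wc_ge
  have h1 : ∀ p ∈ primesIn (bb z (J + 1)) (bb z J), 0 ≤ -Real.log (1 - 1 / (p : ℝ)) := by
    intro p hp
    have := Real.log_nonpos (x := 1 - 1 / (p : ℝ)) (by have := inv_unit p; linarith)
      (by have := inv_unit p; linarith)
    linarith
  refine (Finset.sum_le_sum_of_subset_of_nonneg (Finset.filter_subset _ _)
    (fun p hp _ => h1 p hp)).trans ?_
  have hb1 : wc ≤ bb z (J + 1) := le_max_left _ _
  have hlw : Real.log wc = 1400 := by unfold wc; rw [Real.log_exp]
  have hl1 : 1400 ≤ Real.log (bb z (J + 1)) := by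
    rw [← hlw]; exact Real.log_le_log (by linarith) hb1
  refine (ar_mertens3 _ _ (by linarith) (bb_succ_le z hz J)).trans ?_
  have h2 : Real.log (bb z J) ≤ 5 / 2 * Real.log (bb z (J + 1)) := by
    unfold bb
    rcases le_total (z ^ ((2 / 5 : ℝ) ^ J)) wc with h | h
    · rw [max_eq_left h]
      have : Real.log wc ≤ Real.log (max wc (z ^ ((2 / 5 : ℝ) ^ (J + 1)))) :=
        Real.log_le_log (by linarith) (le_max_left _ _)
      linarith
    · rw [max_eq_right h]
      have hzp : 0 < z := by linarith
      have : Real.log (z ^ ((2 / 5 : ℝ) ^ (J + 1))) ≤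
          Real.log (max wc (z ^ ((2 / 5 : ℝ) ^ (J + 1)))) :=
        Real.log_le_log (by positivity) (le_max_right _ _)
      rw [Real.log_rpow hzp] at this ⊢
      have e : (2 / 5 : ℝ) ^ (J + 1) * Real.log z = 2 / 5 * ((2 / 5 : ℝ) ^ J * Real.log z) := by
        rw [pow_succ]; ring
      rw [e] at this
      linarith
  have h3 : Real.log (Real.log (bb z J) / Real.log (bb z (J + 1))) ≤ Real.log (5 / 2) := by
    have hp : 0 < Real.log (bb z J) := Real.log_pos (by have := bb_succ_le z hz J; linarith)
    apply Real.log_le_log (by positivity)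
    rw [div_le_iff₀ (by linarith)]; exact h2
  have h4 : 19 / Real.log (bb z (J + 1)) ≤ 19 / 1400 :=
    div_le_div_of_nonneg_left (by norm_num) (by norm_num) hl1
  have := log_five_half
  norm_num at this h3 h4 ⊢
  linarith

lemma es_range (S : Finset ℕ) (hS : ∀ p ∈ S, p.Prime)
    (h : ∑ p ∈ S, (-Real.log (1 - 1 / (p : ℝ))) ≤ 0.93) (j : ℕ) :
    es S (kk j + 1) (fun p => 1 / (p : ℝ)) ≤ rr j * ∏ p ∈ S, (1 - 1 / (p : ℝ)) := by
  have hpos : ∀ p ∈ S, 0 < 1 - 1 / (p : ℝ) := by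
    intro p hp
    have : (1:ℝ) < p := by exact_mod_cast (hS p hp).one_lt
    rw [sub_pos, div_lt_one (by linarith)]; exact this
  have h1 : ∑ p ∈ S, 1 / (p : ℝ) ≤ 0.93 := by
    refine (Finset.sum_le_sum ?_).trans h
    intro p hp
    have := Real.log_le_sub_one_of_pos (hpos p hp)
    linarith
  have h0 : 0 ≤ ∑ p ∈ S, 1 / (p : ℝ) := Finset.sum_nonneg (fun _ _ => by positivity)
  have h2 : 1 ≤ Real.exp 0.93 * ∏ p ∈ S, (1 - 1 / (p : ℝ)) := by
    have : ∏ p ∈ S, (1 - 1 / (p : ℝ)) = Real.exp (-∑ p ∈ S, (-Real.log (1 - 1 / (p : ℝ)))) := by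
      rw [Finset.sum_neg_distrib, neg_neg, Real.exp_sum]
      exact Finset.prod_congr rfl (fun p hp => (Real.exp_log (hpos p hp)).symm)
    rw [this, ← Real.exp_add]
    apply Real.one_le_exp; linarith
  have hp0 : 0 ≤ ∏ p ∈ S, (1 - 1 / (p : ℝ)) := Finset.prod_nonneg (fun p hp => (hpos p hp).le)
  have h3 := es_le S (fun p => 1 / (p : ℝ)) (fun p _ => by positivity) (kk j + 1)
  have h4 : (∑ p ∈ S, 1 / (p : ℝ)) ^ (kk j + 1) / ((kk j + 1).factorial : ℝ) ≤
      0.93 ^ (kk j + 1) / ((kk j + 1).factorial : ℝ) := by gcongr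
  have h5 := rr_bound j
  set a : ℝ := 0.93 ^ (kk j + 1) / ((kk j + 1).factorial : ℝ)
  have ha : 0 ≤ a := by positivity
  calc _ ≤ a := h3.trans h4
    _ ≤ a * (Real.exp 0.93 * ∏ p ∈ S, (1 - 1 / (p : ℝ))) := le_mul_of_one_le_right ha h2
    _ = (Real.exp 0.93 * a) * ∏ p ∈ S, (1 - 1 / (p : ℝ)) := by ring
    _ ≤ _ := mul_le_mul_of_nonneg_right h5 hp0

lemma bh_ind (z : ℝ) (hz : wc ≤ z) (R : ℕ → Prop) [DecidablePred R] (J : ℕ) :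
    ∃ U Lw, BHInv ((primesIn 2 wc ∪ primesIn (bb z J) z).filter R)
      (c0c * z ^ (∑ j ∈ Finset.range J, (kk j : ℝ) * (2 / 5 : ℝ) ^ j))
      (c0c * z ^ (∑ j ∈ Finset.range J, (kk j : ℝ) * (2 / 5 : ℝ) ^ j + 1))
      (J + 1) (∑ j ∈ Finset.range J, rr j) U Lw := by
  have hw := wc_ge
  have hc := c0c_ge
  have hz0 : 0 < z := by linarith
  induction J with
  | zero =>
    have hQ : (primesIn 2 wc ∪ primesIn (bb z 0) z) = primesIn 2 wc := by
      rw [bb_zero z hz]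
      ext p; simp only [Finset.mem_union, mem_primesIn]
      constructor
      · rintro (h | h)
        · exact h
        · linarith [h.2.1, h.2.2]
      · intro h; exact Or.inl h
    rw [hQ]
    have h1 := SV.full ((primesIn 2 wc).filter R)
      (fun p hp => (mem_primesIn.1 (Finset.mem_filter.1 hp).1).1.one_le)
    have h2 : ∏ p ∈ (primesIn 2 wc).filter R, (p : ℝ) ≤ c0c := by
      unfold c0c
      rw [← Nat.cast_prod, ← Nat.cast_prod]
      apply Nat.cast_le.2
      exact Finset.prod_le_prod_of_subset_of_one_le' (Finset.filter_subset _ _)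
        (fun p hp _ => (mem_primesIn.1 hp).1.one_le)
    refine ⟨_, _, h1.mono le_rfl ?_, h1.mono ?_ ?_, ?_, ?_, ?_⟩
    · simpa using h2
    · simp
    · simp only [Finset.range_zero, Finset.sum_empty, zero_add, Real.rpow_one]
      nlinarith
    · intro x hx; exact ⟨le_rfl, le_rfl⟩
    · simp
    · simp
  | succ J ih =>
    obtain ⟨U, Lw, h⟩ := ih
    have hQ : (primesIn 2 wc ∪ primesIn (bb z (J + 1)) z).filter R =
        (primesIn 2 wc ∪ primesIn (bb z J) z).filter R ∪
          (primesIn (bb z (J + 1)) (bb z J)).filter R := by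
      have h1 := bb_le z hz J
      have h2 := bb_succ_le z hz J
      ext p
      simp only [Finset.mem_union, Finset.mem_filter, mem_primesIn]
      constructor
      · rintro ⟨h | h, hR⟩
        · exact Or.inl ⟨Or.inl h, hR⟩
        · rcases lt_or_ge (p : ℝ) (bb z J) with h3 | h3
          · exact Or.inr ⟨⟨h.1, h.2.1, h3⟩, hR⟩
          · exact Or.inl ⟨Or.inr ⟨h.1, h3, h.2.2⟩, hR⟩
      · rintro (⟨h | h, hR⟩ | ⟨h, hR⟩)
        · exact ⟨Or.inl h, hR⟩
        · exact ⟨Or.inr ⟨h.1, h2.trans h.2.1, h.2.2⟩, hR⟩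
        · exact ⟨Or.inr ⟨h.1, h.2.1, h.2.2.trans_le h1⟩, hR⟩
    have hd : Disjoint ((primesIn 2 wc ∪ primesIn (bb z J) z).filter R)
        ((primesIn (bb z (J + 1)) (bb z J)).filter R) := by
      rw [Finset.disjoint_left]
      intro p h1 h2
      simp only [Finset.mem_union, Finset.mem_filter, mem_primesIn] at h1 h2
      have : wc ≤ bb z (J + 1) := le_max_left _ _
      rcases h1.1 with h | h
      · linarith [h.2.2, h2.1.2.1]
      · linarith [h.2.1, h2.1.2.2]
    rw [hQ, Finset.sum_range_succ (fun j => rr j)]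
    have hsum := sum_rr (J + 1)
    rw [Finset.sum_range_succ] at hsum
    have hb1 : 1 ≤ z ^ ((2 / 5 : ℝ) ^ J) := Real.one_le_rpow (by linarith) (by positivity)
    have hpow : ∀ n : ℕ, (z ^ ((2 / 5 : ℝ) ^ J)) ^ n = z ^ ((n : ℝ) * (2 / 5 : ℝ) ^ J) := by
      intro n
      rw [← Real.rpow_natCast, ← Real.rpow_mul hz0.le, mul_comm]
    have hres := bh_step hd (kk_even J) h (b := z ^ ((2 / 5 : ℝ) ^ J)) (ρ := rr J) hb1 ?_
      (by positivity) (by positivity) (rr_pos J)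
      (by linarith) (es_range _ (fun p hp => (mem_primesIn.1 (Finset.mem_filter.1 hp).1).1)
        (bb_range z hz J R) J)
      (DU' := (c0c * z ^ (∑ j ∈ Finset.range (J + 1), (kk j : ℝ) * (2 / 5 : ℝ) ^ j)))
      (DL' := (c0c * z ^ (∑ j ∈ Finset.range (J + 1), (kk j : ℝ) * (2 / 5 : ℝ) ^ j + 1))) ?_ ?_ ?_
    · obtain ⟨U', Lw', h'⟩ := hres
      refine ⟨U', Lw', ?_⟩
      push_cast
      exact h'
    · intro p hp
      obtain ⟨h1, h2, h3⟩ := mem_primesIn.1 (Finset.mem_filter.1 hp).1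
      have : wc ≤ bb z (J + 1) := le_max_left _ _
      unfold bb at h3
      rcases lt_max_iff.1 h3 with h4 | h4
      · linarith
      · exact h4.le
    · rw [hpow, mul_assoc, ← Real.rpow_add hz0, Finset.sum_range_succ]
    · rw [hpow, mul_assoc, ← Real.rpow_add hz0, Finset.sum_range_succ]
      apply le_of_eq; congr 2; ring
    · rw [hpow, mul_assoc, ← Real.rpow_add hz0, Finset.sum_range_succ]
      apply mul_le_mul_of_nonneg_left _ (by linarith)
      apply Real.rpow_le_rpow_of_exponent_le (by linarith)
      push_cast
      have : (2 / 5 : ℝ) ^ J ≤ 1 := pow_le_one₀ (by norm_num) (by norm_num)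
      linarith

/-- The Brun-Hooley sieve in the form used. -/
theorem brun_hooley (z : ℝ) (hz : wc ≤ z) (R : ℕ → Prop) [DecidablePred R] :
    ∃ U Lw, SV ((primesIn 2 z).filter R) 1 (c0c * z ^ (7.5 : ℝ)) U ∧
      SV ((primesIn 2 z).filter R) (Real.log z + 2) (c0c * z ^ (8.5 : ℝ)) Lw ∧
      (∀ x : ℕ → ℝ, (∀ p, 0 ≤ x p ∧ x p ≤ 1) →
        Lw x ≤ ∏ p ∈ (primesIn 2 z).filter R, (1 - x p) ∧
          ∏ p ∈ (primesIn 2 z).filter R, (1 - x p) ≤ U x) ∧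
      U (fun p => 1 / (p : ℝ)) ≤ (∏ p ∈ (primesIn 2 z).filter R, (1 - 1 / (p : ℝ))) * 1.031 ∧
      (∏ p ∈ (primesIn 2 z).filter R, (1 - 1 / (p : ℝ))) * 0.968 ≤ Lw (fun p => 1 / (p : ℝ)) := by
  have hw := wc_ge
  have hc := c0c_ge
  have hz1 : 1 ≤ z := by linarith
  have hlz : 0 < Real.log z := Real.log_pos (by linarith)
  obtain ⟨U, Lw, a1, a2, a3, a4, a5⟩ := bh_ind z hz R ⌈Real.log z⌉₊
  set J := ⌈Real.log z⌉₊ with hJ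
  have hJ1 : Real.log z ≤ J := Nat.le_ceil _
  have hJ2 : (J : ℝ) < Real.log z + 1 := Nat.ceil_lt_add_one hlz.le
  have hbb : bb z J = wc := by
    unfold bb
    apply max_eq_left
    rw [← Real.log_le_log_iff (by positivity) (by linarith), Real.log_rpow (by linarith)]
    have e1 : (2 / 5 : ℝ) ^ J * (5 / 2 : ℝ) ^ J = 1 := by rw [← mul_pow]; norm_num
    have e2 := one_add_mul_le_pow (a := (3 / 2 : ℝ)) (by norm_num) J
    have e3 : Real.log wc = 1400 := by unfold wc; rw [Real.log_exp]
    rw [e3]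
    have e4 : Real.log z ≤ (5 / 2 : ℝ) ^ J := by
      norm_num at e2
      have : (0:ℝ) ≤ J := by positivity
      linarith
    have e5 := mul_le_mul_of_nonneg_left e4 (by positivity : (0:ℝ) ≤ (2 / 5) ^ J)
    linarith
  have hQ : primesIn 2 wc ∪ primesIn (bb z J) z = primesIn 2 z := by
    rw [hbb]
    ext p
    simp only [Finset.mem_union, mem_primesIn]
    constructor
    · rintro (h | h)
      · exact ⟨h.1, h.2.1, by linarith [h.2.2]⟩
      · exact ⟨h.1, by linarith [h.2.1], h.2.2⟩
    · rintro ⟨h1, h2, h3⟩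
      rcases lt_or_ge (p : ℝ) wc with h | h
      · exact Or.inl ⟨h1, h2, h⟩
      · exact Or.inr ⟨h1, h, h3⟩
  rw [hQ] at a1 a2 a3 a4 a5
  have hs := sum_kk J
  have hr := sum_rr J
  have hr0 : 0 ≤ ∑ j ∈ Finset.range J, rr j := Finset.sum_nonneg (fun _ _ => rr_pos _)
  have hV : 0 ≤ ∏ p ∈ (primesIn 2 z).filter R, (1 - 1 / (p : ℝ)) :=
    Finset.prod_nonneg (fun p _ => by have := inv_unit p; linarith)
  refine ⟨U, Lw, a1.mono le_rfl ?_, a2.mono (by linarith) ?_, a3, a4.trans ?_, le_trans ?_ a5⟩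
  · exact mul_le_mul_of_nonneg_left (Real.rpow_le_rpow_of_exponent_le hz1 hs) (by linarith)
  · exact mul_le_mul_of_nonneg_left (Real.rpow_le_rpow_of_exponent_le hz1 (by norm_num at hs ⊢; linarith)) (by linarith)
  · exact mul_le_mul_of_nonneg_left ((Real.exp_le_exp.2 (by linarith)).trans exp_small) hV
  · exact mul_le_mul_of_nonneg_left (by linarith) hV

lemma card_pf_le (k : ℕ) (hk : k ≠ 0) : k.primeFactors.card ≤ Nat.log 2 k := by
  apply Nat.le_log_of_pow_le (by norm_num)
  calc 2 ^ k.primeFactors.card = ∏ p ∈ k.primeFactors, 2 := by simp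
    _ ≤ ∏ p ∈ k.primeFactors, p :=
        Finset.prod_le_prod' (fun p hp => (Nat.prime_of_mem_primeFactors hp).two_le)
    _ ≤ k := Nat.le_of_dvd (Nat.pos_of_ne_zero hk) (Nat.prod_primeFactors_dvd k)

lemma fiber_card (m : ℕ) (r : ZMod m) (X N j : ℕ) (P : Finset ℕ)
    (hP : ∀ p ∈ P, p.Prime ∧ p ≤ N) :
    ((Finset.Icc 1 X ×ˢ P).filter (fun q => ((q.1 * q.2 : ℕ) : ZMod m) = r ∧ q.1 * q.2 / m = j)).card
      ≤ Nat.log 2 (X * N) := by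
  rcases Finset.eq_empty_or_nonempty ((Finset.Icc 1 X ×ˢ P).filter
    (fun q => ((q.1 * q.2 : ℕ) : ZMod m) = r ∧ q.1 * q.2 / m = j)) with h | ⟨q0, hq0⟩
  · rw [h]; simp
  have key : ∀ q ∈ (Finset.Icc 1 X ×ˢ P).filter
      (fun q => ((q.1 * q.2 : ℕ) : ZMod m) = r ∧ q.1 * q.2 / m = j), q.1 * q.2 = q0.1 * q0.2 := by
    intro q hq
    simp only [Finset.mem_filter] at hq hq0
    have h1 : q.1 * q.2 % m = q0.1 * q0.2 % m :=
      (ZMod.natCast_eq_natCast_iff _ _ _).1 (hq.2.1.trans hq0.2.1.symm)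
    rw [← Nat.div_add_mod (q.1 * q.2) m, ← Nat.div_add_mod (q0.1 * q0.2) m, h1, hq.2.2, hq0.2.2]
  simp only [Finset.mem_filter, Finset.mem_product, Finset.mem_Icc] at hq0
  have hk0 : q0.1 * q0.2 ≠ 0 :=
    Nat.mul_ne_zero (by omega) (hP _ hq0.1.2).1.ne_zero
  have h1 : ((Finset.Icc 1 X ×ˢ P).filter
      (fun q => ((q.1 * q.2 : ℕ) : ZMod m) = r ∧ q.1 * q.2 / m = j)).card ≤
      (q0.1 * q0.2).primeFactors.card := by
    apply Finset.card_le_card_of_injOn (fun q => q.2)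
    · intro q hq
      have hk := key q hq
      have hq' := Finset.mem_coe.1 hq
      simp only [Finset.mem_filter, Finset.mem_product] at hq'
      simp only [Finset.mem_coe]
      rw [Nat.mem_primeFactors]
      exact ⟨(hP _ hq'.1.2).1, hk ▸ Dvd.intro_left _ rfl, hk0⟩
    · intro q hq q' hq' h
      have hk := key q hq
      have hk' := key q' hq'
      have hq1 := Finset.mem_coe.1 hq
      simp only [Finset.mem_filter, Finset.mem_product] at hq1
      simp only at h
      rw [← hk', ← h] at hk
      exact Prod.ext (Nat.eq_of_mul_eq_mul_right (hP _ hq1.1.2).1.pos hk) h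
  refine h1.trans ((card_pf_le _ hk0).trans (Nat.log_mono_right ?_))
  exact Nat.mul_le_mul hq0.1.1.2 (hP _ hq0.1.2).2

lemma pair_card (m : ℕ) (r : ZMod m) (X N : ℕ) (P : Finset ℕ)
    (hP : ∀ p ∈ P, p.Prime ∧ p ≤ N) :
    ((Finset.Icc 1 X ×ˢ P).filter (fun q => ((q.1 * q.2 : ℕ) : ZMod m) = r)).card
      ≤ (X * N / m + 1) * Nat.log 2 (X * N) := by
  have hmap : ∀ q ∈ (Finset.Icc 1 X ×ˢ P).filter (fun q => ((q.1 * q.2 : ℕ) : ZMod m) = r),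
      q.1 * q.2 / m ∈ Finset.range (X * N / m + 1) := by
    intro q hq
    simp only [Finset.mem_filter, Finset.mem_product, Finset.mem_Icc] at hq
    rw [Finset.mem_range, Nat.lt_succ_iff]
    exact Nat.div_le_div_right (Nat.mul_le_mul hq.1.1.2 (hP _ hq.1.2).2)
  rw [Finset.card_eq_sum_card_fiberwise hmap]
  refine (Finset.sum_le_card_nsmul _ _ (Nat.log 2 (X * N)) ?_).trans (by simp)
  intro j hj
  rw [Finset.filter_filter]
  exact fiber_card m r X N j P hP

/-- Weighted count. -/
lemma weighted_card (m : ℕ) (hm : 0 < m) (r : ZMod m) (N : ℕ) (P : Finset ℕ)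
    (hP : ∀ p ∈ P, p.Prime ∧ p ≤ N) (g : ℕ → ℝ) (hg0 : ∀ i, 0 ≤ g i) (hgN : ∀ i, g i ≤ N)
    (hg : ∀ i, g i * (2 * i) ≤ m) :
    ∑ q ∈ (Finset.Icc 1 m ×ˢ P).filter (fun q => ((q.1 * q.2 : ℕ) : ZMod m) = r), g q.1 ≤
      2 * N * (1 + Real.log (N + 1)) * Nat.log 2 (m * N) := by
  have hmap : ∀ q ∈ (Finset.Icc 1 m ×ˢ P).filter (fun q => ((q.1 * q.2 : ℕ) : ZMod m) = r),
      q.1 * q.2 / m ∈ Finset.range (N + 1) := by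
    intro q hq
    simp only [Finset.mem_filter, Finset.mem_product, Finset.mem_Icc] at hq
    rw [Finset.mem_range, Nat.lt_succ_iff]
    calc q.1 * q.2 / m ≤ m * N / m :=
          Nat.div_le_div_right (Nat.mul_le_mul hq.1.1.2 (hP _ hq.1.2).2)
      _ = N := Nat.mul_div_cancel_left _ hm
  rw [← Finset.sum_fiberwise_of_maps_to hmap]
  have hinner : ∀ j ∈ Finset.range (N + 1),
      ∑ q ∈ ((Finset.Icc 1 m ×ˢ P).filter (fun q => ((q.1 * q.2 : ℕ) : ZMod m) = r)).filter
        (fun q => q.1 * q.2 / m = j), g q.1 ≤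
      Nat.log 2 (m * N) * (2 * N) * ((j : ℝ) + 1)⁻¹ := by
    intro j hj
    rw [Finset.filter_filter]
    have hc := fiber_card m r m N j P hP
    have hterm : ∀ q ∈ (Finset.Icc 1 m ×ˢ P).filter
        (fun q => ((q.1 * q.2 : ℕ) : ZMod m) = r ∧ q.1 * q.2 / m = j),
        g q.1 ≤ (2 * N) * ((j : ℝ) + 1)⁻¹ := by
      intro q hq
      simp only [Finset.mem_filter, Finset.mem_product, Finset.mem_Icc] at hq
      rw [← div_eq_mul_inv, le_div_iff₀ (by positivity)]
      have h1 : (j : ℝ) * m ≤ q.1 * N := by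
        have : j * m ≤ q.1 * q.2 := by rw [← hq.2.2]; exact Nat.div_mul_le_self _ _
        have h2 : q.1 * q.2 ≤ q.1 * N := Nat.mul_le_mul_left _ (hP _ hq.1.2).2
        exact_mod_cast this.trans h2
      have hmr : (0:ℝ) < m := by exact_mod_cast hm
      have h3 := hg q.1
      have h4 := hgN q.1
      have h5 := hg0 q.1
      have h6 : g q.1 * j ≤ N := by
        have e1 : g q.1 * (j * m) ≤ g q.1 * (q.1 * N) := mul_le_mul_of_nonneg_left h1 h5
        have e2 : (N : ℝ) * (g q.1 * (2 * q.1)) ≤ N * m :=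
          mul_le_mul_of_nonneg_left h3 (by positivity)
        have e3 : (g q.1 * j) * m ≤ N * m := by
          have : 0 ≤ (N:ℝ) * m := by positivity
          nlinarith
        exact le_of_mul_le_mul_right e3 hmr
      linarith
    refine (Finset.sum_le_card_nsmul _ _ _ hterm).trans ?_
    rw [nsmul_eq_mul, mul_assoc (Nat.log 2 (m * N) : ℝ)]
    apply mul_le_mul_of_nonneg_right _ (by positivity)
    exact_mod_cast hc
  refine (Finset.sum_le_sum hinner).trans ?_
  rw [← Finset.mul_sum]
  have hh := harmonic_le_one_add_log (N + 1)
  have he : ∑ j ∈ Finset.range (N + 1), ((j : ℝ) + 1)⁻¹ = ((harmonic (N + 1) : ℚ) : ℝ) := by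
    unfold harmonic; push_cast; rfl
  rw [he]
  push_cast at hh
  calc _ ≤ Nat.log 2 (m * N) * (2 * N) * (1 + Real.log ((N:ℝ) + 1)) :=
        mul_le_mul_of_nonneg_left hh (by positivity)
    _ = _ := by ring

/-- Sums over nonzero residues. -/
lemma sum_ne_zero_le (m : ℕ) [NeZero m] (f : ZMod m → ℝ) (hf : ∀ h, 0 ≤ f h) :
    ∑ h ∈ Finset.univ.filter (fun h : ZMod m => h ≠ 0), f h ≤
      ∑ i ∈ Finset.Icc 1 (m / 2), (f (i : ZMod m) + f (-(i : ZMod m))) := by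
  classical
  rw [Finset.sum_add_distrib]
  have hsub : Finset.univ.filter (fun h : ZMod m => h ≠ 0) ⊆
      (Finset.Icc 1 (m / 2)).image (fun i : ℕ => (i : ZMod m)) ∪
      (Finset.Icc 1 (m / 2)).image (fun i : ℕ => -(i : ZMod m)) := by
    intro h hh
    simp only [Finset.mem_filter, Finset.mem_univ, true_and] at hh
    have h1 := ZMod.natAbs_valMinAbs_le h
    have h2 : h.valMinAbs.natAbs ≠ 0 := by
      rw [Int.natAbs_ne_zero]; intro h0; exact hh ((ZMod.valMinAbs_eq_zero h).1 h0)
    have h3 := ZMod.coe_valMinAbs h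
    simp only [Finset.mem_union, Finset.mem_image, Finset.mem_Icc]
    rcases Int.natAbs_eq h.valMinAbs with h4 | h4
    · left; refine ⟨_, ⟨by omega, h1⟩, ?_⟩
      rw [h4, Int.cast_natCast] at h3; exact h3
    · right; refine ⟨_, ⟨by omega, h1⟩, ?_⟩
      rw [h4, Int.cast_neg, Int.cast_natCast] at h3; exact h3
  refine (Finset.sum_le_sum_of_subset_of_nonneg hsub (fun _ _ _ => hf _)).trans ?_
  have hu : ∀ A B : Finset (ZMod m), ∑ h ∈ A ∪ B, f h ≤ ∑ h ∈ A, f h + ∑ h ∈ B, f h := by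
    intro A B
    rw [← Finset.sum_union_inter]
    have : 0 ≤ ∑ h ∈ A ∩ B, f h := Finset.sum_nonneg (fun _ _ => hf _)
    linarith
  refine (hu _ _).trans (add_le_add ?_ ?_)
  · exact Finset.sum_image_le_of_nonneg (fun _ _ => hf _)
  · exact Finset.sum_image_le_of_nonneg (fun _ _ => hf _)

open ZMod in
lemma parseval_zmod (m : ℕ) [NeZero m] (A : ZMod m → ℂ) :
    ∑ u : ZMod m, ‖∑ v, A v * stdAddChar (u * v)‖ ^ 2 = m * ∑ v, ‖A v‖ ^ 2 := by
  have h : ((∑ u : ZMod m, ‖∑ v, A v * stdAddChar (u * v)‖ ^ 2 : ℝ) : ℂ) =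
      ((m * ∑ v, ‖A v‖ ^ 2 : ℝ) : ℂ) := by
    push_cast
    simp_rw [← Complex.mul_conj', map_sum, map_mul, Finset.sum_mul_sum, ← AddChar.map_neg_eq_conj]
    rw [Finset.sum_comm]
    rw [Finset.mul_sum]
    apply Finset.sum_congr rfl
    intro v _
    rw [Finset.sum_comm]
    have : ∀ v' : ZMod m, ∑ u : ZMod m, A v * stdAddChar (u * v) *
        ((starRingEnd ℂ) (A v') * stdAddChar (-(u * v'))) =
        if v - v' = 0 then m * (A v * (starRingEnd ℂ) (A v')) else 0 := by
      intro v'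
      have e : ∀ u : ZMod m, A v * stdAddChar (u * v) *
        ((starRingEnd ℂ) (A v') * stdAddChar (-(u * v'))) =
        (A v * (starRingEnd ℂ) (A v')) * stdAddChar (u * (v - v')) := by
        intro u
        rw [mul_sub, sub_eq_add_neg, AddChar.map_add_eq_mul]; ring
      simp_rw [e]
      rw [← Finset.mul_sum, AddChar.sum_mulShift _ (isPrimitive_stdAddChar m)]
      split_ifs
      · rw [ZMod.card]; push_cast; ring
      · simp
    simp_rw [this, sub_eq_zero]
    simp
  exact_mod_cast h

open ZMod in
lemma bilinear_zmod (m : ℕ) [NeZero m] (A B : ZMod m → ℂ) :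
    ‖∑ u, B u * ∑ v, A v * stdAddChar (u * v)‖ ^ 2 ≤
      m * (∑ u, ‖B u‖ ^ 2) * ∑ v, ‖A v‖ ^ 2 := by
  have h1 : ‖∑ u, B u * ∑ v, A v * stdAddChar (u * v)‖ ≤
      ∑ u, ‖B u‖ * ‖∑ v, A v * stdAddChar (u * v)‖ := by
    refine (norm_sum_le _ _).trans (le_of_eq ?_)
    simp_rw [norm_mul]
  calc _ ≤ (∑ u, ‖B u‖ * ‖∑ v, A v * stdAddChar (u * v)‖) ^ 2 := by gcongr
    _ ≤ (∑ u, ‖B u‖ ^ 2) * ∑ u : ZMod m, ‖∑ v, A v * stdAddChar (u * v)‖ ^ 2 :=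
        Finset.sum_mul_sq_le_sq_mul_sq _ _ _
    _ = _ := by rw [parseval_zmod]; ring

/-- Fibre sums squared. -/
lemma fib_sq {ι : Type*} (m : ℕ) [NeZero m] (I : Finset ι) (f : ι → ZMod m) (c : ι → ℝ) :
    ∑ u, (∑ i ∈ I.filter (fun i => f i = u), c i) ^ 2 =
      ∑ i ∈ I, ∑ i' ∈ I, if f i = f i' then c i * c i' else 0 := by
  simp_rw [sq, Finset.sum_mul_sum, Finset.sum_filter]
  rw [Finset.sum_comm]
  apply Finset.sum_congr rfl
  intro i _
  simp only [Finset.sum_ite_eq, Finset.mem_univ, if_true]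
  apply Finset.sum_congr rfl
  intro i' _
  simp only [eq_comm]

open ZMod in
lemma bilinear_index {ι κ : Type*} (m : ℕ) [NeZero m] (I : Finset ι) (J : Finset κ)
    (f : ι → ZMod m) (g : κ → ZMod m) (c : ι → ℂ) :
    ‖∑ i ∈ I, c i * ∑ j ∈ J, stdAddChar (f i * g j)‖ ^ 2 ≤
      m * (∑ i ∈ I, ∑ i' ∈ I, if f i = f i' then ‖c i‖ * ‖c i'‖ else 0) *
        (∑ j ∈ J, ∑ j' ∈ J, if g j = g j' then (1:ℝ) else 0) := by
  have h := bilinear_zmod m (fun v => ∑ j ∈ J.filter (fun j => g j = v), (1:ℂ))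
    (fun u => ∑ i ∈ I.filter (fun i => f i = u), c i)
  have e1 : ∑ u : ZMod m, (∑ i ∈ I.filter (fun i => f i = u), c i) *
      ∑ v, (∑ j ∈ J.filter (fun j => g j = v), (1:ℂ)) * stdAddChar (u * v) =
      ∑ i ∈ I, c i * ∑ j ∈ J, stdAddChar (f i * g j) := by
    have e2 : ∀ u : ZMod m, ∑ v, (∑ j ∈ J.filter (fun j => g j = v), (1:ℂ)) * stdAddChar (u * v) =
        ∑ j ∈ J, stdAddChar (u * g j) := by
      intro u
      rw [← Finset.sum_fiberwise J g]
      apply Finset.sum_congr rfl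
      intro v _
      rw [Finset.sum_mul]
      apply Finset.sum_congr rfl
      intro j hj
      rw [(Finset.mem_filter.1 hj).2, one_mul]
    simp_rw [e2]
    rw [← Finset.sum_fiberwise I f]
    apply Finset.sum_congr rfl
    intro u _
    rw [Finset.sum_mul]
    apply Finset.sum_congr rfl
    intro i hi
    rw [(Finset.mem_filter.1 hi).2]
  rw [e1] at h
  refine h.trans ?_
  have h2 : ∑ u : ZMod m, ‖∑ i ∈ I.filter (fun i => f i = u), c i‖ ^ 2 ≤
      ∑ i ∈ I, ∑ i' ∈ I, if f i = f i' then ‖c i‖ * ‖c i'‖ else 0 := by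
    rw [← fib_sq]
    apply Finset.sum_le_sum
    intro u _
    gcongr
    exact norm_sum_le _ _
  have h3 : ∑ v : ZMod m, ‖∑ j ∈ J.filter (fun j => g j = v), (1:ℂ)‖ ^ 2 ≤
      ∑ j ∈ J, ∑ j' ∈ J, if g j = g j' then (1:ℝ) else 0 := by
    have := fib_sq m J g (fun _ => (1:ℝ))
    simp only [mul_one] at this
    rw [← this]
    apply Finset.sum_le_sum
    intro u _
    gcongr
    simp
  have h2' : 0 ≤ ∑ i ∈ I, ∑ i' ∈ I, if f i = f i' then ‖c i‖ * ‖c i'‖ else 0 :=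
    le_trans (Finset.sum_nonneg (fun _ _ => by positivity)) h2
  gcongr

open ZMod in
lemma geom_zmod (m : ℕ) [NeZero m] (h : ZMod m) (Y : ℕ) :
    ‖∑ n ∈ Finset.Icc 1 Y, stdAddChar (-(h * (n : ZMod m)))‖ * ‖stdAddChar h - 1‖ ≤ 2 := by
  have e : ∀ n : ℕ, stdAddChar (-(h * (n : ZMod m))) = (stdAddChar (-h)) ^ n := by
    intro n
    rw [← AddChar.map_nsmul_eq_pow, nsmul_eq_mul]; congr 1; ring
  have hn : ‖stdAddChar (-h)‖ = 1 := AddChar.norm_apply _ _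
  have h1 : ‖stdAddChar h - 1‖ = ‖stdAddChar (-h) - 1‖ := by
    rw [AddChar.map_neg_eq_conj, ← Complex.norm_conj]; simp
  rw [h1, ← norm_mul]
  simp_rw [e]
  have h2 : ∀ Y : ℕ, (∑ n ∈ Finset.Icc 1 Y, (stdAddChar (-h)) ^ n) * (stdAddChar (-h) - 1) =
      (stdAddChar (-h)) ^ (Y + 1) - stdAddChar (-h) := by
    intro Y
    induction Y with
    | zero => simp
    | succ Y ih => rw [Finset.sum_Icc_succ_top (by omega), add_mul, ih]; ring
  rw [h2]
  refine (norm_sub_le _ _).trans ?_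
  rw [norm_pow, hn]; norm_num

open ZMod in
lemma stdAddChar_dist (m : ℕ) [NeZero m] (i : ℕ) (hi : 2 * i ≤ m) :
    4 * (i : ℝ) / m ≤ ‖stdAddChar (i : ZMod m) - 1‖ := by
  have hm : (0:ℝ) < m := by exact_mod_cast NeZero.pos m
  have h1 : stdAddChar (i : ZMod m) = Complex.exp (Complex.I * ((2 * Real.pi * i / m : ℝ) : ℂ)) := by
    have := stdAddChar_coe (N := m) (i : ℤ)
    push_cast at this
    rw [this]; congr 1; push_cast; ring
  rw [h1, Complex.norm_exp_I_mul_ofReal_sub_one]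
  have h2 : 2 * Real.pi * i / m / 2 = Real.pi * i / m := by ring
  have hi' : 2 * (i:ℝ) ≤ m := by exact_mod_cast hi
  have h3 := Real.mul_le_sin (x := Real.pi * i / m) (by positivity) (by
    rw [div_le_div_iff₀ hm (by norm_num)]; nlinarith [Real.pi_pos])
  have h4 : 2 / Real.pi * (Real.pi * i / m) = 2 * i / m := by field_simp
  rw [h4] at h3
  rw [h2, Real.norm_eq_abs]
  refine le_trans ?_ (le_abs_self _)
  calc 4 * (i:ℝ) / m = 2 * (2 * i / m) := by ring
    _ ≤ _ := by linarith

open ZMod in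
lemma geom_bound (m : ℕ) [NeZero m] (i : ℕ) (h : ZMod m) (hh : h = i ∨ h = -i) (hi : 2 * i ≤ m) (Y : ℕ) :
    ‖∑ n ∈ Finset.Icc 1 Y, stdAddChar (-(h * (n : ZMod m)))‖ * (2 * i) ≤ m := by
  have hm : (0:ℝ) < m := by exact_mod_cast NeZero.pos m
  have h1 := geom_zmod m h Y
  have h2 := stdAddChar_dist m i hi
  have h3 : ‖stdAddChar h - 1‖ = ‖stdAddChar (i : ZMod m) - 1‖ := by
    rcases hh with rfl | rfl
    · rfl
    · rw [AddChar.map_neg_eq_conj, ← Complex.norm_conj]; simp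
  rw [h3] at h1
  set G := ‖∑ n ∈ Finset.Icc 1 Y, stdAddChar (-(h * (n : ZMod m)))‖
  have hG : 0 ≤ G := norm_nonneg _
  have h4 : G * (4 * (i : ℝ) / m) ≤ 2 := (mul_le_mul_of_nonneg_left h2 hG).trans h1
  rw [← mul_div_assoc, div_le_iff₀ hm] at h4
  linarith

open ZMod in
lemma geom_triv (m : ℕ) [NeZero m] (h : ZMod m) (Y : ℕ) :
    ‖∑ n ∈ Finset.Icc 1 Y, stdAddChar (-(h * (n : ZMod m)))‖ ≤ Y := by
  refine (norm_sum_le _ _).trans ?_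
  simp [AddChar.norm_apply]

/-- Number of solutions of `b n p (p₁ p₂) = a` with `1 ≤ n ≤ Y` and `p, p₁, p₂ ∈ P`. -/
noncomputable def cnt (m : ℕ) (P : Finset ℕ) (a b : ZMod m) (Y : ℕ) : ℝ :=
  ∑ i ∈ Finset.Icc 1 Y ×ˢ P, ∑ j ∈ P ×ˢ P,
    if b * ((i.1 : ZMod m) * (i.2 : ZMod m) * ((j.1 : ZMod m) * (j.2 : ZMod m))) = a then (1:ℝ) else 0

lemma AA_bound (m : ℕ) [NeZero m] (N : ℕ) (P : Finset ℕ)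
    (hP : ∀ p ∈ P, p.Prime ∧ p ≤ N ∧ p.Coprime m) :
    (∑ j ∈ P ×ˢ P, ∑ j' ∈ P ×ˢ P,
      if ((j.1 : ZMod m) * (j.2 : ZMod m))⁻¹ = ((j'.1 : ZMod m) * (j'.2 : ZMod m))⁻¹
      then (1:ℝ) else 0) ≤ (N : ℝ) ^ 2 * (((N : ℝ) ^ 2 / m + 1) * Nat.log 2 (N * N)) := by
  have hP' : ∀ p ∈ P, p.Prime ∧ p ≤ N := fun p hp => ⟨(hP p hp).1, (hP p hp).2.1⟩
  have hcard : P.card ≤ N := by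
    have : P ⊆ Finset.Icc 1 N := fun p hp => Finset.mem_Icc.2 ⟨(hP p hp).1.one_le, (hP p hp).2.1⟩
    simpa using Finset.card_le_card this
  have hinner : ∀ j ∈ P ×ˢ P, (∑ j' ∈ P ×ˢ P,
      if ((j.1 : ZMod m) * (j.2 : ZMod m))⁻¹ = ((j'.1 : ZMod m) * (j'.2 : ZMod m))⁻¹
      then (1:ℝ) else 0) ≤ ((N : ℝ) ^ 2 / m + 1) * Nat.log 2 (N * N) := by
    intro j hj
    rw [Finset.sum_boole]
    have h1 : ((P ×ˢ P).filter (fun j' => ((j.1 : ZMod m) * (j.2 : ZMod m))⁻¹ =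
        ((j'.1 : ZMod m) * (j'.2 : ZMod m))⁻¹)).card ≤ (N * N / m + 1) * Nat.log 2 (N * N) := by
      refine le_trans (Finset.card_le_card ?_)
        (pair_card m ((j.1 : ZMod m) * (j.2 : ZMod m)) N N P hP')
      intro q hq
      simp only [Finset.mem_filter, Finset.mem_product, Finset.mem_Icc] at hq hj ⊢
      refine ⟨⟨⟨(hP _ hq.1.1).1.one_le, (hP _ hq.1.1).2.1⟩, hq.1.2⟩, ?_⟩
      have u1 := (ZMod.unitOfCoprime _ (hP _ hq.1.1).2.2)
      have e : ∀ x ∈ P, ∀ y ∈ P, ((x : ZMod m) * (y : ZMod m)) * ((x : ZMod m) * (y : ZMod m))⁻¹ = 1 := by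
        intro x hx y hy
        have := ZMod.coe_mul_inv_eq_one (n := m) (x * y) (Nat.Coprime.mul_left (hP x hx).2.2 (hP y hy).2.2)
        push_cast at this; exact this
      have e1 := e _ hq.1.1 _ hq.1.2
      have e2 := e _ hj.1 _ hj.2
      rw [hq.2] at e2
      push_cast
      calc (q.1 : ZMod m) * q.2 = (q.1 * q.2) * ((j.1 * j.2) * ((q.1 : ZMod m) * q.2)⁻¹) := by
            rw [e2, mul_one]
        _ = (j.1 * j.2) * ((q.1 * q.2) * ((q.1 : ZMod m) * q.2)⁻¹) := by ring
        _ = _ := by rw [e1, mul_one]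
    calc _ ≤ (((N * N / m + 1) * Nat.log 2 (N * N) : ℕ) : ℝ) := by exact_mod_cast h1
      _ ≤ _ := by
        push_cast
        gcongr
        refine Nat.cast_div_le.trans ?_
        push_cast; rw [sq]
  refine (Finset.sum_le_card_nsmul _ _ _ hinner).trans ?_
  rw [nsmul_eq_mul, Finset.card_product]
  apply mul_le_mul_of_nonneg_right _ (by positivity)
  push_cast
  rw [sq]
  have : (P.card : ℝ) ≤ N := by exact_mod_cast hcard
  gcongr

lemma cs_count {ι κ : Type*} (m : ℕ) [NeZero m] (I : Finset ι) (J : Finset κ)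
    (f : ι → ZMod m) (g : κ → ZMod m) :
    (∑ i ∈ I, ∑ j ∈ J, if f i = g j then (1:ℝ) else 0) ^ 2 ≤
      (∑ i ∈ I, ∑ i' ∈ I, if f i = f i' then (1:ℝ) else 0) *
        (∑ j ∈ J, ∑ j' ∈ J, if g j = g j' then (1:ℝ) else 0) := by
  have h1 := fib_sq m I f (fun _ => (1:ℝ))
  have h2 := fib_sq m J g (fun _ => (1:ℝ))
  simp only [mul_one] at h1 h2
  rw [← h1, ← h2]
  refine le_trans (le_of_eq ?_) (Finset.sum_mul_sq_le_sq_mul_sq _ _ _)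
  congr 1
  rw [← Finset.sum_fiberwise I f]
  apply Finset.sum_congr rfl
  intro u _
  rw [Finset.sum_mul]
  apply Finset.sum_congr rfl
  intro i hi
  rw [(Finset.mem_filter.1 hi).2, one_mul, Finset.sum_filter]
  simp only [eq_comm]

lemma cnt_eq_iff (m : ℕ) [NeZero m] (N : ℕ) (P : Finset ℕ)
    (hP : ∀ p ∈ P, p.Prime ∧ p ≤ N ∧ p.Coprime m) (a b : (ZMod m)ˣ) (t : ZMod m) (j : ℕ × ℕ) (hj : j ∈ P ×ˢ P) :
    (b : ZMod m) * (t * ((j.1 : ZMod m) * (j.2 : ZMod m))) = a ↔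
      (b : ZMod m) * ((a⁻¹ : (ZMod m)ˣ) : ZMod m) * t = ((j.1 : ZMod m) * (j.2 : ZMod m))⁻¹ := by
  rw [Finset.mem_product] at hj
  have e1 := ZMod.coe_mul_inv_eq_one (n := m) (j.1 * j.2)
    (Nat.Coprime.mul_left (hP _ hj.1).2.2 (hP _ hj.2).2.2)
  push_cast at e1
  have ea : (a : ZMod m) * ((a⁻¹ : (ZMod m)ˣ) : ZMod m) = 1 := Units.mul_inv a
  set v := (j.1 : ZMod m) * (j.2 : ZMod m)
  set a' := ((a⁻¹ : (ZMod m)ˣ) : ZMod m)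
  constructor
  · intro h
    calc (b : ZMod m) * a' * t = b * a' * t * (v * v⁻¹) := by rw [e1, mul_one]
      _ = (b * (t * v)) * a' * v⁻¹ := by ring
      _ = _ := by rw [h, ea, one_mul]
  · intro h
    calc (b : ZMod m) * (t * v) = b * (t * v) * (a * a') := by rw [ea, mul_one]
      _ = a * v * (b * a' * t) := by ring
      _ = a * (v * v⁻¹) := by rw [h]; ring
      _ = _ := by rw [e1, mul_one]

/-- Bound for counts along large moduli (used for squares). -/
lemma cnt_sq_le (m : ℕ) [NeZero m] (N : ℕ) (P : Finset ℕ)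
    (hP : ∀ p ∈ P, p.Prime ∧ p ≤ N ∧ p.Coprime m) (a b : (ZMod m)ˣ) (Y : ℕ) :
    (cnt m P a b Y) ^ 2 ≤
      ((Y : ℝ) * N * (((Y : ℝ) * N / m + 1) * Nat.log 2 (Y * N))) *
      ((N : ℝ) ^ 2 * (((N : ℝ) ^ 2 / m + 1) * Nat.log 2 (N * N))) := by
  have hP' : ∀ p ∈ P, p.Prime ∧ p ≤ N := fun p hp => ⟨(hP p hp).1, (hP p hp).2.1⟩
  have hcard : P.card ≤ N := by
    have : P ⊆ Finset.Icc 1 N := fun p hp => Finset.mem_Icc.2 ⟨(hP p hp).1.one_le, (hP p hp).2.1⟩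
    simpa using Finset.card_le_card this
  have e : cnt m P a b Y = ∑ i ∈ Finset.Icc 1 Y ×ˢ P, ∑ j ∈ P ×ˢ P,
      if (b : ZMod m) * ((a⁻¹ : (ZMod m)ˣ) : ZMod m) * ((i.1 : ZMod m) * (i.2 : ZMod m)) =
        ((j.1 : ZMod m) * (j.2 : ZMod m))⁻¹ then (1:ℝ) else 0 := by
    unfold cnt
    apply Finset.sum_congr rfl; intro i _
    apply Finset.sum_congr rfl; intro j hj
    simp only [cnt_eq_iff m N P hP a b _ j hj]
  rw [e]
  refine (cs_count m _ _ _ _).trans ?_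
  have hA := AA_bound m N P hP
  refine mul_le_mul ?_ hA (Finset.sum_nonneg (fun _ _ => Finset.sum_nonneg (fun _ _ => by split_ifs <;> norm_num))) (by positivity)
  have hinner : ∀ i ∈ Finset.Icc 1 Y ×ˢ P, (∑ i' ∈ Finset.Icc 1 Y ×ˢ P,
      if (b : ZMod m) * ((a⁻¹ : (ZMod m)ˣ) : ZMod m) * ((i.1 : ZMod m) * (i.2 : ZMod m)) =
       (b : ZMod m) * ((a⁻¹ : (ZMod m)ˣ) : ZMod m) * ((i'.1 : ZMod m) * (i'.2 : ZMod m))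
      then (1:ℝ) else 0) ≤ ((Y : ℝ) * N / m + 1) * Nat.log 2 (Y * N) := by
    intro i hi
    rw [Finset.sum_boole]
    have h1 : ((Finset.Icc 1 Y ×ˢ P).filter (fun i' : ℕ × ℕ =>
      (b : ZMod m) * ((a⁻¹ : (ZMod m)ˣ) : ZMod m) * ((i.1 : ZMod m) * (i.2 : ZMod m)) =
       (b : ZMod m) * ((a⁻¹ : (ZMod m)ˣ) : ZMod m) * ((i'.1 : ZMod m) * (i'.2 : ZMod m)))).card
        ≤ (Y * N / m + 1) * Nat.log 2 (Y * N) := by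
      refine le_trans (Finset.card_le_card ?_)
        (pair_card m ((i.1 : ZMod m) * (i.2 : ZMod m)) Y N P hP')
      intro q hq
      rw [Finset.mem_filter] at hq ⊢
      refine ⟨hq.1, ?_⟩
      have h2 := hq.2
      rw [← Units.val_mul] at h2
      push_cast
      exact ((Units.mul_right_inj _).1 h2).symm
    calc _ ≤ (((Y * N / m + 1) * Nat.log 2 (Y * N) : ℕ) : ℝ) := by exact_mod_cast h1
      _ ≤ _ := by
        push_cast
        gcongr
        refine Nat.cast_div_le.trans ?_
        push_cast; rfl
  refine (Finset.sum_le_card_nsmul _ _ _ hinner).trans ?_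
  rw [nsmul_eq_mul, Finset.card_product]
  apply mul_le_mul_of_nonneg_right _ (by positivity)
  push_cast
  have : (P.card : ℝ) ≤ N := by exact_mod_cast hcard
  simp only [Nat.card_Icc, Nat.add_sub_cancel]
  gcongr

open ZMod in
lemma c_sum_bound (m : ℕ) [NeZero m] (Y : ℕ) :
    ∑ h ∈ Finset.univ.filter (fun h : ZMod m => h ≠ 0),
      ‖∑ n ∈ Finset.Icc 1 Y, stdAddChar (-(h * (n : ZMod m)))‖ ≤ m * (1 + Real.log m) := by
  have hm : (0:ℝ) < m := by exact_mod_cast NeZero.pos m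
  refine (sum_ne_zero_le m _ (fun h => norm_nonneg _)).trans ?_
  have h1 : ∀ i ∈ Finset.Icc 1 (m / 2),
      ‖∑ n ∈ Finset.Icc 1 Y, stdAddChar (-((i : ZMod m) * (n : ZMod m)))‖ +
      ‖∑ n ∈ Finset.Icc 1 Y, stdAddChar (-(-(i : ZMod m) * (n : ZMod m)))‖ ≤ m * (i : ℝ)⁻¹ := by
    intro i hi
    rw [Finset.mem_Icc] at hi
    have hi0 : (0:ℝ) < i := by exact_mod_cast hi.1
    have g1 := geom_bound m i i (Or.inl rfl) (by omega) Y
    have g2 := geom_bound m i (-i) (Or.inr rfl) (by omega) Y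
    rw [← div_eq_mul_inv, le_div_iff₀ hi0]
    linarith
  refine (Finset.sum_le_sum h1).trans ?_
  rw [← Finset.mul_sum]
  apply mul_le_mul_of_nonneg_left _ hm.le
  have h2 : ∑ i ∈ Finset.Icc 1 (m / 2), (i : ℝ)⁻¹ ≤ ∑ i ∈ Finset.Icc 1 m, (i : ℝ)⁻¹ :=
    Finset.sum_le_sum_of_subset_of_nonneg (Finset.Icc_subset_Icc_right (Nat.div_le_self _ _))
      (fun _ _ _ => by positivity)
  have hh := harmonic_le_one_add_log m
  rw [harmonic_eq_sum_Icc] at hh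
  push_cast at hh
  exact h2.trans hh

open ZMod in
lemma inner_bound (m : ℕ) [NeZero m] (N : ℕ) (P : Finset ℕ)
    (hP : ∀ p ∈ P, p.Prime ∧ p ≤ N) (Y : ℕ) (hY : Y ≤ N) (r : ZMod m) :
    ∑ h ∈ Finset.univ.filter (fun h : ZMod m => h ≠ 0), ∑ p ∈ P,
      (if h * (p : ZMod m) = r then
        ‖∑ n ∈ Finset.Icc 1 Y, stdAddChar (-(h * (n : ZMod m)))‖ else 0) ≤
      4 * N * (1 + Real.log (N + 1)) * Nat.log 2 (m * N) := by
  have hm : 0 < m := NeZero.pos m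
  have hmr : (0:ℝ) < m := by exact_mod_cast hm
  set g : ℕ → ℝ := fun i => min N (m / (2 * i)) with hg
  have hg0 : ∀ i, 0 ≤ g i := fun i => le_min (by positivity) (by positivity)
  have w := fun r => weighted_card m hm r N P hP g hg0 (fun i => min_le_left _ _) (by
    intro i
    rcases Nat.eq_zero_or_pos i with h | h
    · simp [h]
    · have : (0:ℝ) < i := by exact_mod_cast h
      rw [← le_div_iff₀ (by positivity)]
      exact min_le_right _ _)
  have hcg : ∀ (i : ℕ) (h : ZMod m), (h = i ∨ h = -i) → 1 ≤ i → 2 * i ≤ m →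
      ‖∑ n ∈ Finset.Icc 1 Y, stdAddChar (-(h * (n : ZMod m)))‖ ≤ g i := by
    intro i h hh hi him
    have hi0 : (0:ℝ) < i := by exact_mod_cast hi
    apply le_min
    · exact (geom_triv m h Y).trans (by exact_mod_cast hY)
    · rw [le_div_iff₀ (by positivity)]; exact geom_bound m i h hh him Y
  refine (sum_ne_zero_le m _ (fun h => Finset.sum_nonneg (fun p _ => by split_ifs <;> positivity))).trans ?_
  have h1 : ∀ r, ∑ i ∈ Finset.Icc 1 (m / 2), ∑ p ∈ P, (if (i : ZMod m) * (p : ZMod m) = r then g i else 0)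
      ≤ 2 * N * (1 + Real.log (N + 1)) * Nat.log 2 (m * N) := by
    intro r
    refine le_trans ?_ (w r)
    rw [Finset.sum_filter, Finset.sum_product]
    push_cast
    exact Finset.sum_le_sum_of_subset_of_nonneg (Finset.Icc_subset_Icc_right (Nat.div_le_self _ _))
      (fun i _ _ => Finset.sum_nonneg (fun p _ => by split_ifs; exacts [hg0 i, le_rfl]))
  rw [Finset.sum_add_distrib]
  have e1 : ∑ i ∈ Finset.Icc 1 (m / 2), ∑ p ∈ P,
      (if (i : ZMod m) * (p : ZMod m) = r then
        ‖∑ n ∈ Finset.Icc 1 Y, stdAddChar (-((i : ZMod m) * (n : ZMod m)))‖ else 0) ≤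
      2 * N * (1 + Real.log (N + 1)) * Nat.log 2 (m * N) := by
    refine le_trans ?_ (h1 r)
    apply Finset.sum_le_sum; intro i hi
    rw [Finset.mem_Icc] at hi
    apply Finset.sum_le_sum; intro p _
    split_ifs
    · exact hcg i _ (Or.inl rfl) hi.1 (by omega)
    · exact le_rfl
  have e2 : ∑ i ∈ Finset.Icc 1 (m / 2), ∑ p ∈ P,
      (if -(i : ZMod m) * (p : ZMod m) = r then
        ‖∑ n ∈ Finset.Icc 1 Y, stdAddChar (-(-(i : ZMod m) * (n : ZMod m)))‖ else 0) ≤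
      2 * N * (1 + Real.log (N + 1)) * Nat.log 2 (m * N) := by
    refine le_trans ?_ (h1 (-r))
    apply Finset.sum_le_sum; intro i hi
    rw [Finset.mem_Icc] at hi
    apply Finset.sum_le_sum; intro p _
    have : (-(i : ZMod m) * (p : ZMod m) = r) ↔ (i : ZMod m) * (p : ZMod m) = -r := by
      rw [neg_mul, neg_eq_iff_eq_neg]
    simp only [this]
    split_ifs
    · exact hcg i _ (Or.inr rfl) hi.1 (by omega)
    · exact le_rfl
  linarith

open ZMod in
lemma BB_bound (m : ℕ) [NeZero m] (N : ℕ) (P : Finset ℕ)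
    (hP : ∀ p ∈ P, p.Prime ∧ p ≤ N ∧ p.Coprime m) (Y : ℕ) (hY : Y ≤ N) (w : (ZMod m)ˣ) :
    (∑ i ∈ (Finset.univ.filter (fun h : ZMod m => h ≠ 0)) ×ˢ P,
      ∑ i' ∈ (Finset.univ.filter (fun h : ZMod m => h ≠ 0)) ×ˢ P,
      if i.1 * (w : ZMod m) * (i.2 : ZMod m)⁻¹ = i'.1 * (w : ZMod m) * (i'.2 : ZMod m)⁻¹ then
        ‖∑ n ∈ Finset.Icc 1 Y, stdAddChar (-(i.1 * (n : ZMod m)))‖ *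
        ‖∑ n ∈ Finset.Icc 1 Y, stdAddChar (-(i'.1 * (n : ZMod m)))‖ else 0) ≤
      (N : ℝ) * (m * (1 + Real.log m)) * (4 * N * (1 + Real.log (N + 1)) * Nat.log 2 (m * N)) := by
  have hP' : ∀ p ∈ P, p.Prime ∧ p ≤ N := fun p hp => ⟨(hP p hp).1, (hP p hp).2.1⟩
  have hcard : P.card ≤ N := by
    have : P ⊆ Finset.Icc 1 N := fun p hp => Finset.mem_Icc.2 ⟨(hP p hp).1.one_le, (hP p hp).2.1⟩
    simpa using Finset.card_le_card this
  have hinv : ∀ p ∈ P, (p : ZMod m) * (p : ZMod m)⁻¹ = 1 :=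
    fun p hp => ZMod.coe_mul_inv_eq_one p (hP p hp).2.2
  set H := Finset.univ.filter (fun h : ZMod m => h ≠ 0) with hH
  set c : ZMod m → ℝ := fun h => ‖∑ n ∈ Finset.Icc 1 Y, stdAddChar (-(h * (n : ZMod m)))‖ with hc
  have hc0 : ∀ h, 0 ≤ c h := fun h => norm_nonneg _
  have step1 : (∑ i ∈ H ×ˢ P, ∑ i' ∈ H ×ˢ P,
      if i.1 * (w : ZMod m) * (i.2 : ZMod m)⁻¹ = i'.1 * (w : ZMod m) * (i'.2 : ZMod m)⁻¹ then
        c i.1 * c i'.1 else 0) =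
      ∑ h' ∈ H, ∑ p ∈ P, c h' * ∑ h ∈ H, ∑ p' ∈ P,
        (if h * (p' : ZMod m) = h' * (p : ZMod m) then c h else 0) := by
    have e : ∀ h ∈ H, ∀ p ∈ P, ∀ h' ∈ H, ∀ p' ∈ P,
        (if h * (w : ZMod m) * (p : ZMod m)⁻¹ = h' * (w : ZMod m) * (p' : ZMod m)⁻¹ then
        c h * c h' else 0) = c h' * (if h * (p' : ZMod m) = h' * (p : ZMod m) then c h else 0) := by
      intro h _ p hp h' _ p' hp'
      have : (h * (w : ZMod m) * (p : ZMod m)⁻¹ = h' * (w : ZMod m) * (p' : ZMod m)⁻¹) ↔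
          h * (p' : ZMod m) = h' * (p : ZMod m) := by
        have e1 := hinv p hp
        have e2 := hinv p' hp'
        have e3 : (w : ZMod m) * ((w⁻¹ : (ZMod m)ˣ) : ZMod m) = 1 := Units.mul_inv w
        set w' := ((w⁻¹ : (ZMod m)ˣ) : ZMod m)
        constructor
        · intro hh
          calc h * (p' : ZMod m) = h * p' * (w * w') * (p * (p : ZMod m)⁻¹) := by
                rw [e3, e1, mul_one, mul_one]
            _ = (h * w * (p : ZMod m)⁻¹) * (p' * w' * p) := by ring
            _ = h' * p * (w * w') * (p' * (p' : ZMod m)⁻¹) := by rw [hh]; ring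
            _ = _ := by rw [e3, e2, mul_one, mul_one]
        · intro hh
          calc h * (w : ZMod m) * (p : ZMod m)⁻¹ =
                h * w * (p : ZMod m)⁻¹ * (p' * (p' : ZMod m)⁻¹) := by rw [e2, mul_one]
            _ = (h * p') * (w * (p : ZMod m)⁻¹ * (p' : ZMod m)⁻¹) := by ring
            _ = h' * w * (p' : ZMod m)⁻¹ * (p * (p : ZMod m)⁻¹) := by rw [hh]; ring
            _ = _ := by rw [e1, mul_one]
      simp only [this]
      split_ifs
      · ring
      · simp
    simp_rw [Finset.sum_product]
    calc _ = ∑ h ∈ H, ∑ p ∈ P, ∑ h' ∈ H, ∑ p' ∈ P,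
          c h' * (if h * (p' : ZMod m) = h' * (p : ZMod m) then c h else 0) :=
          Finset.sum_congr rfl fun h hh => Finset.sum_congr rfl fun p hp =>
            Finset.sum_congr rfl fun h' hh' => Finset.sum_congr rfl fun p' hp' =>
              e h hh p hp h' hh' p' hp'
      _ = ∑ h ∈ H, ∑ h' ∈ H, ∑ p ∈ P, ∑ p' ∈ P,
          c h' * (if h * (p' : ZMod m) = h' * (p : ZMod m) then c h else 0) :=
          Finset.sum_congr rfl fun h _ => Finset.sum_comm
      _ = ∑ h' ∈ H, ∑ h ∈ H, ∑ p ∈ P, ∑ p' ∈ P,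
          c h' * (if h * (p' : ZMod m) = h' * (p : ZMod m) then c h else 0) := Finset.sum_comm
      _ = ∑ h' ∈ H, ∑ p ∈ P, ∑ h ∈ H, ∑ p' ∈ P,
          c h' * (if h * (p' : ZMod m) = h' * (p : ZMod m) then c h else 0) :=
          Finset.sum_congr rfl fun h _ => Finset.sum_comm
      _ = _ := by simp_rw [Finset.mul_sum]
  change (∑ i ∈ H ×ˢ P, ∑ i' ∈ H ×ˢ P,
      if i.1 * (w : ZMod m) * (i.2 : ZMod m)⁻¹ = i'.1 * (w : ZMod m) * (i'.2 : ZMod m)⁻¹ then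
        c i.1 * c i'.1 else 0) ≤ _
  rw [step1]
  set M : ℝ := 4 * N * (1 + Real.log (N + 1)) * Nat.log 2 (m * N) with hM
  have hM0 : 0 ≤ M := by
    have : 0 ≤ Real.log ((N:ℝ) + 1) := Real.log_nonneg (by linarith [Nat.cast_nonneg (α := ℝ) N])
    positivity
  calc _ ≤ ∑ h' ∈ H, ∑ p ∈ P, c h' * M :=
        Finset.sum_le_sum fun h' _ => Finset.sum_le_sum fun p _ =>
          mul_le_mul_of_nonneg_left (inner_bound m N P hP' Y hY _) (hc0 h')
    _ = (P.card : ℝ) * (∑ h' ∈ H, c h') * M := by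
        simp_rw [Finset.sum_const, nsmul_eq_mul]
        rw [Finset.mul_sum, Finset.sum_mul]
        apply Finset.sum_congr rfl; intros; ring
    _ ≤ _ := by
        apply mul_le_mul_of_nonneg_right _ hM0
        exact mul_le_mul (by exact_mod_cast hcard) (c_sum_bound m Y)
          (Finset.sum_nonneg (fun h _ => hc0 h)) (by positivity)

open ZMod in
lemma cnt_expand (m : ℕ) [NeZero m] (N : ℕ) (P : Finset ℕ)
    (hP : ∀ p ∈ P, p.Prime ∧ p ≤ N ∧ p.Coprime m) (a b : (ZMod m)ˣ) (Y : ℕ) :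
    ((m * cnt m P a b Y - (P.card : ℝ) ^ 3 * Y : ℝ) : ℂ) =
      ∑ i ∈ (Finset.univ.filter (fun h : ZMod m => h ≠ 0)) ×ˢ P,
        (∑ n ∈ Finset.Icc 1 Y, stdAddChar (-(i.1 * (n : ZMod m)))) *
        ∑ j ∈ P ×ˢ P, stdAddChar (i.1 * ((a * b⁻¹ : (ZMod m)ˣ) : ZMod m) * (i.2 : ZMod m)⁻¹ *
          ((j.1 : ZMod m) * (j.2 : ZMod m))⁻¹) := by
  have hinv : ∀ p ∈ P, (p : ZMod m) * (p : ZMod m)⁻¹ = 1 :=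
    fun p hp => ZMod.coe_mul_inv_eq_one p (hP p hp).2.2
  set w : ZMod m := ((a * b⁻¹ : (ZMod m)ˣ) : ZMod m) with hw
  -- full expansion
  have hfull : ((m * cnt m P a b Y : ℝ) : ℂ) = ∑ h : ZMod m, ∑ p ∈ P,
        (∑ n ∈ Finset.Icc 1 Y, stdAddChar (-(h * (n : ZMod m)))) *
        ∑ j ∈ P ×ˢ P, stdAddChar (h * w * (p : ZMod m)⁻¹ *
          ((j.1 : ZMod m) * (j.2 : ZMod m))⁻¹) := by
    have e1 : ∀ n ∈ Finset.Icc 1 Y, ∀ p ∈ P, ∀ j ∈ P ×ˢ P,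
        (m : ℂ) * (if (b : ZMod m) * ((n : ZMod m) * (p : ZMod m) * ((j.1 : ZMod m) * (j.2 : ZMod m))) = a
          then (1:ℂ) else 0) =
        ∑ h : ZMod m, stdAddChar (-(h * (n : ZMod m))) * stdAddChar (h * w * (p : ZMod m)⁻¹ *
          ((j.1 : ZMod m) * (j.2 : ZMod m))⁻¹) := by
      intro n _ p hp j hj
      have e2 : ∀ h : ZMod m, stdAddChar (-(h * (n : ZMod m))) * stdAddChar (h * w * (p : ZMod m)⁻¹ *
          ((j.1 : ZMod m) * (j.2 : ZMod m))⁻¹) = stdAddChar (h * (w * (p : ZMod m)⁻¹ *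
          ((j.1 : ZMod m) * (j.2 : ZMod m))⁻¹ - (n : ZMod m))) := by
        intro h
        rw [← AddChar.map_add_eq_mul]; congr 1; ring
      simp_rw [e2]
      rw [AddChar.sum_mulShift _ (isPrimitive_stdAddChar m), ZMod.card]
      have hiff : (b : ZMod m) * ((n : ZMod m) * (p : ZMod m) * ((j.1 : ZMod m) * (j.2 : ZMod m))) = a ↔
          w * (p : ZMod m)⁻¹ * ((j.1 : ZMod m) * (j.2 : ZMod m))⁻¹ - (n : ZMod m) = 0 := by
        rw [cnt_eq_iff m N P hP a b _ j hj, sub_eq_zero]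
        have ep := hinv p hp
        have ea : (a : ZMod m) * ((a⁻¹ : (ZMod m)ˣ) : ZMod m) = 1 := Units.mul_inv a
        have eb : (b : ZMod m) * ((b⁻¹ : (ZMod m)ˣ) : ZMod m) = 1 := Units.mul_inv b
        have ew : w = a * ((b⁻¹ : (ZMod m)ˣ) : ZMod m) := by rw [hw, Units.val_mul]
        set v := ((j.1 : ZMod m) * (j.2 : ZMod m))⁻¹
        set a' := ((a⁻¹ : (ZMod m)ˣ) : ZMod m)
        set b' := ((b⁻¹ : (ZMod m)ˣ) : ZMod m)
        rw [ew]
        constructor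
        · intro h
          rw [← h]
          calc (a : ZMod m) * b' * (p : ZMod m)⁻¹ * (b * a' * (n * p)) =
              n * (a * a') * (b * b') * (p * (p : ZMod m)⁻¹) := by ring
            _ = n := by rw [ea, eb, ep]; ring
        · intro h
          rw [← h]
          calc (b : ZMod m) * a' * (a * b' * (p : ZMod m)⁻¹ * v * p) =
              v * (a * a') * (b * b') * (p * (p : ZMod m)⁻¹) := by ring
            _ = v := by rw [ea, eb, ep]; ring
      simp only [hiff]
      split_ifs <;> simp
    unfold cnt
    rw [Finset.sum_product]
    push_cast
    calc _ = ∑ n ∈ Finset.Icc 1 Y, ∑ p ∈ P, ∑ j ∈ P ×ˢ P, ∑ h : ZMod m,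
          stdAddChar (-(h * (n : ZMod m))) * stdAddChar (h * w * (p : ZMod m)⁻¹ *
          ((j.1 : ZMod m) * (j.2 : ZMod m))⁻¹) := by
          simp_rw [Finset.mul_sum]
          exact Finset.sum_congr rfl fun n hn => Finset.sum_congr rfl fun p hp =>
            Finset.sum_congr rfl fun j hj => by
              rw [← e1 n hn p hp j hj]; split_ifs <;> simp
      _ = ∑ n ∈ Finset.Icc 1 Y, ∑ p ∈ P, ∑ h : ZMod m, ∑ j ∈ P ×ˢ P,
          stdAddChar (-(h * (n : ZMod m))) * stdAddChar (h * w * (p : ZMod m)⁻¹ *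
          ((j.1 : ZMod m) * (j.2 : ZMod m))⁻¹) :=
          Finset.sum_congr rfl fun n hn => Finset.sum_congr rfl fun p hp => Finset.sum_comm
      _ = ∑ n ∈ Finset.Icc 1 Y, ∑ h : ZMod m, ∑ p ∈ P, ∑ j ∈ P ×ˢ P,
          stdAddChar (-(h * (n : ZMod m))) * stdAddChar (h * w * (p : ZMod m)⁻¹ *
          ((j.1 : ZMod m) * (j.2 : ZMod m))⁻¹) :=
          Finset.sum_congr rfl fun n hn => Finset.sum_comm
      _ = ∑ h : ZMod m, ∑ n ∈ Finset.Icc 1 Y, ∑ p ∈ P, ∑ j ∈ P ×ˢ P,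
          stdAddChar (-(h * (n : ZMod m))) * stdAddChar (h * w * (p : ZMod m)⁻¹ *
          ((j.1 : ZMod m) * (j.2 : ZMod m))⁻¹) := Finset.sum_comm
      _ = ∑ h : ZMod m, ∑ p ∈ P, ∑ n ∈ Finset.Icc 1 Y, ∑ j ∈ P ×ˢ P,
          stdAddChar (-(h * (n : ZMod m))) * stdAddChar (h * w * (p : ZMod m)⁻¹ *
          ((j.1 : ZMod m) * (j.2 : ZMod m))⁻¹) :=
          Finset.sum_congr rfl fun n hn => Finset.sum_comm
      _ = _ := by simp_rw [Finset.sum_mul_sum]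
  rw [Complex.ofReal_sub, hfull, Finset.sum_product]
  rw [← Finset.sum_filter_add_sum_filter_not Finset.univ (fun h : ZMod m => h ≠ 0)]
  have h0 : Finset.univ.filter (fun h : ZMod m => ¬ (h ≠ 0)) = {0} := by
    ext h; simp
  rw [h0, Finset.sum_singleton]
  simp only [zero_mul, neg_zero, AddChar.map_zero_eq_one, Finset.sum_const, Nat.card_Icc,
    Nat.add_sub_cancel, nsmul_eq_mul, mul_one, Finset.card_product]
  push_cast
  ring

/-- The distribution estimate. -/
theorem cnt_dist (m : ℕ) [NeZero m] (N : ℕ) (P : Finset ℕ)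
    (hP : ∀ p ∈ P, p.Prime ∧ p ≤ N ∧ p.Coprime m) (a b : (ZMod m)ˣ) (Y : ℕ) (hY : Y ≤ N) :
    (m * cnt m P a b Y - (P.card : ℝ) ^ 3 * Y) ^ 2 ≤
      m * ((N : ℝ) * (m * (1 + Real.log m)) * (4 * N * (1 + Real.log (N + 1)) * Nat.log 2 (m * N))) *
      ((N : ℝ) ^ 2 * (((N : ℝ) ^ 2 / m + 1) * Nat.log 2 (N * N))) := by
  have h1 : (m * cnt m P a b Y - (P.card : ℝ) ^ 3 * Y) ^ 2 =
      ‖((m * cnt m P a b Y - (P.card : ℝ) ^ 3 * Y : ℝ) : ℂ)‖ ^ 2 := by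
    rw [Complex.norm_real, Real.norm_eq_abs, sq_abs]
  rw [h1, cnt_expand m N P hP a b Y]
  refine (bilinear_index m _ _ (fun i : ZMod m × ℕ => i.1 * ((a * b⁻¹ : (ZMod m)ˣ) : ZMod m) * (i.2 : ZMod m)⁻¹)
    (fun j : ℕ × ℕ => ((j.1 : ZMod m) * (j.2 : ZMod m))⁻¹) _).trans ?_
  have hB := BB_bound m N P hP Y hY (a * b⁻¹)
  have hA := AA_bound m N P hP
  have hA0 : 0 ≤ (∑ j ∈ P ×ˢ P, ∑ j' ∈ P ×ˢ P,
      if ((j.1 : ZMod m) * (j.2 : ZMod m))⁻¹ = ((j'.1 : ZMod m) * (j'.2 : ZMod m))⁻¹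
      then (1:ℝ) else 0) :=
    Finset.sum_nonneg (fun _ _ => Finset.sum_nonneg (fun _ _ => by split_ifs <;> norm_num))
  have hB0 : 0 ≤ (N : ℝ) * (m * (1 + Real.log m)) * (4 * N * (1 + Real.log (N + 1)) * Nat.log 2 (m * N)) := by
    have : 0 ≤ Real.log ((N:ℝ) + 1) := Real.log_nonneg (by linarith [Nat.cast_nonneg (α := ℝ) N])
    have := Real.log_natCast_nonneg m
    positivity
  exact mul_le_mul (mul_le_mul_of_nonneg_left hB (by positivity)) hA hA0 (by positivity)


lemma cnt_dist' (m : ℕ) [NeZero m] (N : ℕ) (P : Finset ℕ)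
    (hP : ∀ p ∈ P, p.Prime ∧ p ≤ N ∧ p.Coprime m) (a b : (ZMod m)ˣ) (Y : ℕ) (hY : Y ≤ N)
    (L : ℝ) (h1 : 1 + Real.log m ≤ L) (h2 : 1 + Real.log (N + 1) ≤ L)
    (h3 : (Nat.log 2 (m * N) : ℝ) ≤ L) (h4 : (Nat.log 2 (N * N) : ℝ) ≤ L) (hmN : (m : ℝ) ≤ N ^ 2) :
    |cnt m P a b Y - (P.card : ℝ) ^ 3 * Y / m| ≤ 3 * N ^ 3 * L ^ 2 / Real.sqrt m := by
  have hm : (0 : ℝ) < m := by exact_mod_cast Nat.pos_of_ne_zero (NeZero.ne m)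
  have hl1 := Real.log_natCast_nonneg m
  have hL : 0 ≤ L := by linarith
  have hl2 : 0 ≤ Real.log ((N:ℝ) + 1) := Real.log_nonneg (by linarith [Nat.cast_nonneg (α := ℝ) N])
  have key := cnt_dist m N P hP a b Y hY
  have hdiv : (N : ℝ) ^ 2 / m + 1 ≤ 2 * (N : ℝ) ^ 2 / m := by
    rw [div_add_one hm.ne', div_le_div_iff_of_pos_right hm]; linarith
  have b1 : m * ((N : ℝ) * (m * (1 + Real.log m)) * (4 * N * (1 + Real.log (N + 1)) * Nat.log 2 (m * N))) *
      ((N : ℝ) ^ 2 * (((N : ℝ) ^ 2 / m + 1) * Nat.log 2 (N * N))) ≤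
      m * ((N : ℝ) * (m * L) * (4 * N * L * L)) *
      ((N : ℝ) ^ 2 * ((2 * (N : ℝ) ^ 2 / m) * L)) := by gcongr
  have b2 : m * ((N : ℝ) * (m * L) * (4 * N * L * L)) *
      ((N : ℝ) ^ 2 * ((2 * (N : ℝ) ^ 2 / m) * L)) = 8 * N ^ 6 * L ^ 4 * m := by
    field_simp; ring
  have b3 : (cnt m P a b Y - (P.card : ℝ) ^ 3 * Y / m) =
    (m * cnt m P a b Y - (P.card : ℝ) ^ 3 * Y) / m := by field_simp
  apply abs_le_of_sq_le_sq _ (by positivity)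
  rw [b3, div_pow, div_pow, Real.sq_sqrt hm.le, div_le_div_iff₀ (by positivity) hm]
  calc _ ≤ (8 * (N:ℝ) ^ 6 * L ^ 4 * m) * m := by
        apply mul_le_mul_of_nonneg_right _ hm.le
        linarith
    _ ≤ _ := by
        have : 0 ≤ (N:ℝ) ^ 6 * L ^ 4 * m ^ 2 := by positivity
        nlinarith

lemma cnt_sq' (m : ℕ) [NeZero m] (N : ℕ) (P : Finset ℕ)
    (hP : ∀ p ∈ P, p.Prime ∧ p ≤ N ∧ p.Coprime m) (a b : (ZMod m)ˣ) (Y : ℕ) (hY : Y ≤ N)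
    (q : ℝ) (hq : 0 < q) (hYq : (Y : ℝ) ≤ N / q ^ 2)
    (L : ℝ) (h4 : (Nat.log 2 (N * N) : ℝ) ≤ L) (hmN : (m : ℝ) ≤ N ^ 2) :
    cnt m P a b Y ≤ 2 * N ^ 4 * L / m * (1 / q ^ 2) + 2 * N ^ 3 * L / Real.sqrt m * (1 / q) := by
  have hm : (0 : ℝ) < m := by exact_mod_cast Nat.pos_of_ne_zero (NeZero.ne m)
  have hL : 0 ≤ L := le_trans (by positivity) h4
  have h5 : (Nat.log 2 (Y * N) : ℝ) ≤ L := le_trans (by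
    exact_mod_cast Nat.log_mono_right (Nat.mul_le_mul_right _ hY)) h4
  have key := cnt_sq_le m N P hP a b Y
  have hdiv : (N : ℝ) ^ 2 / m + 1 ≤ 2 * (N : ℝ) ^ 2 / m := by
    rw [div_add_one hm.ne', div_le_div_iff_of_pos_right hm]; linarith
  set s := Real.sqrt m with hs
  have hs0 : 0 < s := Real.sqrt_pos.2 hm
  have hs2 : s ^ 2 = m := Real.sq_sqrt hm.le
  have b1 : ((Y : ℝ) * N * (((Y : ℝ) * N / m + 1) * Nat.log 2 (Y * N))) *
      ((N : ℝ) ^ 2 * (((N : ℝ) ^ 2 / m + 1) * Nat.log 2 (N * N))) ≤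
      ((N / q ^ 2) * N * (((N / q ^ 2) * N / m + 1) * L)) *
      ((N : ℝ) ^ 2 * ((2 * (N : ℝ) ^ 2 / m) * L)) := by gcongr
  refine le_of_sq_le_sq ?_ (by positivity)
  refine (key.trans b1).trans ?_
  rw [← hs2]
  have e1 : ((N / q ^ 2) * N * (((N / q ^ 2) * N / s ^ 2 + 1) * L)) *
      ((N : ℝ) ^ 2 * ((2 * (N : ℝ) ^ 2 / s ^ 2) * L)) =
      2 * ((N ^ 4 * L / s ^ 2 * (1 / q ^ 2)) ^ 2 + (N ^ 3 * L / s * (1 / q)) ^ 2) := by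
    field_simp
  rw [e1]
  have p1 : 0 ≤ N ^ 4 * L / s ^ 2 * (1 / q ^ 2) := by positivity
  have p2 : 0 ≤ N ^ 3 * L / s * (1 / q) := by positivity
  have e2 : 2 * N ^ 4 * L / s ^ 2 * (1 / q ^ 2) + 2 * N ^ 3 * L / s * (1 / q) =
    2 * ((N ^ 4 * L / s ^ 2 * (1 / q ^ 2)) + (N ^ 3 * L / s * (1 / q))) := by ring
  rw [e2]
  nlinarith [mul_nonneg p1 p2]

/-- number of representations weight -/
noncomputable def an (m : ℕ) (P : Finset ℕ) (a : ZMod m) (n : ℕ) : ℝ :=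
  ∑ p ∈ P, ∑ j ∈ P ×ˢ P, if (n : ZMod m) * p * (j.1 * j.2) = a then (1 : ℝ) else 0

lemma an_nonneg (m : ℕ) (P : Finset ℕ) (a : ZMod m) (n : ℕ) : 0 ≤ an m P a n :=
  Finset.sum_nonneg (fun _ _ => Finset.sum_nonneg (fun _ _ => by split_ifs <;> norm_num))

lemma an_pos (m : ℕ) (P : Finset ℕ) (a : ZMod m) (n : ℕ) (h : an m P a n ≠ 0) :
    ∃ p ∈ P, ∃ p' ∈ P, ∃ p'' ∈ P, (n : ZMod m) * p * (p' * p'') = a := by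
  obtain ⟨p, hp, h1⟩ := Finset.exists_ne_zero_of_sum_ne_zero h
  obtain ⟨j, hj, h2⟩ := Finset.exists_ne_zero_of_sum_ne_zero h1
  rw [Finset.mem_product] at hj
  refine ⟨p, hp, j.1, hj.1, j.2, hj.2, ?_⟩
  by_contra h3
  simp [h3] at h2

lemma an_coprime (m : ℕ) [NeZero m] (P : Finset ℕ) (a : (ZMod m)ˣ) (n : ℕ) (h : an m P a n ≠ 0) :
    n.Coprime m := by
  obtain ⟨p, _, p', _, p'', _, h⟩ := an_pos m P a n h
  have : IsUnit (n : ZMod m) := by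
    have h' : IsUnit ((n : ZMod m) * (p * (p' * p''))) := by rw [← mul_assoc, h]; exact a.isUnit
    exact isUnit_of_mul_isUnit_left h'
  exact (ZMod.isUnit_iff_coprime n m).1 this

lemma sum_an_dvd (m : ℕ) (P : Finset ℕ) (a : ZMod m) (N d : ℕ) (hd : 0 < d) :
    ∑ n ∈ (Finset.Icc 1 N).filter (fun n => d ∣ n), an m P a n = cnt m P a d (N / d) := by
  unfold cnt
  rw [Finset.sum_product]
  symm
  apply Finset.sum_bij (fun n _ => d * n)
  · intro n hn
    rw [Finset.mem_Icc] at hn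
    rw [Finset.mem_filter, Finset.mem_Icc]
    refine ⟨⟨Nat.mul_pos hd hn.1, ?_⟩, dvd_mul_right _ _⟩
    rw [mul_comm]; exact (Nat.le_div_iff_mul_le hd).1 hn.2
  · intro x _ y _ h; exact Nat.eq_of_mul_eq_mul_left hd h
  · intro n hn
    rw [Finset.mem_filter, Finset.mem_Icc] at hn
    obtain ⟨k, rfl⟩ := hn.2
    refine ⟨k, ?_, rfl⟩
    rw [Finset.mem_Icc, Nat.le_div_iff_mul_le hd]
    exact ⟨Nat.pos_of_mul_pos_left hn.1.1 |> fun h => by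
      rcases Nat.eq_zero_or_pos k with h0 | h0
      · subst h0; simp at hn
      · exact h0, by rw [mul_comm]; exact hn.1.2⟩
  · intro n _
    unfold an
    apply Finset.sum_congr rfl; intro p _; apply Finset.sum_congr rfl; intro j _
    have : (d : ZMod m) * ((n : ZMod m) * p * (j.1 * j.2)) = ((d * n : ℕ) : ZMod m) * p * (j.1 * j.2) := by
      push_cast; ring
    simp only [this]

lemma prod_inj {Q : Finset ℕ} (hQ : ∀ p ∈ Q, p.Prime) {T T' : Finset ℕ} (hT : T ⊆ Q) (hT' : T' ⊆ Q)
    (h : ∏ p ∈ T, p = ∏ p ∈ T', p) : T = T' := by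
  rw [← Nat.primeFactors_prod (fun p hp => hQ p (hT hp)), h,
    Nat.primeFactors_prod (fun p hp => hQ p (hT' hp))]

/-- linear functional evaluation -/
lemma sieve_sum (m : ℕ) [NeZero m] (N : ℕ) (P : Finset ℕ) (a : (ZMod m)ˣ) (K E : ℝ)
    (hE0 : 0 ≤ E)
    (hE : ∀ b : (ZMod m)ˣ, ∀ d : ℕ, 0 < d → |cnt m P a b (N / d) - K * N / m / d| ≤ E)
    (Q : Finset ℕ) (hQ : ∀ p ∈ Q, p.Prime ∧ p.Coprime m) (d : ℕ) (hd : 0 < d) (hdm : d.Coprime m)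
    (hdQ : ∀ p ∈ Q, d.Coprime p) (B D : ℝ) (hB : 0 ≤ B) (hD : 0 ≤ D)
    (F : (ℕ → ℝ) → ℝ) (hF : SV Q B D F) :
    |(∑ n ∈ (Finset.Icc 1 N).filter (fun n => d ∣ n), an m P a n * F (fun p => if p ∣ n then 1 else 0))
      - K * N / m / d * F (fun p => 1 / (p : ℝ))| ≤ B * D * E := by
  obtain ⟨c, h1, h2, h3⟩ := hF
  have hprod : ∀ T ∈ Q.powerset, ∀ n : ℕ, (∏ p ∈ T, (if p ∣ n then (1 : ℝ) else 0)) =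
      if (∏ p ∈ T, p) ∣ n then 1 else 0 := by
    intro T hT n
    have hTQ := Finset.mem_powerset.1 hT
    rw [Finset.prod_ite_zero]
    simp only [Finset.prod_const_one]
    congr 1
    apply propext
    constructor
    · intro h
      exact Finset.prod_primes_dvd _ (fun p hp => (hQ p (hTQ hp)).1.prime) h
    · intro h p hp
      exact (Finset.dvd_prod_of_mem (fun p => p) hp).trans h
  have hcop : ∀ T ∈ Q.powerset, d.Coprime (∏ p ∈ T, p) := by
    intro T hT
    exact Nat.Coprime.prod_right (fun p hp => hdQ p (Finset.mem_powerset.1 hT hp))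
  have hcopm : ∀ T ∈ Q.powerset, (d * ∏ p ∈ T, p).Coprime m := by
    intro T hT
    exact Nat.Coprime.mul_left hdm (Nat.Coprime.prod_left (fun p hp => (hQ p (Finset.mem_powerset.1 hT hp)).2))
  have hpos : ∀ T ∈ Q.powerset, 0 < ∏ p ∈ T, p := fun T hT =>
    Finset.prod_pos (fun p hp => (hQ p (Finset.mem_powerset.1 hT hp)).1.pos)
  have e1 : (∑ n ∈ (Finset.Icc 1 N).filter (fun n => d ∣ n), an m P a n * F (fun p => if p ∣ n then 1 else 0))
      = ∑ T ∈ Q.powerset, c T * cnt m P a ((d * ∏ p ∈ T, p : ℕ) : ZMod m) (N / (d * ∏ p ∈ T, p)) := by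
    simp_rw [h1, Finset.mul_sum]
    rw [Finset.sum_comm]
    apply Finset.sum_congr rfl
    intro T hT
    rw [← sum_an_dvd m P a N _ (Nat.mul_pos hd (hpos T hT)), Finset.mul_sum, Finset.sum_filter,
      Finset.sum_filter]
    apply Finset.sum_congr rfl
    intro n _
    rw [hprod T hT n]
    have : d * ∏ p ∈ T, p ∣ n ↔ d ∣ n ∧ ∏ p ∈ T, p ∣ n :=
      ⟨fun h => ⟨(dvd_mul_right _ _).trans h, (dvd_mul_left _ _).trans h⟩,
        fun h => (hcop T hT).mul_dvd_of_dvd_of_dvd h.1 h.2⟩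
    simp only [this]
    by_cases c1 : d ∣ n <;> by_cases c2 : ∏ p ∈ T, p ∣ n <;> simp [c1, c2]
    ring
  rw [e1, h1, Finset.mul_sum, ← Finset.sum_sub_distrib]
  set S := Q.powerset.filter (fun T => c T ≠ 0) with hS
  have hcard : (S.card : ℝ) ≤ D := by
    have : S.card ≤ (Finset.Icc 1 ⌊D⌋₊).card := by
      apply Finset.card_le_card_of_injOn (fun T => ∏ p ∈ T, p)
      · intro T hT
        rw [Finset.mem_coe, hS, Finset.mem_filter] at hT
        have := h3 T hT.1 hT.2
        rw [Finset.mem_coe, Finset.mem_Icc]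
        refine ⟨hpos T hT.1, Nat.le_floor ?_⟩
        push_cast; exact this
      · intro T hT T' hT' h
        rw [Finset.mem_coe, hS, Finset.mem_filter, Finset.mem_powerset] at hT hT'
        exact prod_inj (fun p hp => (hQ p hp).1) hT.1 hT'.1 h
    rw [Nat.card_Icc, Nat.add_sub_cancel] at this
    calc (S.card : ℝ) ≤ ⌊D⌋₊ := by exact_mod_cast this
      _ ≤ D := Nat.floor_le hD
  have e2 : ∀ T ∈ Q.powerset, |c T * cnt m P a ((d * ∏ p ∈ T, p : ℕ) : ZMod m) (N / (d * ∏ p ∈ T, p)) -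
      K * N / m / d * (c T * ∏ p ∈ T, 1 / (p : ℝ))| ≤ if c T ≠ 0 then B * E else 0 := by
    intro T hT
    split_ifs with h
    · have hb := hE (ZMod.unitOfCoprime _ (hcopm T hT)) (d * ∏ p ∈ T, p) (Nat.mul_pos hd (hpos T hT))
      rw [ZMod.coe_unitOfCoprime] at hb
      have : c T * cnt m P a ((d * ∏ p ∈ T, p : ℕ) : ZMod m) (N / (d * ∏ p ∈ T, p)) -
          K * N / m / d * (c T * ∏ p ∈ T, 1 / (p : ℝ)) = c T *
          (cnt m P a ((d * ∏ p ∈ T, p : ℕ) : ZMod m) (N / (d * ∏ p ∈ T, p)) - K * N / m / ((d * ∏ p ∈ T, p : ℕ) : ℝ)) := by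
        simp only [one_div, Finset.prod_inv_distrib]
        push_cast
        rw [mul_sub]
        congr 1
        rw [← div_div (K * N / m)]
        simp only [div_eq_mul_inv]
        ring
      rw [this, abs_mul]
      exact mul_le_mul (h2 T) hb (abs_nonneg _) hB
    · push Not at h
      simp [h]
  calc _ ≤ ∑ T ∈ Q.powerset, (if c T ≠ 0 then B * E else 0) :=
        (Finset.abs_sum_le_sum_abs _ _).trans (Finset.sum_le_sum e2)
    _ = S.card * (B * E) := by rw [← Finset.sum_filter, Finset.sum_const, nsmul_eq_mul]
    _ ≤ D * (B * E) := by gcongr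
    _ = _ := by ring


noncomputable def VV (R : ℕ → Prop) [DecidablePred R] (z : ℝ) : ℝ :=
  ∏ p ∈ (primesIn 2 z).filter R, (1 - 1 / (p : ℝ))

lemma VV_fac {p : ℕ} (hp : p.Prime) : 0 < 1 - 1 / (p : ℝ) ∧ 1 - 1 / (p : ℝ) ≤ 1 := by
  have h2 : (2 : ℝ) ≤ p := by exact_mod_cast hp.two_le
  constructor
  · rw [sub_pos, div_lt_one (by linarith)]; linarith
  · have : 0 ≤ 1 / (p : ℝ) := by positivity
    linarith

lemma VV_pos (R : ℕ → Prop) [DecidablePred R] (z : ℝ) : 0 < VV R z :=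
  Finset.prod_pos (fun p hp => (VV_fac (mem_primesIn.1 (Finset.mem_filter.1 hp).1).1).1)

lemma prod_primesIn_ge (R : ℕ → Prop) [DecidablePred R] (x y : ℝ) (hx : 2 ≤ x) (hxy : x ≤ y) :
    1 ≤ (∏ p ∈ (primesIn x y).filter R, (1 - 1 / (p : ℝ))) *
      (Real.log y / Real.log x * Real.exp (19 / Real.log x)) := by
  have hlx : 0 < Real.log x := Real.log_pos (by linarith)
  have hly : 0 < Real.log y := Real.log_pos (by linarith)
  have h := ar_mertens3 x y hx hxy
  have h1 : ∑ p ∈ (primesIn x y).filter R, (-Real.log (1 - 1 / (p : ℝ))) ≤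
      ∑ p ∈ primesIn x y, (-Real.log (1 - 1 / (p : ℝ))) := by
    apply Finset.sum_le_sum_of_subset_of_nonneg (Finset.filter_subset _ _)
    intro p hp _
    have := VV_fac (mem_primesIn.1 hp).1
    have := Real.log_nonpos this.1.le this.2
    linarith
  have h2 : (∏ p ∈ (primesIn x y).filter R, (1 - 1 / (p : ℝ))) =
      Real.exp (-∑ p ∈ (primesIn x y).filter R, (-Real.log (1 - 1 / (p : ℝ)))) := by
    rw [← Finset.sum_neg_distrib, Real.exp_sum]
    apply Finset.prod_congr rfl
    intro p hp
    rw [neg_neg, Real.exp_log (VV_fac (mem_primesIn.1 (Finset.mem_filter.1 hp).1).1).1]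
  have h3 : Real.log y / Real.log x = Real.exp (Real.log (Real.log y / Real.log x)) := by
    rw [Real.exp_log (by positivity)]
  rw [h2, h3, ← Real.exp_add, ← Real.exp_add]
  apply Real.one_le_exp
  linarith

lemma VV_ratio (R : ℕ → Prop) [DecidablePred R] (x y : ℝ) (hx : 2 ≤ x) (hxy : x ≤ y) :
    VV R x ≤ VV R y * (Real.log y / Real.log x * Real.exp (19 / Real.log x)) := by
  have h1 := prod_primesIn_ge R x y hx hxy
  have e : (primesIn 2 y).filter R = (primesIn 2 x).filter R ∪ (primesIn x y).filter R := by
    ext p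
    simp only [Finset.mem_filter, Finset.mem_union, mem_primesIn]
    constructor
    · rintro ⟨⟨a, b, c⟩, d⟩
      rcases lt_or_ge (p : ℝ) x with h | h
      · exact Or.inl ⟨⟨a, b, h⟩, d⟩
      · exact Or.inr ⟨⟨a, h, c⟩, d⟩
    · rintro (⟨⟨a, b, c⟩, d⟩ | ⟨⟨a, b, c⟩, d⟩)
      · exact ⟨⟨a, b, by linarith⟩, d⟩
      · exact ⟨⟨a, by linarith, c⟩, d⟩
  have hd : Disjoint ((primesIn 2 x).filter R) ((primesIn x y).filter R) := by
    rw [Finset.disjoint_left]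
    intro p hp hp'
    simp only [Finset.mem_filter, mem_primesIn] at hp hp'
    linarith [hp.1.2.2, hp'.1.2.1]
  have hV : VV R y = VV R x * ∏ p ∈ (primesIn x y).filter R, (1 - 1 / (p : ℝ)) := by
    unfold VV; rw [e, Finset.prod_union hd]
  rw [hV, mul_assoc]
  exact le_mul_of_one_le_right (VV_pos R x).le h1

/-- sifting indicator -/
noncomputable def ind (R : ℕ → Prop) [DecidablePred R] (z : ℝ) (n : ℕ) : ℝ :=
  ∏ p ∈ (primesIn 2 z).filter R, (1 - if p ∣ n then (1 : ℝ) else 0)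

lemma ind_cases (R : ℕ → Prop) [DecidablePred R] (z : ℝ) (n : ℕ) :
    (ind R z n = 0) ∨ (ind R z n = 1 ∧ ∀ p ∈ (primesIn 2 z).filter R, ¬ p ∣ n) := by
  by_cases h : ∃ p ∈ (primesIn 2 z).filter R, p ∣ n
  · obtain ⟨p, hp, h⟩ := h
    left
    exact Finset.prod_eq_zero hp (by simp [h])
  · push Not at h
    right
    refine ⟨Finset.prod_eq_one (fun p hp => by simp [h p hp]), h⟩

lemma ind_nonneg (R : ℕ → Prop) [DecidablePred R] (z : ℝ) (n : ℕ) : 0 ≤ ind R z n := by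
  rcases ind_cases R z n with h | h
  · rw [h]
  · rw [h.1]; norm_num

lemma ind_le_one (R : ℕ → Prop) [DecidablePred R] (z : ℝ) (n : ℕ) : ind R z n ≤ 1 := by
  rcases ind_cases R z n with h | h
  · rw [h]; norm_num
  · rw [h.1]

lemma ind_anti (R : ℕ → Prop) [DecidablePred R] (z z' : ℝ) (h : z' ≤ z) (n : ℕ) : ind R z n ≤ ind R z' n := by
  rcases ind_cases R z' n with h1 | h1
  · have : ind R z n = 0 := by
      rcases ind_cases R z n with h2 | h2
      · exact h2
      · exfalso
        have h3 : ind R z' n = 1 := by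
          apply Finset.prod_eq_one
          intro p hp
          have : p ∈ (primesIn 2 z).filter R := by
            simp only [Finset.mem_filter, mem_primesIn] at hp ⊢
            exact ⟨⟨hp.1.1, hp.1.2.1, by linarith [hp.1.2.2]⟩, hp.2⟩
          simp [h2.2 p this]
        rw [h1] at h3; norm_num at h3
    rw [this, h1]
  · rw [h1.1]; exact ind_le_one R z n

lemma core_aux (l q η : ℝ) (hl : 0 < l) (hq : 0 ≤ q) (h1 : 1 / 2 ≤ η) (h2 : η < 1) :
    (1 - q / (η * l)) * (2 / 17 * l) ≤ 15 / 17 * (2 / 15 * (l - q)) := by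
  have e : (1 - q / (η * l)) * (2 / 17 * l) = 2 / 17 * (l - q / η) := by
    have : η ≠ 0 := by linarith
    field_simp
  have : q ≤ q / η := by
    rw [le_div_iff₀ (by linarith)]; nlinarith
  rw [e]; linarith

section core
variable (m : ℕ) [NeZero m] (N : ℕ) (P : Finset ℕ) (a : (ZMod m)ˣ) (K E : ℝ)

lemma core_upper (hK : 0 ≤ K) (hE0 : 0 ≤ E)
    (hE : ∀ b : (ZMod m)ˣ, ∀ d : ℕ, 0 < d → |cnt m P a b (N / d) - K * N / m / d| ≤ E)
    (z' : ℝ) (hz' : wc ≤ z') (q : ℕ) (hq : q.Prime) (hqz : z' ≤ q) (hqm : q.Coprime m) :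
    ∑ n ∈ (Finset.Icc 1 N).filter (fun n => q ∣ n), an m P a n * ind (fun p => p.Coprime m) z' n ≤
      K * N / m / q * (VV (fun p => p.Coprime m) z' * 1.031) + c0c * z' ^ (7.5 : ℝ) * E := by
  obtain ⟨U, Lw, h1, -, h3, h4, -⟩ := brun_hooley z' hz' (fun p => p.Coprime m)
  have hw := wc_ge
  have hc := c0c_ge
  have hs := sieve_sum m N P a K E hE0 hE _ (fun p hp => by
    rw [Finset.mem_filter, mem_primesIn] at hp; exact ⟨hp.1.1, hp.2⟩) q hq.pos hqm (fun p hp => by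
    rw [Finset.mem_filter, mem_primesIn] at hp
    rw [Nat.coprime_primes hq hp.1.1]
    rintro rfl
    linarith [hp.1.2.2]) 1 _ zero_le_one (mul_nonneg (by linarith) (Real.rpow_nonneg (by linarith) _)) U h1
  have h5 : ∑ n ∈ (Finset.Icc 1 N).filter (fun n => q ∣ n), an m P a n * ind (fun p => p.Coprime m) z' n ≤
      ∑ n ∈ (Finset.Icc 1 N).filter (fun n => q ∣ n), an m P a n * U (fun p => if p ∣ n then 1 else 0) := by
    apply Finset.sum_le_sum
    intro n _
    apply mul_le_mul_of_nonneg_left _ (an_nonneg _ _ _ _)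
    exact (h3 _ (fun p => by split_ifs <;> norm_num)).2
  have h6 : K * N / m / q * U (fun p => 1 / (p : ℝ)) ≤
      K * N / m / q * (VV (fun p => p.Coprime m) z' * 1.031) :=
    mul_le_mul_of_nonneg_left h4 (by positivity)
  have := (abs_le.1 hs).2
  linarith

lemma core_lower (hK : 0 ≤ K) (hE0 : 0 ≤ E)
    (hE : ∀ b : (ZMod m)ˣ, ∀ d : ℕ, 0 < d → |cnt m P a b (N / d) - K * N / m / d| ≤ E)
    (z : ℝ) (hz : wc ≤ z) :
    K * N / m * (VV (fun p => p.Coprime m) z * 0.968) - (Real.log z + 2) * (c0c * z ^ (8.5 : ℝ)) * E ≤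
    ∑ n ∈ Finset.Icc 1 N, an m P a n * ind (fun p => p.Coprime m) z n := by
  obtain ⟨U, Lw, -, h1, h3, -, h4⟩ := brun_hooley z hz (fun p => p.Coprime m)
  have hw := wc_ge
  have hc := c0c_ge
  have hlz : 0 ≤ Real.log z := Real.log_nonneg (by linarith)
  have hs := sieve_sum m N P a K E hE0 hE _ (fun p hp => by
    rw [Finset.mem_filter, mem_primesIn] at hp; exact ⟨hp.1.1, hp.2⟩) 1 one_pos (Nat.coprime_one_left m) (fun p hp => by
    exact Nat.coprime_one_left p) _ _ (by positivity) (mul_nonneg (by linarith) (Real.rpow_nonneg (by linarith) _)) Lw h1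
  have h5 : ∑ n ∈ (Finset.Icc 1 N).filter (fun n => 1 ∣ n), an m P a n * Lw (fun p => if p ∣ n then 1 else 0) ≤
      ∑ n ∈ Finset.Icc 1 N, an m P a n * ind (fun p => p.Coprime m) z n := by
    rw [Finset.filter_true_of_mem (fun n _ => one_dvd n)]
    apply Finset.sum_le_sum
    intro n _
    apply mul_le_mul_of_nonneg_left _ (an_nonneg _ _ _ _)
    exact (h3 _ (fun p => by split_ifs <;> norm_num)).1
  have h6 : K * N / m * (VV (fun p => p.Coprime m) z * 0.968) ≤ K * N / m / (1 : ℕ) * Lw (fun p => 1 / (p : ℝ)) := by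
    rw [Nat.cast_one, div_one]
    exact mul_le_mul_of_nonneg_left h4 (by positivity)
  have := (abs_le.1 hs).1
  linarith

set_option maxHeartbeats 1600000 in
lemma core_weight (hK : 0 ≤ K) (hE0 : 0 ≤ E)
    (hE : ∀ b : (ZMod m)ˣ, ∀ d : ℕ, 0 < d → |cnt m P a b (N / d) - K * N / m / d| ≤ E)
    (D η lam : ℝ) (hD : 1 < D) (hη : 1 / 2 ≤ η) (hη1 : η < 1)
    (hlam0 : 0 ≤ lam) (hlam : lam * 2.06 ≤ 1)
    (hz0 : wc ≤ D ^ ((1 - η) * (2 / 15))) (hk : 19 / Real.log (D ^ ((1 - η) * (2 / 15))) ≤ 0.0005) :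
    K * N / m * (VV (fun p => p.Coprime m) (D ^ (2 / 17 : ℝ)) * 0.01) - (Real.log D + 5) * (c0c * D) * E ≤
    ∑ n ∈ Finset.Icc 1 N, an m P a n * (ind (fun p => p.Coprime m) (D ^ (2 / 17 : ℝ)) n *
      (1 - lam * ∑ q ∈ (primesIn (D ^ (2 / 17 : ℝ)) (D ^ η)).filter (fun q => q.Coprime m ∧ q ∣ n),
        (1 - Real.log q / Real.log (D ^ η)))) := by
  classical
  have hw := wc_ge
  have hc := c0c_ge
  set z := D ^ (2 / 17 : ℝ) with hzdef
  set y := D ^ η with hydef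
  set z0 := D ^ ((1 - η) * (2 / 15)) with hz0def
  set V := VV (fun p => p.Coprime m) z with hV
  have hV0 : 0 < V := VV_pos _ _
  have hD0 : 0 < D := by linarith
  have hlD : 0 < Real.log D := Real.log_pos hD
  have hlz : Real.log z = 2 / 17 * Real.log D := Real.log_rpow hD0 _
  have hly : Real.log y = η * Real.log D := Real.log_rpow hD0 _
  have hlz0 : Real.log z0 = (1 - η) * (2 / 15) * Real.log D := Real.log_rpow hD0 _
  have hlz0p : 0 < Real.log z0 := by
    rw [hlz0]; have : 0 < 1 - η := by linarith
    positivity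
  have hz0z : z0 ≤ z := Real.rpow_le_rpow_of_exponent_le hD.le (by linarith)
  have hzy : z ≤ y := Real.rpow_le_rpow_of_exponent_le hD.le (by linarith)
  have hz2 : 2 ≤ z := by linarith
  have hz85 : z ^ (8.5 : ℝ) = D := by
    rw [hzdef, ← Real.rpow_mul hD0.le]; norm_num
  set J := (primesIn z y).filter (fun q => q.Coprime m) with hJ
  have hJm : ∀ q ∈ J, q.Prime ∧ z ≤ (q:ℝ) ∧ (q : ℝ) < y ∧ q.Coprime m := by
    intro q hq
    rw [hJ, Finset.mem_filter, mem_primesIn] at hq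
    exact ⟨hq.1.1, hq.1.2.1, hq.1.2.2, hq.2⟩
  -- rewriting
  have e1 : ∑ n ∈ Finset.Icc 1 N, an m P a n * (ind (fun p => p.Coprime m) z n *
      (1 - lam * ∑ q ∈ (primesIn z y).filter (fun q => q.Coprime m ∧ q ∣ n),
        (1 - Real.log q / Real.log y))) =
      ∑ n ∈ Finset.Icc 1 N, an m P a n * ind (fun p => p.Coprime m) z n -
      ∑ q ∈ J, lam * (1 - Real.log q / Real.log y) *
        ∑ n ∈ (Finset.Icc 1 N).filter (fun n => q ∣ n), an m P a n * ind (fun p => p.Coprime m) z n := by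
    have : ∑ q ∈ J, lam * (1 - Real.log q / Real.log y) *
        ∑ n ∈ (Finset.Icc 1 N).filter (fun n => q ∣ n), an m P a n * ind (fun p => p.Coprime m) z n =
        ∑ n ∈ Finset.Icc 1 N, an m P a n * ind (fun p => p.Coprime m) z n * (lam *
         ∑ q ∈ (primesIn z y).filter (fun q => q.Coprime m ∧ q ∣ n), (1 - Real.log q / Real.log y)) := by
      simp_rw [← Finset.filter_filter, ← hJ, Finset.sum_filter, Finset.mul_sum]
      rw [Finset.sum_comm]
      apply Finset.sum_congr rfl; intro n _; apply Finset.sum_congr rfl; intro q _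
      split_ifs <;> ring
    rw [this, ← Finset.sum_sub_distrib]
    apply Finset.sum_congr rfl; intro n _; ring
  rw [e1]
  have hlow := core_lower m N P a K E hK hE0 hE z (by linarith)
  rw [hz85] at hlow
  -- per q
  have hq : ∀ q ∈ J, lam * (1 - Real.log q / Real.log y) *
        ∑ n ∈ (Finset.Icc 1 N).filter (fun n => q ∣ n), an m P a n * ind (fun p => p.Coprime m) z n ≤
        (lam * (K * N / m * V * 1.031 * (15 / 17) * 1.001) + c0c * D * E) * (1 / q) := by
    intro q hq
    obtain ⟨q1, q2, q3, q4⟩ := hJm q hq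
    have hq0 : (0 : ℝ) < q := by exact_mod_cast q1.pos
    have hlq : Real.log q ≤ η * Real.log D := by
      rw [← hly]; exact Real.log_le_log hq0 q3.le
    have hlq2 : 2 / 17 * Real.log D ≤ Real.log q := by
      rw [← hlz]; exact Real.log_le_log (by linarith) q2
    set w := 1 - Real.log q / Real.log y with hw'
    have hw0 : 0 ≤ w := by
      rw [hw', hly, sub_nonneg]
      apply div_le_one_of_le₀ hlq (by positivity)
    have hw1 : w ≤ 1 := by
      rw [hw', hly]
      have : 0 ≤ Real.log q / (η * Real.log D) := by
        apply div_nonneg _ (by positivity)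
        exact le_trans (by positivity) hlq2
      linarith
    set z' := (D / q) ^ (2 / 15 : ℝ) with hz'
    have hlz' : Real.log z' = 2 / 15 * (Real.log D - Real.log q) := by
      rw [hz', Real.log_rpow (by positivity), Real.log_div hD0.ne' hq0.ne']
    have hz'pos : 0 < z' := by positivity
    have hz0z' : z0 ≤ z' := by
      rw [← Real.log_le_log_iff (by positivity) hz'pos, hlz0, hlz']
      linarith
    have hz'z : z' ≤ z := by
      rw [← Real.log_le_log_iff hz'pos (by positivity), hlz, hlz']
      linarith
    have hz'75 : z' ^ (7.5 : ℝ) = D / q := by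
      rw [hz', ← Real.rpow_mul (by positivity)]; norm_num
    have hup := core_upper m N P a K E hK hE0 hE z' (by linarith) q q1 (by linarith) q4
    rw [hz'75] at hup
    have hle : ∑ n ∈ (Finset.Icc 1 N).filter (fun n => q ∣ n), an m P a n * ind (fun p => p.Coprime m) z n ≤
        ∑ n ∈ (Finset.Icc 1 N).filter (fun n => q ∣ n), an m P a n * ind (fun p => p.Coprime m) z' n :=
      Finset.sum_le_sum (fun n _ => mul_le_mul_of_nonneg_left (ind_anti _ _ _ hz'z n) (an_nonneg _ _ _ _))
    have hVr := VV_ratio (fun p => p.Coprime m) z' z (by linarith) hz'z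
    have hexp : Real.exp (19 / Real.log z') ≤ 1.001 := by
      have h1 : 19 / Real.log z' ≤ 0.0005 := by
        refine le_trans ?_ hk
        apply div_le_div_of_nonneg_left (by norm_num) hlz0p
        exact Real.log_le_log (by linarith) hz0z'
      have h0 : 0 ≤ 19 / Real.log z' := by
        apply div_nonneg (by norm_num)
        exact Real.log_nonneg (by linarith)
      have := Real.abs_exp_sub_one_le (x := 19 / Real.log z') (by rw [abs_of_nonneg h0]; linarith)
      rw [abs_of_nonneg h0] at this
      have := (abs_le.1 this).2
      linarith
    have hlz'p : 0 < Real.log z' := by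
      rw [hlz']; nlinarith
    have hwr : w * (Real.log z / Real.log z') ≤ 15 / 17 := by
      rw [hlz, hlz', hw', hly, mul_div_assoc', div_le_iff₀ (by rw [← hlz']; exact hlz'p)]
      exact core_aux _ _ _ hlD (le_trans (by positivity) hlq2) hη hη1
    have hwV : w * VV (fun p => p.Coprime m) z' ≤ V * (15 / 17) * 1.001 := by
      have hex := Real.exp_pos (19 / Real.log z')
      calc w * VV (fun p => p.Coprime m) z' ≤ w * (V * (Real.log z / Real.log z' * Real.exp (19 / Real.log z'))) :=
            mul_le_mul_of_nonneg_left hVr hw0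
        _ = V * (w * (Real.log z / Real.log z')) * Real.exp (19 / Real.log z') := by ring
        _ ≤ V * (15 / 17) * 1.001 := by gcongr
    have hX : 0 ≤ K * N / m := by positivity
    calc lam * w * ∑ n ∈ (Finset.Icc 1 N).filter (fun n => q ∣ n), an m P a n * ind (fun p => p.Coprime m) z n
        ≤ lam * w * (K * N / m / q * (VV (fun p => p.Coprime m) z' * 1.031) + c0c * (D / q) * E) :=
          mul_le_mul_of_nonneg_left (hle.trans hup) (by positivity)
      _ = lam * (K * N / m * (w * VV (fun p => p.Coprime m) z') * 1.031) * (1 / q) +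
          (lam * w) * (c0c * D * E * (1 / q)) := by field_simp
      _ ≤ lam * (K * N / m * (V * (15 / 17) * 1.001) * 1.031) * (1 / q) +
          1 * (c0c * D * E * (1 / q)) := by
          gcongr
          nlinarith
      _ = _ := by ring
  have hsum := Finset.sum_le_sum hq
  rw [← Finset.mul_sum] at hsum
  have hS : ∑ q ∈ J, 1 / (q : ℝ) ≤ 2.1425 := by
    have h1 : ∑ q ∈ J, 1 / (q : ℝ) ≤ ∑ q ∈ primesIn z y, 1 / (q : ℝ) :=
      Finset.sum_le_sum_of_subset_of_nonneg (Finset.filter_subset _ _) (fun _ _ _ => by positivity)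
    have h2 := ar_mertens2 z y hz2 hzy
    have h3 : Real.log (Real.log y / Real.log z) ≤ 2.142 := by
      have : Real.log y / Real.log z ≤ 8.5 := by
        rw [hly, hlz, div_le_iff₀ (by positivity)]; nlinarith
      have h4 : 0 < Real.log y / Real.log z := by
        rw [hly, hlz]; positivity
      refine (Real.log_le_log h4 this).trans ?_
      have e : (8.5 : ℝ) = 2 ^ 3 * 1.0625 := by norm_num
      rw [e, Real.log_mul (by norm_num) (by norm_num), Real.log_pow]
      have h7 := Real.log_two_lt_d9
      have h8 := Real.log_le_sub_one_of_pos (x := 1.0625) (by norm_num)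
      push_cast
      linarith
    have h5 : 15 / Real.log z ≤ 0.0005 := by
      have h6 : Real.log z0 ≤ Real.log z := Real.log_le_log (by positivity) hz0z
      rw [div_le_iff₀ hlz0p] at hk
      rw [div_le_iff₀ (by linarith)]
      linarith
    linarith
  have hX : 0 ≤ K * N / m := by positivity
  have hA : (lam * (K * N / m * V * 1.031 * (15 / 17) * 1.001) + c0c * D * E) * ∑ q ∈ J, 1 / (q : ℝ) ≤
      (lam * (K * N / m * V * 1.031 * (15 / 17) * 1.001) + c0c * D * E) * 2.1425 :=
    mul_le_mul_of_nonneg_left hS (by positivity)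
  have hXV : 0 ≤ K * N / m * V := by positivity
  have hlx : lam * (K * N / m * V) * 2.06 ≤ K * N / m * V := by nlinarith
  have hcDE : 0 ≤ c0c * D * E := by positivity
  have hlast : (Real.log z + 2) * (c0c * D) * E ≤ (Real.log D + 2) * (c0c * D) * E := by
    have : Real.log z ≤ Real.log D := by rw [hlz]; linarith
    apply mul_le_mul_of_nonneg_right _ hE0
    apply mul_le_mul_of_nonneg_right _ (by positivity)
    linarith
  nlinarith
end core


lemma weight_omega (m n N r : ℕ) (z y T lam : ℝ) (hz : 2 ≤ z) (hzy : z ≤ y)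
    (hn : 1 ≤ n) (hnN : n ≤ N) (hnm : n.Coprime m)
    (hrough : ∀ p, p.Prime → p ∣ n → z ≤ (p : ℝ)) (hsq : ∀ q, q.Prime → ¬ q ^ 2 ∣ n)
    (hT : Real.log N ≤ T * Real.log y) (hlam0 : 0 < lam) (hlam : 1 / lam = r + 1 - T)
    (hW : 0 < 1 - lam * ∑ q ∈ (primesIn z y).filter (fun q => q.Coprime m ∧ q ∣ n),
        (1 - Real.log q / Real.log y)) :
    n.primeFactorsList.length ≤ r := by
  have hly : 0 < Real.log y := Real.log_pos (by linarith)
  have hn0 : n ≠ 0 := by omega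
  have hsf : Squarefree n := by
    rw [Nat.squarefree_iff_prime_squarefree]
    intro p hp h
    exact hsq p hp (by rw [sq]; exact h)
  have hlen : n.primeFactorsList.length = n.primeFactors.card := by
    have := (Nat.squarefree_iff_nodup_primeFactorsList hn0).1 hsf
    rw [← List.toFinset_card_of_nodup this]; rfl
  rw [hlen]
  have hsub : (primesIn z y).filter (fun q => q.Coprime m ∧ q ∣ n) ⊆ n.primeFactors := by
    intro q hq
    rw [Finset.mem_filter, mem_primesIn] at hq
    exact Nat.mem_primeFactors.2 ⟨hq.1.1, hq.2.2, hn0⟩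
  have h1 : ∑ q ∈ n.primeFactors, (1 - Real.log q / Real.log y) ≤
      ∑ q ∈ (primesIn z y).filter (fun q => q.Coprime m ∧ q ∣ n), (1 - Real.log q / Real.log y) := by
    rw [← Finset.sum_sdiff hsub]
    have : ∑ q ∈ n.primeFactors \ (primesIn z y).filter (fun q => q.Coprime m ∧ q ∣ n),
        (1 - Real.log q / Real.log y) ≤ 0 := by
      apply Finset.sum_nonpos
      intro q hq
      rw [Finset.mem_sdiff, Nat.mem_primeFactors, Finset.mem_filter, mem_primesIn] at hq
      obtain ⟨⟨a1, a2, a3⟩, a4⟩ := hq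
      have hy : y ≤ q := by
        by_contra h
        push Not at h
        exact a4 ⟨⟨a1, hrough q a1 a2, h⟩, Nat.Coprime.coprime_dvd_left a2 hnm, a2⟩
      have := Real.log_le_log (by linarith) hy
      rw [sub_nonpos, le_div_iff₀ hly]
      linarith
    linarith
  have h2 : ∑ q ∈ n.primeFactors, Real.log q = Real.log n := by
    conv_rhs => rw [← Nat.prod_primeFactors_of_squarefree hsf]
    push_cast
    rw [Real.log_prod]
    intro q hq
    exact_mod_cast (Nat.prime_of_mem_primeFactors hq).ne_zero
  have h3 : ∑ q ∈ n.primeFactors, (1 - Real.log q / Real.log y) =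
      n.primeFactors.card - Real.log n / Real.log y := by
    rw [Finset.sum_sub_distrib, ← Finset.sum_div, h2]; simp
  have h4 : Real.log n / Real.log y ≤ T := by
    rw [div_le_iff₀ hly]
    refine le_trans (Real.log_le_log (by exact_mod_cast hn) (by exact_mod_cast hnN)) hT
  have h5 : ∑ q ∈ (primesIn z y).filter (fun q => q.Coprime m ∧ q ∣ n), (1 - Real.log q / Real.log y) < 1 / lam := by
    rw [lt_div_iff₀ hlam0]; linarith
  have h6 : (n.primeFactors.card : ℝ) < r + 1 := by linarith
  have : n.primeFactors.card < r + 1 := by exact_mod_cast h6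
  omega

theorem core_find (m : ℕ) [NeZero m] (N : ℕ) (P : Finset ℕ) (a : (ZMod m)ˣ) (K E : ℝ)
    (hK : 0 ≤ K) (hE0 : 0 ≤ E)
    (hE : ∀ b : (ZMod m)ˣ, ∀ d : ℕ, 0 < d → |cnt m P a b (N / d) - K * N / m / d| ≤ E)
    (D η lam : ℝ) (hD : 1 < D) (hη : 1 / 2 ≤ η) (hη1 : η < 1)
    (hlam0 : 0 < lam) (hlam : lam * 2.06 ≤ 1)
    (hz0 : wc ≤ D ^ ((1 - η) * (2 / 15))) (hk : 19 / Real.log (D ^ ((1 - η) * (2 / 15))) ≤ 0.0005)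
    (T : ℝ) (r : ℕ) (hT : Real.log N ≤ T * Real.log (D ^ η)) (hlamT : 1 / lam = r + 1 - T)
    (S1 S2 : ℝ) (hS1 : an m P a 1 ≤ S1)
    (hS2 : ∑ q ∈ (primesIn (D ^ (2 / 17 : ℝ)) (N + 1)).filter (fun q => q.Coprime m),
      cnt m P a ((q ^ 2 : ℕ) : ZMod m) (N / q ^ 2) ≤ S2)
    (hmain : (Real.log D + 5) * (c0c * D) * E + S1 + S2 <
      K * N / m * (VV (fun p => p.Coprime m) (D ^ (2 / 17 : ℝ)) * 0.01)) :
    ∃ n, 1 < n ∧ n ≤ N ∧ an m P a n ≠ 0 ∧ n.primeFactorsList.length ≤ r := by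
  by_contra hcon
  push Not at hcon
  have hw := core_weight m N P a K E hK hE0 hE D η lam hD hη hη1 hlam0.le hlam hz0 hk
  have hwc := wc_ge
  set z := D ^ (2 / 17 : ℝ) with hzdef
  set y := D ^ η with hydef
  have hz0z : D ^ ((1 - η) * (2 / 15)) ≤ z := Real.rpow_le_rpow_of_exponent_le hD.le (by linarith)
  have hzy : z ≤ y := Real.rpow_le_rpow_of_exponent_le hD.le (by linarith)
  have hz2 : 2 ≤ z := by linarith
  have hly : 0 < Real.log y := Real.log_pos (by linarith)
  set J := (primesIn z (N + 1)).filter (fun q => q.Coprime m) with hJ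
  have hpt : ∀ n ∈ Finset.Icc 1 N, an m P a n * (ind (fun p => p.Coprime m) z n *
      (1 - lam * ∑ q ∈ (primesIn z y).filter (fun q => q.Coprime m ∧ q ∣ n),
        (1 - Real.log q / Real.log y))) ≤
      (if n = 1 then an m P a n else 0) + ∑ q ∈ J, if q ^ 2 ∣ n then an m P a n else 0 := by
    intro n hn
    rw [Finset.mem_Icc] at hn
    have ha0 := an_nonneg m P a n
    have t1 : 0 ≤ (if n = 1 then an m P a n else 0) := by split_ifs <;> simp [ha0]
    have t2 : ∀ q ∈ J, 0 ≤ if q ^ 2 ∣ n then an m P a n else 0 := by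
      intro q _; split_ifs <;> simp [ha0]
    have t3 := Finset.sum_nonneg t2
    have hsum0 : 0 ≤ ∑ q ∈ (primesIn z y).filter (fun q => q.Coprime m ∧ q ∣ n),
        (1 - Real.log q / Real.log y) := by
      apply Finset.sum_nonneg
      intro q hq
      rw [Finset.mem_filter, mem_primesIn] at hq
      rw [sub_nonneg]
      apply div_le_one_of_le₀ _ hly.le
      exact Real.log_le_log (by exact_mod_cast hq.1.1.pos) hq.1.2.2.le
    by_cases han : an m P a n = 0
    · rw [han] at t1 t3 ⊢
      rw [zero_mul]; linarith
    have hcop := an_coprime m P a n han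
    rcases ind_cases (fun p => p.Coprime m) z n with h | ⟨h, hr⟩
    · rw [h, zero_mul, mul_zero]; linarith
    rw [h, one_mul]
    have hrough : ∀ p, p.Prime → p ∣ n → z ≤ (p : ℝ) := by
      intro p hp hpn
      by_contra hlt
      push Not at hlt
      apply hr p _ hpn
      rw [Finset.mem_filter, mem_primesIn]
      exact ⟨⟨hp, by exact_mod_cast hp.two_le, hlt⟩, Nat.Coprime.coprime_dvd_left hpn hcop⟩
    have hle : an m P a n * (1 - lam * ∑ q ∈ (primesIn z y).filter (fun q => q.Coprime m ∧ q ∣ n),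
        (1 - Real.log q / Real.log y)) ≤ an m P a n := by
      apply mul_le_of_le_one_right ha0
      have := mul_nonneg hlam0.le hsum0
      linarith
    by_cases h1 : n = 1
    · rw [if_pos h1]; linarith
    by_cases h2 : ∃ q, q.Prime ∧ q ^ 2 ∣ n
    · obtain ⟨q, hq, hqn⟩ := h2
      have hqn' : q ∣ n := (dvd_pow_self q two_ne_zero).trans hqn
      have hqJ : q ∈ J := by
        rw [hJ, Finset.mem_filter, mem_primesIn]
        refine ⟨⟨hq, hrough q hq hqn', ?_⟩, Nat.Coprime.coprime_dvd_left hqn' hcop⟩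
        have : q ≤ N := (Nat.le_of_dvd (by omega) hqn').trans hn.2
        have : (q : ℝ) ≤ N := by exact_mod_cast this
        linarith
      have := Finset.single_le_sum t2 hqJ
      rw [if_pos hqn] at this
      linarith
    · push Not at h2
      have hneg : 1 - lam * ∑ q ∈ (primesIn z y).filter (fun q => q.Coprime m ∧ q ∣ n),
        (1 - Real.log q / Real.log y) ≤ 0 := by
        by_contra hpos
        push Not at hpos
        have := weight_omega m n N r z y T lam hz2 hzy hn.1 hn.2 hcop hrough h2 hT hlam0 hlamT hpos
        have := hcon n (by omega) hn.2 han
        omega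
      have := mul_nonpos_of_nonneg_of_nonpos ha0 hneg
      linarith
  have hs := Finset.sum_le_sum hpt
  rw [Finset.sum_add_distrib, Finset.sum_comm (t := J)] at hs
  have e1 : ∑ n ∈ Finset.Icc 1 N, (if n = 1 then an m P a n else 0) ≤ an m P a 1 := by
    rw [Finset.sum_ite_eq']
    split_ifs
    · exact le_rfl
    · exact an_nonneg _ _ _ _
  have e2 : ∑ q ∈ J, ∑ n ∈ Finset.Icc 1 N, (if q ^ 2 ∣ n then an m P a n else 0) ≤ S2 := by
    refine le_trans (le_of_eq ?_) hS2
    apply Finset.sum_congr rfl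
    intro q hq
    rw [hJ, Finset.mem_filter, mem_primesIn] at hq
    rw [← Finset.sum_filter, sum_an_dvd m P a N (q ^ 2) (pow_pos hq.1.1.pos 2)]
  linarith


noncomputable def c3c : ℝ := Real.exp (19 / Real.log 2) / Real.log 2

lemma c3c_pos : 0 < c3c := div_pos (Real.exp_pos _) (Real.log_pos (by norm_num))

lemma VV_lower (R : ℕ → Prop) [DecidablePred R] (z : ℝ) (hz : 2 ≤ z) :
    1 ≤ VV R z * (Real.log z * c3c) := by
  have h := prod_primesIn_ge R 2 z le_rfl hz
  have e : Real.log z / Real.log 2 * Real.exp (19 / Real.log 2) = Real.log z * c3c := by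
    unfold c3c; ring
  rw [e] at h
  exact h

lemma sum_inv_primes_sq (R : ℕ → Prop) [DecidablePred R] (z : ℝ) (hz : 2 ≤ z) (N : ℕ) :
    ∑ q ∈ (primesIn z (N + 1)).filter R, 1 / (q : ℝ) ^ 2 ≤ 2 / z := by
  set k := ⌈z⌉₊ with hk
  have hkz : z ≤ k := Nat.le_ceil z
  have hk1 : 1 ≤ k := by
    have : (1 : ℝ) ≤ k := by linarith
    exact_mod_cast this
  have hsub : (primesIn z (N + 1)).filter R ⊆ Finset.Ioo (k - 1) (N + 1) := by
    intro q hq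
    rw [Finset.mem_filter, mem_primesIn] at hq
    have h1 : k ≤ q := Nat.ceil_le.2 hq.1.2.1
    have h2 : q < N + 1 := by exact_mod_cast hq.1.2.2
    rw [Finset.mem_Ioo]; omega
  calc _ ≤ ∑ q ∈ Finset.Ioo (k - 1) (N + 1), 1 / (q : ℝ) ^ 2 :=
        Finset.sum_le_sum_of_subset_of_nonneg hsub (fun _ _ _ => by positivity)
    _ ≤ 2 / (((k - 1 : ℕ) : ℝ) + 1) := by
        simp_rw [one_div]
        exact sum_Ioo_inv_sq_le _ _
    _ ≤ 2 / z := by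
        apply div_le_div_of_nonneg_left (by norm_num) (by linarith)
        have : ((k - 1 : ℕ) : ℝ) + 1 = k := by
          rw [Nat.cast_sub hk1]; simp
        rw [this]; exact hkz

lemma sum_inv_primes (R : ℕ → Prop) [DecidablePred R] (z : ℝ) (N : ℕ) :
    ∑ q ∈ (primesIn z (N + 1)).filter R, 1 / (q : ℝ) ≤ 1 + Real.log N := by
  have hsub : (primesIn z (N + 1)).filter R ⊆ Finset.Icc 1 N := by
    intro q hq
    rw [Finset.mem_filter, mem_primesIn] at hq
    have h2 : q < N + 1 := by exact_mod_cast hq.1.2.2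
    have := hq.1.1.pos
    rw [Finset.mem_Icc]; omega
  calc _ ≤ ∑ q ∈ Finset.Icc 1 N, 1 / (q : ℝ) :=
        Finset.sum_le_sum_of_subset_of_nonneg hsub (fun _ _ _ => by positivity)
    _ = ((harmonic N : ℚ) : ℝ) := by
        rw [harmonic_eq_sum_Icc]; push_cast; simp
    _ ≤ _ := harmonic_le_one_add_log N

/-- primes up to N coprime to m -/
noncomputable def PP (m N : ℕ) : Finset ℕ := (Finset.Icc 1 N).filter (fun p => p.Prime ∧ p.Coprime m)

lemma mem_PP {m N p : ℕ} (h : p ∈ PP m N) : p.Prime ∧ p ≤ N ∧ p.Coprime m := by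
  rw [PP, Finset.mem_filter, Finset.mem_Icc] at h
  exact ⟨h.2.1, h.1.2, h.2.2⟩

lemma an_one (m : ℕ) (P : Finset ℕ) (a : ZMod m) : an m P a 1 = cnt m P a 1 1 := by
  have := sum_an_dvd m P a 1 1 one_pos
  simpa using this

set_option maxHeartbeats 1000000 in
theorem fixed_find (m : ℕ) [NeZero m] (N : ℕ) (a : (ZMod m)ˣ) (L D θ : ℝ) (l : ℕ)
    (h1 : 1 + Real.log m ≤ L) (h2 : 1 + Real.log (N + 1) ≤ L)
    (h3 : (Nat.log 2 (m * N) : ℝ) ≤ L) (h4 : (Nat.log 2 (N * N) : ℝ) ≤ L) (hmN : (m : ℝ) ≤ N ^ 2)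
    (hN : 1 ≤ N) (hK : (N : ℝ) / (4 * L) ≤ (PP m N).card)
    (hD : 1 < D) (hDL : Real.log D + 5 ≤ L) (hθ : 2 ≤ θ) (hθl : 2.07 + θ ≤ l + 2)
    (hlN : Real.log N ≤ θ * Real.log D)
    (hz0 : wc ≤ D ^ ((1 - θ / (θ + 0.01)) * (2 / 15)))
    (hk : 19 / Real.log (D ^ ((1 - θ / (θ + 0.01)) * (2 / 15))) ≤ 0.0005)
    (hf1 : 128000 * c0c * c3c * L ^ 7 * (D * Real.sqrt m) < N)
    (hf2 : 51200 * c3c * L ^ 5 < D ^ (2 / 17 : ℝ)) :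
    ∃ n, 1 < n ∧ n ≤ N ∧ an m (PP m N) a n ≠ 0 ∧ n.primeFactorsList.length ≤ l + 1 := by
  have hwc := wc_ge
  have hc0 := c0c_ge
  have hc3 := c3c_pos
  have hm : (0 : ℝ) < m := by exact_mod_cast Nat.pos_of_ne_zero (NeZero.ne m)
  have hm1 : (1 : ℝ) ≤ m := by exact_mod_cast Nat.pos_of_ne_zero (NeZero.ne m)
  have hN0 : (0 : ℝ) < N := by exact_mod_cast hN
  set P := PP m N with hPdef
  have hP : ∀ p ∈ P, p.Prime ∧ p ≤ N ∧ p.Coprime m := fun p hp => mem_PP hp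
  have hcard : (P.card : ℝ) ≤ N := by
    have : P.card ≤ N := by
      have h := Finset.card_le_card (Finset.filter_subset _ _ : PP m N ⊆ Finset.Icc 1 N)
      rw [Nat.card_Icc] at h
      exact h
    exact_mod_cast this
  have hlm := Real.log_natCast_nonneg m
  have hL1 : 1 ≤ L := by linarith
  set s := Real.sqrt m with hs
  have hs0 : 0 < s := Real.sqrt_pos.2 hm
  have hs2 : s ^ 2 = m := Real.sq_sqrt hm.le
  have hs1 : 1 ≤ s := by
    rw [hs]; exact Real.one_le_sqrt.2 hm1
  set η := θ / (θ + 0.01) with hη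
  have hη1 : η < 1 := by rw [hη, div_lt_one (by linarith)]; linarith
  have hη2 : 1 / 2 ≤ η := by rw [hη, div_le_div_iff₀ (by norm_num) (by linarith)]; linarith
  set z := D ^ (2 / 17 : ℝ) with hz
  have hz0z : D ^ ((1 - η) * (2 / 15)) ≤ z := Real.rpow_le_rpow_of_exponent_le hD.le (by linarith)
  have hz2 : 2 ≤ z := by linarith
  have hlD : 0 < Real.log D := Real.log_pos hD
  have hK3 : (P.card : ℝ) ^ 3 ≤ N ^ 3 := by gcongr
  -- K/m bound
  have hKm : (P.card : ℝ) ^ 3 / m ≤ N ^ 3 * L ^ 2 / s := by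
    rw [← hs2, div_le_div_iff₀ (by positivity) hs0]
    calc (P.card : ℝ) ^ 3 * s ≤ N ^ 3 * s := by gcongr
      _ = N ^ 3 * 1 * (s * 1) := by ring
      _ ≤ N ^ 3 * L ^ 2 * (s * s) := by
          gcongr
          nlinarith
      _ = _ := by ring
  set E : ℝ := 4 * N ^ 3 * L ^ 2 / s with hEdef
  have hE0 : 0 ≤ E := by positivity
  have hEsplit : E = 3 * N ^ 3 * L ^ 2 / s + N ^ 3 * L ^ 2 / s := by rw [hEdef]; ring
  have hE : ∀ b : (ZMod m)ˣ, ∀ d : ℕ, 0 < d → |cnt m P a b (N / d) - (P.card : ℝ) ^ 3 * N / m / d| ≤ E := by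
    intro b d hd
    have hd' : (0 : ℝ) < d := by exact_mod_cast hd
    have k1 := cnt_dist' m N P hP a b (N / d) (Nat.div_le_self _ _) L h1 h2 h3 h4 hmN
    have f1 : ((N / d : ℕ) : ℝ) ≤ N / d := Nat.cast_div_le
    have f2 : (N : ℝ) / d ≤ (N / d : ℕ) + 1 := by
      rw [div_le_iff₀ hd']
      have : N < (N / d + 1) * d := by
        have := Nat.lt_div_mul_add hd (a := N)
        nlinarith
      exact_mod_cast this.le
    have k2 : |(P.card : ℝ) ^ 3 * (N / d : ℕ) / m - (P.card : ℝ) ^ 3 * N / m / d| ≤ N ^ 3 * L ^ 2 / s := by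
      refine le_trans ?_ hKm
      have : (P.card : ℝ) ^ 3 * (N / d : ℕ) / m - (P.card : ℝ) ^ 3 * N / m / d =
        (P.card : ℝ) ^ 3 / m * ((N / d : ℕ) - N / d) := by field_simp
      rw [this, abs_mul, abs_of_nonneg (by positivity)]
      apply mul_le_of_le_one_right (by positivity)
      rw [abs_le]; constructor <;> linarith
    have := abs_sub_le (cnt m P a b (N / d)) ((P.card : ℝ) ^ 3 * (N / d : ℕ) / m) ((P.card : ℝ) ^ 3 * N / m / d)
    rw [hEsplit]
    linarith
  have hS1 : an m P a 1 ≤ E := by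
    rw [an_one]
    have k1 := cnt_dist' m N P hP a 1 1 hN L h1 h2 h3 h4 hmN
    rw [Units.val_one, Nat.cast_one, mul_one] at k1
    have := (abs_le.1 k1).2
    rw [hEsplit]; linarith
  have hS2 : ∑ q ∈ (primesIn z (N + 1)).filter (fun q => q.Coprime m),
      cnt m P a ((q ^ 2 : ℕ) : ZMod m) (N / q ^ 2) ≤ 4 * N ^ 4 * L / m / z + 2 * N ^ 3 * L ^ 2 / s := by
    calc _ ≤ ∑ q ∈ (primesIn z (N + 1)).filter (fun q => q.Coprime m),
          (2 * N ^ 4 * L / m * (1 / (q : ℝ) ^ 2) + 2 * N ^ 3 * L / s * (1 / (q : ℝ))) := by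
          apply Finset.sum_le_sum
          intro q hq
          rw [Finset.mem_filter, mem_primesIn] at hq
          have hq0 : (0 : ℝ) < q := by exact_mod_cast hq.1.1.pos
          have := cnt_sq' m N P hP a (ZMod.unitOfCoprime (q ^ 2) (Nat.Coprime.pow_left 2 hq.2)) (N / q ^ 2)
            (Nat.div_le_self _ _) q hq0 (by exact_mod_cast Nat.cast_div_le (m := N) (n := q ^ 2) (α := ℝ)) L h4 hmN
          rw [ZMod.coe_unitOfCoprime] at this
          exact this
      _ = 2 * N ^ 4 * L / m * ∑ q ∈ (primesIn z (N + 1)).filter (fun q => q.Coprime m), 1 / (q : ℝ) ^ 2 +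
          2 * N ^ 3 * L / s * ∑ q ∈ (primesIn z (N + 1)).filter (fun q => q.Coprime m), 1 / (q : ℝ) := by
          rw [Finset.sum_add_distrib, Finset.mul_sum, Finset.mul_sum]
      _ ≤ 2 * N ^ 4 * L / m * (2 / z) + 2 * N ^ 3 * L / s * L := by
          have g1 := sum_inv_primes_sq (fun q => q.Coprime m) z hz2 N
          have g2 := sum_inv_primes (fun q => q.Coprime m) z N
          have g3 : Real.log N ≤ Real.log (N + 1) := Real.log_le_log hN0 (by linarith)
          have g4 : ∑ q ∈ (primesIn z (N + 1)).filter (fun q => q.Coprime m), 1 / (q : ℝ) ≤ L := by linarith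
          gcongr
      _ = _ := by ring
  have hlamp : 0 < (l : ℝ) + 2 - (θ + 0.01) := by linarith
  refine core_find m N P a ((P.card : ℝ) ^ 3) E (by positivity) hE0 hE D η (1 / ((l : ℝ) + 2 - (θ + 0.01)))
    hD hη2 hη1 (by positivity) ?_ hz0 hk (θ + 0.01) (l + 1) ?_ ?_ E _ hS1 hS2 ?_
  · rw [one_div_mul_eq_div, div_le_one hlamp]; linarith
  · rw [Real.log_rpow (by linarith), hη]
    have : (θ + 0.01) * (θ / (θ + 0.01) * Real.log D) = θ * Real.log D := by
      have : θ + 0.01 ≠ 0 := by linarith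
      field_simp
    rw [this]; exact hlN
  · rw [one_div_one_div]; push_cast; ring
  -- main inequality
  have hV := VV_lower (fun p => p.Coprime m) z hz2
  set V := VV (fun p => p.Coprime m) z with hVdef
  have hV0 : 0 < V := VV_pos _ _
  have hlz : Real.log z ≤ L := by
    rw [hz, Real.log_rpow (by linarith)]; linarith
  have hVL : 1 / (L * c3c) ≤ V := by
    rw [div_le_iff₀ (by positivity)]
    refine hV.trans ?_
    gcongr
  have hRHS : (N : ℝ) ^ 4 / m / (6400 * c3c * L ^ 4) ≤ (P.card : ℝ) ^ 3 * N / m * (V * 0.01) := by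
    calc (N : ℝ) ^ 4 / m / (6400 * c3c * L ^ 4) = (N / (4 * L)) ^ 3 * N / m * (1 / (L * c3c) * 0.01) := by
          field_simp; norm_num
      _ ≤ _ := by gcongr
  refine lt_of_lt_of_le ?_ hRHS
  have hl1 : (Real.log D + 5) * (c0c * D) * E ≤ L * (c0c * D) * E := by gcongr
  have hl2 : E + 2 * N ^ 3 * L ^ 2 / s ≤ L * (c0c * D) * (6 * N ^ 3 * L ^ 2 / s) := by
    have : 1 ≤ L * (c0c * D) := by
      have := mul_le_mul hc0 hD.le zero_le_one (by linarith)
      have := mul_le_mul hL1 this (by norm_num) (by linarith)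
      linarith
    have h6 : E + 2 * N ^ 3 * L ^ 2 / s = 6 * N ^ 3 * L ^ 2 / s := by rw [hEdef]; ring
    rw [h6]
    exact le_mul_of_one_le_left (by positivity) this
  have hh1 : L * (c0c * D) * E + L * (c0c * D) * (6 * N ^ 3 * L ^ 2 / s) <
      (N : ℝ) ^ 4 / m / (12800 * c3c * L ^ 4) := by
    have e1 : L * (c0c * D) * E + L * (c0c * D) * (6 * N ^ 3 * L ^ 2 / s) =
      (N : ℝ) ^ 3 / m / (12800 * c3c * L ^ 4) * (128000 * c0c * c3c * L ^ 7 * (D * s)) := by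
      rw [hEdef, ← hs2]; field_simp; ring
    have e2 : (N : ℝ) ^ 4 / m / (12800 * c3c * L ^ 4) = (N : ℝ) ^ 3 / m / (12800 * c3c * L ^ 4) * N := by ring
    rw [e1, e2]
    exact mul_lt_mul_of_pos_left hf1 (by positivity)
  have hh2 : 4 * N ^ 4 * L / m / z < (N : ℝ) ^ 4 / m / (12800 * c3c * L ^ 4) := by
    have hzp : 0 < z := by linarith
    rw [div_lt_div_iff₀ hzp (by positivity)]
    have e : 4 * N ^ 4 * L / m * (12800 * c3c * L ^ 4) = N ^ 4 / m * (51200 * c3c * L ^ 5) := by ring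
    rw [e]
    exact mul_lt_mul_of_pos_left hf2 (by positivity)
  have hh3 : (N : ℝ) ^ 4 / m / (6400 * c3c * L ^ 4) = (N : ℝ) ^ 4 / m / (12800 * c3c * L ^ 4) +
      (N : ℝ) ^ 4 / m / (12800 * c3c * L ^ 4) := by field_simp; norm_num
  rw [hh3]
  linarith


lemma card_PP_lower (m N : ℕ) (hm : m ≠ 0) (hN1 : 1 < N) (L : ℝ) (h2 : 1 + Real.log (N + 1) ≤ L)
    (h3 : (Nat.log 2 (m * N) : ℝ) ≤ L) (hNL : 100 * L ^ 2 ≤ N) :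
    (N : ℝ) / (4 * L) ≤ (PP m N).card := by
  have hN0 : (0 : ℝ) < N := by exact_mod_cast (by omega : 0 < N)
  have hlN : 0 < Real.log N := Real.log_pos (by exact_mod_cast hN1)
  have hlN' : Real.log N ≤ Real.log (N + 1) := Real.log_le_log hN0 (by linarith)
  have hL : 1 ≤ L := by linarith
  have hpi := Chebyshev.pi_ge N
  have hlog2 := Real.log_two_gt_d9
  have hw : (m.primeFactors.card : ℝ) ≤ L := by
    refine le_trans ?_ h3
    have : 2 ^ m.primeFactors.card ≤ m * N := by
      calc 2 ^ m.primeFactors.card ≤ ∏ p ∈ m.primeFactors, p :=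
            Finset.pow_card_le_prod _ _ _ (fun p hp => (Nat.prime_of_mem_primeFactors hp).two_le)
        _ ≤ m := Nat.le_of_dvd (Nat.pos_of_ne_zero hm) (Nat.prod_primeFactors_dvd m)
        _ ≤ m * N := Nat.le_mul_of_pos_right _ (by omega)
    exact_mod_cast Nat.le_log_of_pow_le (by norm_num) this
  have hcard : Nat.primeCounting N ≤ (PP m N).card + m.primeFactors.card := by
    rw [Nat.primeCounting, Nat.primeCounting', Nat.count_eq_card_filter_range]
    refine le_trans (Finset.card_le_card ?_) (Finset.card_union_le _ _)
    intro p hp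
    rw [Finset.mem_filter, Finset.mem_range] at hp
    rw [Finset.mem_union]
    by_cases h : p ∣ m
    · exact Or.inr (Nat.mem_primeFactors.2 ⟨hp.2, h, hm⟩)
    · left
      rw [PP, Finset.mem_filter, Finset.mem_Icc]
      exact ⟨⟨hp.2.one_le, by omega⟩, hp.2, (hp.2.coprime_iff_not_dvd).2 h⟩
  have hcard' : (Nat.primeCounting N : ℝ) ≤ (PP m N).card + m.primeFactors.card := by exact_mod_cast hcard
  have h5 : (N : ℝ) / (2 * L) ≤ (N * Real.log 2 - Real.log (N + 1)) / Real.log N := by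
    rw [div_le_div_iff₀ (by positivity) hlN]
    have : (N : ℝ) / 2 ≤ N * Real.log 2 - Real.log (N + 1) := by nlinarith
    nlinarith
  have h6 : L ≤ (N : ℝ) / (4 * L) := by
    rw [le_div_iff₀ (by positivity)]; nlinarith
  have h7 : (N : ℝ) / (2 * L) = N / (4 * L) + N / (4 * L) := by field_simp; norm_num
  linarith

lemma ev_log_pow (C s : ℝ) (hs : 0 < s) (k : ℕ) :
    ∀ᶠ m : ℕ in Filter.atTop, C * Real.log m ^ k < (m : ℝ) ^ s := by
  have h := (isLittleO_log_rpow_rpow_atTop (k : ℝ) hs).bound (c := 1 / (|C| + 1)) (by positivity)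
  have h' := (tendsto_natCast_atTop_atTop (R := ℝ)).eventually h
  filter_upwards [h', Filter.eventually_ge_atTop 1] with m hm hm1
  have hm0 : (0 : ℝ) < m := by exact_mod_cast hm1
  have hl := Real.log_natCast_nonneg m
  rw [Real.rpow_natCast, Real.norm_of_nonneg (by positivity), Real.norm_of_nonneg (by positivity)] at hm
  have hp : 0 < (m : ℝ) ^ s := Real.rpow_pos_of_pos hm0 s
  have h0 : 0 ≤ Real.log m ^ k := by positivity
  have hC := abs_nonneg C
  have h1 : (|C| + 1) * Real.log m ^ k ≤ (m : ℝ) ^ s := by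
    rw [one_div, inv_mul_eq_div, le_div_iff₀ (by positivity)] at hm
    linarith
  have h2 := le_abs_self C
  rcases h0.eq_or_lt with h | h
  · rw [← h]; linarith
  · nlinarith

lemma natlog_le (n : ℕ) (hn : 1 ≤ n) : (Nat.log 2 n : ℝ) ≤ 2 * Real.log n := by
  have h := Real.natLog_le_logb n 2
  have hl : 0 ≤ Real.log n := Real.log_natCast_nonneg n
  have h2 := Real.log_two_gt_d9
  refine h.trans ?_
  rw [Real.logb, Nat.cast_ofNat, div_le_iff₀ (by linarith)]
  nlinarith

lemma c3c_ge : 1 ≤ c3c := by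
  unfold c3c
  have h1 := Real.log_two_gt_d9
  have h2 := Real.log_two_lt_d9
  rw [le_div_iff₀ (by linarith)]
  have : 1 ≤ Real.exp (19 / Real.log 2) := Real.one_le_exp (by positivity)
  linarith

set_option maxHeartbeats 1000000 in
theorem ev_find (l : ℕ) (θ ε : ℝ) (hθ : 2 ≤ θ) (hθl : 2.07 + θ ≤ l + 2) (hε : 0 < ε) :
    ∀ᶠ m : ℕ in Filter.atTop, ∀ [NeZero m], ∀ a : (ZMod m)ˣ,
      ∃ n, 1 < n ∧ n ≤ ⌊(m : ℝ) ^ (θ / (2 * θ - 2) + ε)⌋₊ ∧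
        an m (PP m ⌊(m : ℝ) ^ (θ / (2 * θ - 2) + ε)⌋₊) a n ≠ 0 ∧ n.primeFactorsList.length ≤ l + 1 := by
  set β := 1 / (2 * θ - 2) with hβ
  have hβ0 : 0 < β := by rw [hβ]; apply div_pos one_pos; linarith
  have hα : θ / (2 * θ - 2) = 1 / 2 + β := by
    rw [hβ]
    have : 2 * θ - 2 ≠ 0 := by linarith
    rw [div_eq_iff this, add_mul, one_div_mul_cancel this]; ring
  have hα2 : θ / (2 * θ - 2) = θ * β := by rw [hβ]; ring
  set B := θ / (2 * θ - 2) + ε with hB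
  have hB0 : 1 / 2 < B := by rw [hB, hα]; linarith
  set A := 10 * (1 + B) with hA
  set δ := β + ε / 2 with hδ
  have hδ0 : 0 < δ := by positivity
  have hδB : δ ≤ B := by rw [hB, hα]; linarith
  set e0 := (1 - θ / (θ + 0.01)) * (2 / 15) with he0
  have he0p : 0 < e0 := by
    have : θ / (θ + 0.01) < 1 := by rw [div_lt_one (by linarith)]; linarith
    rw [he0]; apply mul_pos <;> linarith
  have hc0 := c0c_ge
  have hc3 := c3c_ge
  have t1 : Filter.Tendsto (fun m : ℕ => Real.log m) Filter.atTop Filter.atTop :=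
    Real.tendsto_log_atTop.comp tendsto_natCast_atTop_atTop
  filter_upwards [ev_log_pow (2 * (128000 * c0c * c3c * A ^ 7)) (ε / 2) (by positivity) 7,
    ev_log_pow (51200 * c3c * A ^ 5) (δ * (2 / 17)) (by positivity) 5,
    t1.eventually_ge_atTop 10, t1.eventually_ge_atTop (38000 / (e0 * δ)), Filter.eventually_ge_atTop 2]
    with m g1 g2 g3 g4 g5
  intro _ a
  have hm0 : (0 : ℝ) < m := by exact_mod_cast (by omega : 0 < m)
  have hm1 : (1 : ℝ) ≤ m := by exact_mod_cast (by omega : 1 ≤ m)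
  set t := Real.log m with ht
  set x := (m : ℝ) ^ B with hx
  set N := ⌊x⌋₊ with hN
  have hxl : Real.log x = B * t := Real.log_rpow hm0 _
  have hx0 : 0 < x := Real.rpow_pos_of_pos hm0 _
  have hx2 : 2 ≤ x := by
    rw [← Real.log_le_log_iff (by norm_num) hx0, hxl]
    have := Real.log_two_lt_d9
    have := mul_le_mul hB0.le g3 (by norm_num) (by linarith)
    linarith
  have hNx : (N : ℝ) ≤ x := Nat.floor_le hx0.le
  have hxN : x / 2 ≤ N := by
    have := Nat.lt_floor_add_one x
    have h1 : (1 : ℕ) ≤ N := Nat.le_floor (by push_cast; linarith)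
    have h1' : (1 : ℝ) ≤ N := by exact_mod_cast h1
    linarith
  have hN1 : 1 ≤ N := Nat.le_floor (by push_cast; linarith)
  have hN0 : (0 : ℝ) < N := by exact_mod_cast hN1
  have hlN : Real.log N ≤ B * t := by rw [← hxl]; exact Real.log_le_log hN0 hNx
  have hBt : 5 ≤ B * t := by
    have := mul_le_mul hB0.le g3 (by norm_num) (by linarith)
    linarith
  set D := (m : ℝ) ^ δ with hD
  have hlD : Real.log D = δ * t := Real.log_rpow hm0 _
  have hD1 : 1 < D := Real.one_lt_rpow (by exact_mod_cast (by omega : 1 < m)) hδ0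
  set L := A * t with hL
  have hLe : L = 10 * t + 10 * (B * t) := by rw [hL, hA]; ring
  have hL1 : 1 ≤ L := by linarith
  have b1 : 1 + Real.log m ≤ L := by rw [← ht]; linarith
  have b2 : 1 + Real.log (N + 1) ≤ L := by
    have : Real.log ((N : ℝ) + 1) ≤ Real.log (2 * N) := by
      apply Real.log_le_log (by linarith)
      have : (1 : ℝ) ≤ N := by exact_mod_cast hN1
      linarith
    rw [Real.log_mul (by norm_num) hN0.ne'] at this
    have := Real.log_two_lt_d9
    linarith
  have b3 : (Nat.log 2 (m * N) : ℝ) ≤ L := by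
    refine (natlog_le _ (Nat.mul_pos (by omega) hN1)).trans ?_
    rw [Nat.cast_mul, Real.log_mul hm0.ne' hN0.ne', ← ht]
    linarith
  have b4 : (Nat.log 2 (N * N) : ℝ) ≤ L := by
    refine (natlog_le _ (Nat.mul_pos hN1 hN1)).trans ?_
    rw [Nat.cast_mul, Real.log_mul hN0.ne' hN0.ne']
    linarith
  have hsq : Real.sqrt m = (m : ℝ) ^ (1 / 2 : ℝ) := Real.sqrt_eq_rpow _
  have hf1 : 128000 * c0c * c3c * L ^ 7 * (D * Real.sqrt m) < N := by
    have e1 : x = (m : ℝ) ^ (ε / 2) * (D * Real.sqrt m) := by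
      rw [hx, hD, hsq, ← Real.rpow_add hm0, ← Real.rpow_add hm0, hB, hα, hδ]
      congr 1; ring
    have hDs : 0 < D * Real.sqrt m := mul_pos (by linarith) (Real.sqrt_pos.2 hm0)
    have e2 : 2 * (128000 * c0c * c3c * L ^ 7 * (D * Real.sqrt m)) =
      2 * (128000 * c0c * c3c * A ^ 7) * t ^ 7 * (D * Real.sqrt m) := by rw [hL]; ring
    have e3 := mul_lt_mul_of_pos_right g1 hDs
    rw [← e1, ← e2] at e3
    linarith
  have hs1 : 1 ≤ Real.sqrt m := Real.one_le_sqrt.2 hm1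
  have hcc : 1 ≤ c0c * c3c := one_le_mul_of_one_le_of_one_le hc0 hc3
  have hNL : 128000 * L ^ 7 ≤ N ∧ Real.sqrt m ≤ N := by
    have hL7 : 1 ≤ L ^ 7 := one_le_pow₀ hL1
    have q1 : 1 ≤ D * Real.sqrt m := one_le_mul_of_one_le_of_one_le hD1.le hs1
    have q2 : Real.sqrt m ≤ D * Real.sqrt m := le_mul_of_one_le_left (by linarith) hD1.le
    constructor
    · refine le_trans ?_ hf1.le
      calc 128000 * L ^ 7 = 128000 * L ^ 7 * 1 * 1 := by ring
        _ ≤ 128000 * L ^ 7 * (c0c * c3c) * (D * Real.sqrt m) := by gcongr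
        _ = _ := by ring
    · refine le_trans ?_ hf1.le
      calc Real.sqrt m ≤ 1 * 1 * 1 * (D * Real.sqrt m) := by linarith
        _ ≤ 128000 * (c0c * c3c) * L ^ 7 * (D * Real.sqrt m) := by
          gcongr
          norm_num
        _ = _ := by ring
  have hmN : (m : ℝ) ≤ N ^ 2 := by
    rw [← Real.sq_sqrt hm0.le]
    have := hNL.2
    gcongr
  have hNL2 : 100 * L ^ 2 ≤ N := by
    refine le_trans ?_ hNL.1
    have : L ^ 2 ≤ L ^ 7 := pow_le_pow_right₀ hL1 (by norm_num)
    linarith [sq_nonneg L]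
  have hN2 : 1 < N := by
    have : (1 : ℝ) < N := by linarith [one_le_pow₀ hL1 (n := 2)]
    exact_mod_cast this
  have hlz0 : Real.log (D ^ e0) = e0 * (δ * t) := by
    rw [Real.log_rpow (by linarith), hlD]
  have hlz0b : 38000 ≤ Real.log (D ^ e0) := by
    rw [hlz0]
    rw [div_le_iff₀ (by positivity)] at g4
    linarith
  have hlz0c : 38000 ≤ Real.log (D ^ ((1 - θ / (θ + 0.01)) * (2 / 15))) := hlz0b
  refine fixed_find m N a L D θ l b1 b2 b3 b4 hmN hN1
    (card_PP_lower m N (by omega) hN2 L b2 b3 hNL2) hD1 ?_ hθ hθl ?_ ?_ ?_ hf1 ?_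
  · rw [hlD]
    have := mul_le_mul_of_nonneg_right hδB (by linarith : 0 ≤ t)
    linarith
  · rw [hlD]
    refine hlN.trans ?_
    rw [← mul_assoc]
    apply mul_le_mul_of_nonneg_right _ (by linarith)
    rw [hB, hα2, hδ]
    have := mul_le_mul_of_nonneg_right hθ hε.le
    linarith
  · rw [wc, ← Real.le_log_iff_exp_le (Real.rpow_pos_of_pos (by linarith) _)]
    linarith [hlz0c]
  · rw [div_le_iff₀ (by linarith [hlz0c])]
    linarith [hlz0c]
  · have e1 : D ^ (2 / 17 : ℝ) = (m : ℝ) ^ (δ * (2 / 17)) := by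
      rw [hD, ← Real.rpow_mul hm0.le]
    rw [e1]
    refine lt_of_eq_of_lt ?_ g2
    rw [hL]; ring

theorem stmt_7 (l : ℕ) (hl : 3 ≤ l) (α : ℝ)
    (hα : α = greavesTheta l / (2 * greavesTheta l - 2)) :
    ∀ ε : ℝ, 0 < ε → ∃ M : ℕ, ∀ m : ℕ, M ≤ m → ∀ a : ℤ, Int.gcd a m = 1 →
      ∃ p₁ p₂ p₃ p₄ s : ℕ, p₁.Prime ∧ p₂.Prime ∧ p₃.Prime ∧ p₄.Prime ∧
        (p₁ : ℝ) ≤ (m : ℝ) ^ (α + ε) ∧ (p₂ : ℝ) ≤ (m : ℝ) ^ (α + ε) ∧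
        (p₃ : ℝ) ≤ (m : ℝ) ^ (α + ε) ∧ (p₄ : ℝ) ≤ (m : ℝ) ^ (α + ε) ∧
        0 < s ∧ (s : ℝ) ≤ (m : ℝ) ^ (α + ε) ∧ s.primeFactorsList.length ≤ l ∧
        ((p₁ * p₂ * p₃ * p₄ * s : ℕ) : ℤ) ≡ a [ZMOD (m : ℤ)] := by
  have hδ : 0.07 ≤ greavesDelta l ∧ greavesDelta l ≤ 0.2 := by
    unfold greavesDelta
    split_ifs <;> first | omega | (constructor <;> norm_num)
  have hl3 : (3 : ℝ) ≤ l := by exact_mod_cast hl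
  have hθ : 2 ≤ greavesTheta l := by unfold greavesTheta; linarith [hδ.2]
  have hθl : 2.07 + greavesTheta l ≤ l + 2 := by unfold greavesTheta; linarith [hδ.1]
  intro ε hε
  obtain ⟨M, hM⟩ := Filter.eventually_atTop.1 (ev_find l (greavesTheta l) ε hθ hθl hε)
  refine ⟨max M 2, fun m hm a ha => ?_⟩
  have hm2 : 2 ≤ m := le_trans (le_max_right _ _) hm
  haveI : NeZero m := ⟨by omega⟩
  have hau : IsUnit ((a : ℤ) : ZMod m) := by
    rw [ZMod.coe_int_isUnit_iff_isCoprime]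
    exact (Int.isCoprime_iff_gcd_eq_one.2 ha).symm
  obtain ⟨u, hu⟩ := hau
  obtain ⟨n, hn1, hnN, hn, hlen⟩ := hM m (le_trans (le_max_left _ _) hm) u
  rw [← hα] at hnN hn
  obtain ⟨p, hp, p', hp', p'', hp'', heq⟩ := an_pos _ _ _ _ hn
  have hx0 : 0 ≤ (m : ℝ) ^ (α + ε) := Real.rpow_nonneg (by positivity) _
  have hle : ∀ k : ℕ, k ≤ ⌊(m : ℝ) ^ (α + ε)⌋₊ → (k : ℝ) ≤ (m : ℝ) ^ (α + ε) := fun k hk =>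
    le_trans (by exact_mod_cast hk) (Nat.floor_le hx0)
  have hq : n.minFac.Prime := Nat.minFac_prime (by omega)
  obtain ⟨s, hs⟩ := Nat.minFac_dvd n
  have hs0 : 0 < s := by
    rcases Nat.eq_zero_or_pos s with h | h
    · rw [h, mul_zero] at hs; omega
    · exact h
  have hsn : s ≤ n := by
    conv_rhs => rw [hs]
    exact Nat.le_mul_of_pos_left _ hq.pos
  have hqn : n.minFac ≤ n := Nat.minFac_le (by omega)
  have hlens : s.primeFactorsList.length ≤ l := by
    have h1 : n.primeFactorsList.length = (n.minFac.primeFactorsList ++ s.primeFactorsList).length := by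
      rw [← (Nat.perm_primeFactorsList_mul hq.ne_zero hs0.ne').length_eq, ← hs]
    rw [List.length_append, Nat.primeFactorsList_prime hq, List.length_singleton] at h1
    omega
  refine ⟨p, p', p'', n.minFac, s, (mem_PP hp).1, (mem_PP hp').1, (mem_PP hp'').1, hq,
    hle _ (mem_PP hp).2.1, hle _ (mem_PP hp').2.1, hle _ (mem_PP hp'').2.1, hle _ (hqn.trans hnN),
    hs0, hle _ (hsn.trans hnN), hlens, ?_⟩
  rw [← ZMod.intCast_eq_intCast_iff]
  have e : p * p' * p'' * n.minFac * s = n * p * (p' * p'') := by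
    conv_rhs => rw [hs]
    ring
  rw [e, ← hu, ← heq]
  push_cast
  ring
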